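/- There is a bijection Φ_ξ from the quotient set {(Σ_{j=1}^{k_i} A^(i)_j x^{−j})_{0≤i≤p} ∈ ∏_{i=0}^{p} O_{B^(i)} : Σ_{i=0}^{p} A^(i)_1 = 0}/GL(n,ℂ) onto the quotient set Rep(Q̄,α)_λ^dif/∏_{a∈Q_0} GL(α_a,ℂ). -/

import Mathlib

open Polynomial Matrix BigOperators

namespace DS

noncomputable section

/-- The data of a collection of HTL normal forms `B⁽ⁱ⁾`, `i = 0,…,p`, on `ℂⁿ`:
block counts `m i`, pole orders `kk i`, block sizes `nn i j`, irregular parts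
`q i j ∈ s²ℂ[s]` (pairwise distinct, degree ≤ kk i), residue blocks `R i j`,
chosen annihilating eigenvalue lists `ξ i j`, and an identification of
`Σ j, Fin (nn i j)` with `Fin n` (the block decomposition of `ℂⁿ`). -/
structure Setup where
  p : ℕ
  n : ℕ
  hn : 0 < n
  m : Fin (p+1) → ℕ
  hm : ∀ i, 0 < m i
  kk : Fin (p+1) → ℕ
  hkk : ∀ i, 0 < kk i
  nn : ∀ i : Fin (p+1), Fin (m i) → ℕ
  q : ∀ i : Fin (p+1), Fin (m i) → Polynomial ℂ
  hq0 : ∀ i j, (q i j).coeff 0 = 0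
  hq1 : ∀ i j, (q i j).coeff 1 = 0
  hqdeg : ∀ i j, (q i j).natDegree ≤ kk i
  hqdist : ∀ i : Fin (p+1), ∀ j j' : Fin (m i), j ≠ j' → q i j ≠ q i j'
  e : ∀ i : Fin (p+1), Fin (m i) → ℕ
  he : ∀ i j, 0 < e i j
  xi : ∀ (i : Fin (p+1)) (j : Fin (m i)), Fin (e i j) → ℂ
  R : ∀ (i : Fin (p+1)) (j : Fin (m i)), Matrix (Fin (nn i j)) (Fin (nn i j)) ℂ
  hxi : ∀ i j, (((List.finRange (e i j)).map fun l => R i j - xi i j l • 1).prod) = 0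
  emb : ∀ i : Fin (p+1), (Σ j : Fin (m i), Fin (nn i j)) ≃ Fin n
  hreg : ∀ i : Fin (p+1), ¬ (1 < m i ∨ i = 0) → kk i = 1

/-- `i ∈ I_irr` : the indices of irregular singular points together with `0`. -/
def Iirr (S : Setup) (i : Fin (S.p+1)) : Prop := 1 < S.m i ∨ i = 0

instance (S : Setup) : DecidablePred (Iirr S) := fun i =>
  inferInstanceAs (Decidable (1 < S.m i ∨ i = 0))

/-- Vertices `[i,j]` for `i ∈ I_irr`. -/
abbrev Vb (S : Setup) := Σ i : {i : Fin (S.p+1) // Iirr S i}, Fin (S.m i.1)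

/-- Vertices `[i,j,k]` for `0 ≤ i ≤ p`, `1 ≤ j ≤ m⁽ⁱ⁾`, `1 ≤ k ≤ e[i,j]-1`
(the third component `κ` encodes `k = κ+1`). -/
abbrev Vr (S : Setup) := Σ i : Fin (S.p+1), Σ j : Fin (S.m i), Fin (S.e i j - 1)

/-- The vertex set `Q₀` of the quiver `Q`. -/
abbrev V (S : Setup) := Vb S ⊕ Vr S

/-- `d_i(j,j') = deg (q_j - q_j') - 2`. -/
def dcnt (S : Setup) (i : Fin (S.p+1)) (j j' : Fin (S.m i)) : ℕ :=
  (S.q i j - S.q i j').natDegree - 2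

/-- The number of arrows of `Q` from a vertex `a` to a vertex `b`. -/
def arr (S : Setup) : V S → V S → ℕ
  | .inl ⟨i, j⟩, .inl ⟨i', j'⟩ =>
      (if i.1 = 0 ∧ i'.1 ≠ 0 then 1 else 0) +
      (if h : i = i' then
        (if (j : ℕ) < (j' : ℕ) then dcnt S i.1 j (Fin.cast (by rw [h]) j') else 0)
       else 0)
  | .inl _, .inr _ => 0
  | .inr ⟨i, j, κ⟩, .inl ⟨i', j'⟩ =>
      (if i = i'.1 ∧ (j : ℕ) = (j' : ℕ) ∧ (κ : ℕ) = 0 then 1 else 0) +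
      (if ¬ Iirr S i ∧ i'.1 = 0 ∧ (j : ℕ) = 0 ∧ (κ : ℕ) = 0 then 1 else 0)
  | .inr ⟨i, j, κ⟩, .inr ⟨i', j', κ'⟩ =>
      if i = i' ∧ (j : ℕ) = (j' : ℕ) ∧ (κ : ℕ) = (κ' : ℕ) + 1 then 1 else 0

/-- The Euler form `⟨β,γ⟩` of the quiver `Q`. -/
def eform (S : Setup) (β γ : V S → ℤ) : ℤ :=
  (∑ a : V S, β a * γ a) - ∑ a : V S, ∑ b : V S, (arr S a b : ℤ) * β a * γ b

/-- The symmetrized bilinear form `(β,γ)`. -/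
def bform (S : Setup) (β γ : V S → ℤ) : ℤ := eform S β γ + eform S γ β

/-- The quadratic form `q(β)`. -/
def qform (S : Setup) (β : V S → ℤ) : ℤ := eform S β β

/-- `p(β) = 1 - q(β)`. -/
def pform (S : Setup) (β : V S → ℤ) : ℤ := 1 - qform S β

/-- The coordinate vector `ε_a`. -/
def eps (S : Setup) (a : V S) : V S → ℤ := fun b => if b = a then 1 else 0

/-- The fundamental reflection `s_a`. -/
def refl1 (S : Setup) (a : V S) (β : V S → ℤ) : V S → ℤ :=
  fun b => β b - bform S β (eps S a) * eps S a b

/-- Iterated fundamental reflections (a Weyl group element). -/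
def reflList (S : Setup) (l : List (V S)) (β : V S → ℤ) : V S → ℤ :=
  l.foldr (refl1 S) β

/-- The support of a vector. -/
def supp (S : Setup) (β : V S → ℤ) : Set (V S) := {a | β a ≠ 0}

/-- The support of `β` is connected in the underlying graph of `Q`. -/
def connSupp (S : Setup) (β : V S → ℤ) : Prop :=
  ∀ a ∈ supp S β, ∀ b ∈ supp S β,
    Relation.ReflTransGen
      (fun x y => (0 < arr S x y + arr S y x) ∧ x ∈ supp S β ∧ y ∈ supp S β) a b

/-- The fundamental set of the root system of `Q` (all vertices of `Q` are loop-free). -/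
def fund (S : Setup) (β : V S → ℤ) : Prop :=
  β ≠ 0 ∧ (∀ a, 0 ≤ β a) ∧ connSupp S β ∧ ∀ a : V S, bform S β (eps S a) ≤ 0

/-- Real roots of `Q`. -/
def isRealRoot (S : Setup) (β : V S → ℤ) : Prop :=
  ∃ (l : List (V S)) (a : V S), β = reflList S l (eps S a)

/-- Imaginary roots of `Q`. -/
def isImagRoot (S : Setup) (β : V S → ℤ) : Prop :=
  ∃ (l : List (V S)) (γ : V S → ℤ), (fund S γ ∨ fund S (-γ)) ∧ β = reflList S l γ

/-- Roots of `Q`. -/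
def isRoot (S : Setup) (β : V S → ℤ) : Prop := isRealRoot S β ∨ isImagRoot S β

/-- Positive roots of `Q`. -/
def isPosRoot (S : Setup) (β : V S → ℤ) : Prop := isRoot S β ∧ ∀ a, 0 ≤ β a

/-- The index `0` as an element of `I_irr`. -/
def i0 (S : Setup) : {i : Fin (S.p+1) // Iirr S i} := ⟨0, Or.inr rfl⟩

/-- The vertex `[0,j]`. -/
def v0 (S : Setup) (j : Fin (S.m 0)) : V S := Sum.inl ⟨i0 S, j⟩

/-- The vertex `[i,j]` for `i ∈ I_irr`. -/
def vI (S : Setup) (i : {i : Fin (S.p+1) // Iirr S i}) (j : Fin (S.m i.1)) : V S :=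
  Sum.inl ⟨i, j⟩

/-- The lattice `L`: `Σ_j β_[0,j] = Σ_j β_[i,j]` for all `i ∈ I_irr ∖ {0}`. -/
def inL (S : Setup) (β : V S → ℤ) : Prop :=
  ∀ i : {i : Fin (S.p+1) // Iirr S i}, i.1 ≠ 0 →
    (∑ j : Fin (S.m 0), β (v0 S j)) = ∑ j : Fin (S.m i.1), β (vI S i j)

/-- `L⁺ = L ∩ (ℤ≥0)^{Q₀}`. -/
def inLpos (S : Setup) (β : V S → ℤ) : Prop := inL S β ∧ ∀ a, 0 ≤ β a

/-- The dimension vector `α` (as natural numbers):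
`α_[i,j] = n⁽ⁱ⁾_j`, `α_[i,j,k] = rank ∏_{l=1}^k (R⁽ⁱ⁾_j - ξ^{[i,j]}_l)`. -/
noncomputable def alN (S : Setup) : V S → ℕ
  | .inl ⟨i, j⟩ => S.nn i.1 j
  | .inr ⟨i, j, κ⟩ =>
      ((((List.finRange (S.e i j)).take ((κ : ℕ) + 1)).map
          fun l => S.R i j - S.xi i j l • 1).prod).rank

/-- The dimension vector `α` as an integer vector. -/
noncomputable def alZ (S : Setup) : V S → ℤ := fun a => (alN S a : ℤ)

/-- The parameter `λ ∈ ℂ^{Q₀}`. -/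
noncomputable def lam (S : Setup) : V S → ℂ
  | .inl ⟨i, j⟩ =>
      if h : i.1 = 0 then
        (- S.xi 0 (Fin.cast (by rw [h]) j) ⟨0, S.he 0 (Fin.cast (by rw [h]) j)⟩)
          - ∑ i' ∈ Finset.univ.filter (fun i' : Fin (S.p+1) => ¬ Iirr S i'),
              S.xi i' ⟨0, S.hm i'⟩ ⟨0, S.he i' ⟨0, S.hm i'⟩⟩
      else - S.xi i.1 j ⟨0, S.he i.1 j⟩
  | .inr ⟨i, j, κ⟩ =>
      S.xi i j ⟨(κ : ℕ), by have := κ.2; omega⟩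
        - S.xi i j ⟨(κ : ℕ) + 1, by have := κ.2; omega⟩

/-- Pairing `β · μ = Σ_a β_a μ_a` between `ℤ^{Q₀}` and `ℂ^{Q₀}`. -/
noncomputable def dotC (S : Setup) (β : V S → ℤ) (μ : V S → ℂ) : ℂ :=
  ∑ a : V S, (β a : ℂ) * μ a

/-- `β ∈ R̃⁺_μ` : positive roots of `Q` lying in `L` with `β·μ = 0`. -/
def inRt (S : Setup) (μ : V S → ℂ) (β : V S → ℤ) : Prop :=
  isPosRoot S β ∧ inL S β ∧ dotC S β μ = 0

/-- `β ∈ ℕR̃⁺_μ` : finite sums (including `0`) of elements of `R̃⁺_μ`. -/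
def inNRt (S : Setup) (μ : V S → ℂ) (β : V S → ℤ) : Prop :=
  ∃ (r : ℕ) (γ : Fin r → (V S → ℤ)), (∀ t, inRt S μ (γ t)) ∧ β = ∑ t, γ t

/-- `β ∈ Σ̃_μ`. -/
def inSig (S : Setup) (μ : V S → ℂ) (β : V S → ℤ) : Prop :=
  inRt S μ β ∧ ∀ (r : ℕ), 2 ≤ r → ∀ γ : Fin r → (V S → ℤ),
    (∀ t, inRt S μ (γ t)) → β = ∑ t, γ t → (∑ t, pform S (γ t)) < pform S β

/-! ### The matrix side: truncated orbits.

An element `Σ_{j=1}^{k} A_j x^{-j}` of `𝔤_k*` is encoded as the polynomial matrix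
`Σ_{j=1}^{k} A_j x^{k-j}` (of degree `< k`); the coadjoint `G_k`-action becomes
conjugation modulo `x^k` by polynomial matrices with invertible constant term. -/

abbrev PMat (S : Setup) := Matrix (Fin S.n) (Fin S.n) (Polynomial ℂ)

/-- All entries have degree `< k`. -/
def degLT (S : Setup) (k : ℕ) (A : PMat S) : Prop :=
  ∀ a b, (A a b).degree < (k : ℕ)

/-- The HTL normal form `B⁽ⁱ⁾`, in the polynomial encoding. -/
noncomputable def Bmat (S : Setup) (i : Fin (S.p+1)) : PMat S :=
  Matrix.of fun a b =>
    if h : ((S.emb i).symm a).1 = ((S.emb i).symm b).1 then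
      (if Fin.cast (by rw [h]) ((S.emb i).symm a).2 = ((S.emb i).symm b).2 then
          Polynomial.reflect (S.kk i) (S.q i ((S.emb i).symm b).1)
        else 0)
        + Polynomial.C
            (S.R i ((S.emb i).symm b).1 (Fin.cast (by rw [h]) ((S.emb i).symm a).2)
              ((S.emb i).symm b).2)
          * Polynomial.X ^ (S.kk i - 1)
    else 0

/-- Membership in the truncated orbit `𝒪_{B⁽ⁱ⁾}`. -/
def inOrbit (S : Setup) (i : Fin (S.p+1)) (A : PMat S) : Prop :=
  degLT S (S.kk i) A ∧
  ∃ g : PMat S, IsUnit (g.map fun r => r.coeff 0) ∧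
    ∀ a b, (Polynomial.X ^ (S.kk i) : Polynomial ℂ) ∣ (g * Bmat S i - A * g) a b

/-- The residue matrix `A⁽ⁱ⁾₁`. -/
def resMat (S : Setup) (i : Fin (S.p+1)) (A : PMat S) : Matrix (Fin S.n) (Fin S.n) ℂ :=
  Matrix.of fun a b => (A a b).coeff (S.kk i - 1)

/-- `(A⁽ⁱ⁾)_{0≤i≤p} ∈ ∏ 𝒪_{B⁽ⁱ⁾}` with `Σ A⁽ⁱ⁾₁ = 0`. -/
def isDSElem (S : Setup) (A : ∀ _ : Fin (S.p+1), PMat S) : Prop :=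
  (∀ i, inOrbit S i (A i)) ∧ (∑ i, resMat S i (A i)) = 0

/-- Irreducibility of the collection of all coefficient matrices `A⁽ⁱ⁾_j`. -/
def irredTuple (S : Setup) (A : ∀ _ : Fin (S.p+1), PMat S) : Prop :=
  ∀ W : Submodule ℂ (Fin S.n → ℂ),
    (∀ (i : Fin (S.p+1)) (l : ℕ), ∀ v ∈ W,
        (Matrix.of fun a b => (A i a b).coeff l).mulVec v ∈ W) →
    W = ⊥ ∨ W = ⊤

/-! ### Representations of the double quiver -/

/-- A representation of the double quiver `Q̄` with dimension vector `β`: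
`f a b ρ` is the matrix of `ψ_ρ : ℂ^{β a} → ℂ^{β b}` and `g a b ρ` the matrix of
`ψ_{ρ*} : ℂ^{β b} → ℂ^{β a}`, for the `ρ`-th arrow `a → b` of `Q`. -/
structure Rep (S : Setup) (β : V S → ℕ) where
  f : ∀ a b : V S, Fin (arr S a b) → Matrix (Fin (β b)) (Fin (β a)) ℂ
  g : ∀ a b : V S, Fin (arr S a b) → Matrix (Fin (β a)) (Fin (β b)) ℂ

/-- The moment map at a vertex `c`. -/
noncomputable def moment (S : Setup) {β : V S → ℕ} (M : Rep S β) (c : V S) :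
    Matrix (Fin (β c)) (Fin (β c)) ℂ :=
  (∑ a : V S, ∑ ρ : Fin (arr S a c), M.f a c ρ * M.g a c ρ)
    - ∑ b : V S, ∑ ρ : Fin (arr S c b), M.g c b ρ * M.f c b ρ

/-- `M ∈ Rep(Q̄,β)_μ`. -/
def onMu (S : Setup) {β : V S → ℕ} (μ : V S → ℂ) (M : Rep S β) : Prop :=
  ∀ c : V S, moment S M c = μ c • (1 : Matrix (Fin (β c)) (Fin (β c)) ℂ)

/-- The block matrix `(ψ_{ρ^{[0,j]}_{[i,j']}})_{j,j'}` for `i ∈ I_irr ∖ {0}`. -/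
noncomputable def crossMat (S : Setup) {β : V S → ℕ} (M : Rep S β)
    (i : {i : Fin (S.p+1) // Iirr S i}) :
    Matrix (Σ j' : Fin (S.m i.1), Fin (β (vI S i j'))) (Σ j : Fin (S.m 0), Fin (β (v0 S j))) ℂ :=
  Matrix.of fun x y =>
    if h : 0 < arr S (v0 S y.1) (vI S i x.1) then
      M.f (v0 S y.1) (vI S i x.1) ⟨0, h⟩ x.2 y.2
    else 0

/-- All the block matrices `(ψ_{ρ^{[0,j]}_{[i,j']}})` for `i ∈ I_irr ∖ {0}` are invertible. -/
def crossBij (S : Setup) {β : V S → ℕ} (M : Rep S β) : Prop :=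
  ∀ i : {i : Fin (S.p+1) // Iirr S i}, i.1 ≠ 0 →
    Function.Bijective ((crossMat S M i).mulVec)

/-- The combined map `(ψ_{ρ^{[i,1,1]}_{[0,j]}})_j : ℂ^{β [i,1,1]} → ⊕_j ℂ^{β [0,j]}`
(for `i ∈ I_reg`). -/
noncomputable def regMatF (S : Setup) {β : V S → ℕ} (M : Rep S β)
    (i : Fin (S.p+1)) (j : Fin (S.m i)) (κ : Fin (S.e i j - 1)) :
    Matrix (Σ j' : Fin (S.m 0), Fin (β (v0 S j'))) (Fin (β (Sum.inr ⟨i, j, κ⟩))) ℂ :=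
  Matrix.of fun x y =>
    if h : 0 < arr S (Sum.inr ⟨i, j, κ⟩) (v0 S x.1) then
      M.f (Sum.inr ⟨i, j, κ⟩) (v0 S x.1) ⟨0, h⟩ x.2 y
    else 0

/-- The combined map `(ψ_{(ρ^{[i,1,1]}_{[0,j]})*})_j : ⊕_j ℂ^{β [0,j]} → ℂ^{β [i,1,1]}`. -/
noncomputable def regMatG (S : Setup) {β : V S → ℕ} (M : Rep S β)
    (i : Fin (S.p+1)) (j : Fin (S.m i)) (κ : Fin (S.e i j - 1)) :
    Matrix (Fin (β (Sum.inr ⟨i, j, κ⟩))) (Σ j' : Fin (S.m 0), Fin (β (v0 S j'))) ℂ :=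
  Matrix.of fun y x =>
    if h : 0 < arr S (Sum.inr ⟨i, j, κ⟩) (v0 S x.1) then
      M.g (Sum.inr ⟨i, j, κ⟩) (v0 S x.1) ⟨0, h⟩ y x.2
    else 0

/-- `M ∈ Rep(Q̄,β)_μ^{dif}` (the open conditions). -/
def difCond (S : Setup) {β : V S → ℕ} (M : Rep S β) : Prop :=
  crossBij S M ∧
  (∀ (i : Fin (S.p+1)), ¬ Iirr S i → ∀ (j : Fin (S.m i)) (κ : Fin (S.e i j - 1)),
      (κ : ℕ) = 0 →
      Function.Injective ((regMatF S M i j κ).mulVec) ∧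
      Function.Surjective ((regMatG S M i j κ).mulVec)) ∧
  (∀ (i : Fin (S.p+1)) (j : Fin (S.m i)) (κ : Fin (S.e i j - 1)) (b : V S)
      (ρ : Fin (arr S (Sum.inr ⟨i, j, κ⟩) b)),
      (¬ Iirr S i ∧ (κ : ℕ) = 0) ∨
      (Function.Injective ((M.f (Sum.inr ⟨i, j, κ⟩) b ρ).mulVec) ∧
       Function.Surjective ((M.g (Sum.inr ⟨i, j, κ⟩) b ρ).mulVec)))

/-- A family of subspaces forming a subrepresentation of `M`. -/
def isSubrep (S : Setup) {β : V S → ℕ} (M : Rep S β)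
    (W : ∀ a : V S, Submodule ℂ (Fin (β a) → ℂ)) : Prop :=
  ∀ (a b : V S) (ρ : Fin (arr S a b)),
    (∀ v ∈ W a, (M.f a b ρ).mulVec v ∈ W b) ∧ (∀ v ∈ W b, (M.g a b ρ).mulVec v ∈ W a)

/-- Irreducibility of a representation. -/
def irredRep (S : Setup) {β : V S → ℕ} (M : Rep S β) : Prop :=
  ∀ W, isSubrep S M W → (∀ a, W a = ⊥) ∨ (∀ a, W a = ⊤)

/-- A dimension vector is balanced if `Σ_j γ_[0,j] = Σ_j γ_[i,j]` for all `i ∈ I_irr∖{0}`. -/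
def balanced (S : Setup) (γ : V S → ℕ) : Prop :=
  ∀ i : {i : Fin (S.p+1) // Iirr S i}, i.1 ≠ 0 →
    (∑ j : Fin (S.m 0), γ (v0 S j)) = ∑ j : Fin (S.m i.1), γ (vI S i j)

/-- Quasi-irreducibility: no nontrivial proper subrepresentation with balanced
dimension vector. -/
def quasiIrred (S : Setup) {β : V S → ℕ} (M : Rep S β) : Prop :=
  ∀ W, isSubrep S M W → balanced S (fun a => Module.finrank ℂ (W a)) →
    (∀ a, W a = ⊥) ∨ (∀ a, W a = ⊤)

/-- Simultaneous conjugation of representations by `∏_a GL(β_a, ℂ)`. -/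
def repConj (S : Setup) {β : V S → ℕ} (M N : Rep S β) : Prop :=
  ∃ g : ∀ a : V S, (Matrix (Fin (β a)) (Fin (β a)) ℂ)ˣ,
    (∀ a b ρ, N.f a b ρ = ((g b).val * M.f a b ρ) * ((g a)⁻¹).val) ∧
    (∀ a b ρ, N.g a b ρ = ((g a).val * M.g a b ρ) * ((g b)⁻¹).val)

/-- Simultaneous conjugation of tuples by `GL(n, ℂ)`. -/
def tupConj (S : Setup) (A A' : ∀ _ : Fin (S.p+1), PMat S) : Prop :=
  ∃ g : (Matrix (Fin S.n) (Fin S.n) ℂ)ˣ,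
    ∀ i, A' i = (g.val.map Polynomial.C) * A i * ((g⁻¹).val.map Polynomial.C)

/-- Carrier of the moduli space `ℳ*_{st}(𝐁)`. -/
abbrev MstC (S : Setup) := {A : ∀ _ : Fin (S.p+1), PMat S // isDSElem S A ∧ irredTuple S A}

/-- The moduli space `ℳ*_{st}(𝐁)` of stable connections, identified with conjugacy
classes of irreducible elements of `∏ 𝒪_{B⁽ⁱ⁾}` with vanishing residue sum. -/
abbrev Mst (S : Setup) := Quot (fun A A' : MstC S => tupConj S A.1 A'.1)

abbrev DSC (S : Setup) := {A : ∀ _ : Fin (S.p+1), PMat S // isDSElem S A}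

abbrev DSQ (S : Setup) := Quot (fun A A' : DSC S => tupConj S A.1 A'.1)

abbrev RepIrrC (S : Setup) (μ : V S → ℂ) :=
  {M : Rep S (alN S) // onMu S μ M ∧ irredRep S M}

/-- The quiver variety `𝔐^{reg}_μ(Q,α)`. -/
abbrev Mreg (S : Setup) (μ : V S → ℂ) :=
  Quot (fun M N : RepIrrC S μ => repConj S M.1 N.1)

abbrev DifC (S : Setup) (μ : V S → ℂ) :=
  {M : Rep S (alN S) // onMu S μ M ∧ difCond S M}

abbrev DifQ (S : Setup) (μ : V S → ℂ) :=
  Quot (fun M N : DifC S μ => repConj S M.1 N.1)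

abbrev QIC (S : Setup) (μ : V S → ℂ) :=
  {M : Rep S (alN S) // onMu S μ M ∧ quasiIrred S M ∧ crossBij S M}

abbrev QIQ (S : Setup) (μ : V S → ℂ) :=
  Quot (fun M N : QIC S μ => repConj S M.1 N.1)

/-! ### `J`, `ε_𝐢`, and the equivalence relation `∼` -/

/-- `ε_𝐢 = Σ_{i ∈ I_irr} ε_{[i,j_i]}` for `𝐢 = ([i,j_i]) ∈ 𝒥`. -/
def epsJ (S : Setup) (I : ∀ i : Fin (S.p+1), Fin (S.m i)) : V S → ℤ
  | .inl ⟨i, j⟩ => if (j : ℕ) = (I i.1 : ℕ) then 1 else 0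
  | .inr _ => 0

/-- The reflection `s_𝐢`. -/
def sJ (S : Setup) (I : ∀ i : Fin (S.p+1), Fin (S.m i)) (β : V S → ℤ) : V S → ℤ :=
  fun b => β b - bform S β (epsJ S I) * epsJ S I b

/-- The quasi-fundamental set `F̃`. -/
def quasiFund (S : Setup) (β : V S → ℤ) : Prop :=
  inL S β ∧ (∀ a, 0 ≤ β a) ∧ β ≠ 0 ∧
  (∀ I : ∀ i : Fin (S.p+1), Fin (S.m i), bform S β (epsJ S I) ≤ 0) ∧
  (∀ (i : Fin (S.p+1)) (j : Fin (S.m i)) (κ : Fin (S.e i j - 1)),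
      bform S β (eps S (Sum.inr ⟨i, j, κ⟩)) ≤ 0) ∧
  connSupp S β

/-- `μ_𝐢 = Σ_{i ∈ I_irr} μ_{[i,j_i]}`. -/
noncomputable def muJ (S : Setup) (I : ∀ i : Fin (S.p+1), Fin (S.m i)) (μ : V S → ℂ) : ℂ :=
  ∑ i : {i : Fin (S.p+1) // Iirr S i}, μ (vI S i (I i.1))

/-- The transformed parameter `μ'` in the move `s_𝐢` on pairs. -/
noncomputable def muMove (S : Setup) (I : ∀ i : Fin (S.p+1), Fin (S.m i)) (μ : V S → ℂ) :
    V S → ℂ := fun a =>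
  match a with
  | .inl ⟨i, j⟩ =>
      if i.1 = 0 ∧ (j : ℕ) = (I 0 : ℕ) then μ a - 2 * muJ S I μ else μ a
  | .inr ⟨i, j, κ⟩ =>
      if j = I i ∧ (κ : ℕ) = 0 then μ a + muJ S I μ else μ a

/-- The reflected parameter `r_a(μ)` for a vertex `a`. -/
noncomputable def rvtx (S : Setup) (a : V S) (μ : V S → ℂ) : V S → ℂ :=
  fun b => μ b - ((bform S (eps S a) (eps S b) : ℤ) : ℂ) * μ a

/-- One move generating the relation `∼` on pairs `(β,μ)`. -/
def stepRel (S : Setup) :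
    ((V S → ℤ) × (V S → ℂ)) → ((V S → ℤ) × (V S → ℂ)) → Prop := fun x y =>
  (∃ (i : Fin (S.p+1)) (j : Fin (S.m i)) (κ : Fin (S.e i j - 1)),
      x.2 (Sum.inr ⟨i, j, κ⟩) ≠ 0 ∧
      y = (refl1 S (Sum.inr ⟨i, j, κ⟩) x.1, rvtx S (Sum.inr ⟨i, j, κ⟩) x.2)) ∨
  (∃ I : ∀ i : Fin (S.p+1), Fin (S.m i),
      muJ S I x.2 ≠ 0 ∧ y = (sJ S I x.1, muMove S I x.2))

/-- The smallest equivalence relation `∼` containing all the moves. -/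
def pairEquiv (S : Setup) :
    ((V S → ℤ) × (V S → ℂ)) → ((V S → ℤ) × (V S → ℂ)) → Prop :=
  Relation.EqvGen (stepRel S)

/-- The vector `z^{(i₀)}` for `i₀ ∈ I_irr ∖ {0}`. -/
def zvec (S : Setup) (i' : Fin (S.p+1)) : V S → ℂ
  | .inl ⟨i, _⟩ => if i.1 = i' then 1 else if i.1 = 0 then -1 else 0
  | .inr _ => 0

attribute [reducible] alN vI v0 i0

noncomputable section
set_option linter.unusedSimpArgs false

abbrev PS := PowerSeries ℂ
/-- The variable. -/
def xx : PS := PowerSeries.X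

section dvsec
variable {α β γ : Type}

/-- Entrywise divisibility by `x^N`. -/
def dv (N : ℕ) (A : Matrix α β PS) : Prop := ∃ A' : Matrix α β PS, A = xx ^ N • A'

def cf (n : ℕ) (A : Matrix α β PS) : Matrix α β ℂ := A.map (fun r => PowerSeries.coeff n r)

/-- Constant matrix. -/
def cst (A : Matrix α β ℂ) : Matrix α β PS := A.map (fun r => PowerSeries.C r)

@[simp] lemma cf_apply (n : ℕ) (A : Matrix α β PS) (a b) :
    cf n A a b = PowerSeries.coeff n (A a b) := rfl
@[simp] lemma cst_apply (A : Matrix α β ℂ) (a b) :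
    cst A a b = PowerSeries.C (A a b) := rfl

lemma dv_iff {N : ℕ} {A : Matrix α β PS} : dv N A ↔ ∀ n < N, cf n A = 0 := by
  constructor
  · rintro ⟨A', rfl⟩ n hn
    ext a b
    have : xx ^ N ∣ (xx ^ N • A') a b := ⟨A' a b, rfl⟩
    exact (PowerSeries.X_pow_dvd_iff.1 this) n hn
  · intro h
    have : ∀ a b, xx ^ N ∣ A a b := fun a b => PowerSeries.X_pow_dvd_iff.2
      (fun m hm => congrFun (congrFun (h m hm) a) b)
    choose A' hA' using this
    exact ⟨Matrix.of A', by ext1 a b; exact hA' a b⟩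

lemma dv_zero_right (N : ℕ) : dv N (0 : Matrix α β PS) := ⟨0, by simp⟩
lemma dv_zero (A : Matrix α β PS) : dv 0 A := ⟨A, by simp⟩
lemma dv.add {N : ℕ} {A B : Matrix α β PS} : dv N A → dv N B → dv N (A + B) := by
  rintro ⟨A', rfl⟩ ⟨B', rfl⟩; exact ⟨A' + B', by simp⟩
lemma dv.neg {N : ℕ} {A : Matrix α β PS} : dv N A → dv N (-A) := by
  rintro ⟨A', rfl⟩; exact ⟨-A', by simp⟩
lemma dv.sub {N : ℕ} {A B : Matrix α β PS} (h : dv N A) (h' : dv N B) : dv N (A - B) := by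
  rw [sub_eq_add_neg]; exact h.add h'.neg
lemma dv.mono {N M : ℕ} {A : Matrix α β PS} (h : dv N A) (hM : M ≤ N) : dv M A := by
  rw [dv_iff] at *; intro n hn; exact h n (by omega)
lemma dv.smul {N : ℕ} {A : Matrix α β PS} (M : ℕ) : dv N A → dv (M + N) (xx ^ M • A) := by
  rintro ⟨A', rfl⟩; exact ⟨A', by rw [smul_smul, pow_add]⟩
lemma dv.smul' {N : ℕ} {A : Matrix α β PS} (s : PS) : dv N A → dv N (s • A) := by
  rintro ⟨A', rfl⟩; exact ⟨s • A', by rw [smul_comm]⟩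
lemma dv_smul (N : ℕ) (A : Matrix α β PS) : dv N (xx ^ N • A) := ⟨A, rfl⟩
lemma dv.mul [Fintype β] {N M : ℕ} {A : Matrix α β PS} {B : Matrix β γ PS} :
    dv N A → dv M B → dv (N + M) (A * B) := by
  rintro ⟨A', rfl⟩ ⟨B', rfl⟩
  exact ⟨A' * B', by simp [smul_smul, pow_add, mul_comm]⟩
lemma dv.mul_right [Fintype β] {N : ℕ} {A : Matrix α β PS} (h : dv N A) (B : Matrix β γ PS) :
    dv N (A * B) := h.mul (dv_zero B)
lemma dv.mul_left [Fintype β] {N : ℕ} {B : Matrix β γ PS} (h : dv N B) (A : Matrix α β PS) :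
    dv N (A * B) := by simpa using (dv_zero A).mul h
lemma dv.cf {N n : ℕ} {A : Matrix α β PS} (h : dv N A) (hn : n < N) : cf n A = 0 := dv_iff.1 h n hn
lemma dv.succ {N : ℕ} {A : Matrix α β PS} (h : dv N A) (h' : DS.cf N A = 0) : dv (N + 1) A := by
  rw [dv_iff] at *; intro n hn
  rcases Nat.lt_succ_iff_lt_or_eq.1 hn with h1 | rfl
  · exact h n h1
  · exact h'

@[simp] lemma cf_add (n : ℕ) (A B : Matrix α β PS) : cf n (A + B) = cf n A + cf n B := by
  ext; simp
@[simp] lemma cf_sub (n : ℕ) (A B : Matrix α β PS) : cf n (A - B) = cf n A - cf n B := by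
  ext; simp
@[simp] lemma cf_neg (n : ℕ) (A : Matrix α β PS) : cf n (-A) = - cf n A := by
  ext; simp
@[simp] lemma cf_zero (n : ℕ) : cf n (0 : Matrix α β PS) = 0 := by
  ext; simp
lemma cf_mul [Fintype β] (n : ℕ) (A : Matrix α β PS) (B : Matrix β γ PS) :
    cf n (A * B) = ∑ p ∈ Finset.HasAntidiagonal.antidiagonal n, cf p.1 A * cf p.2 B := by
  ext a b
  simp only [cf_apply, Matrix.mul_apply, map_sum, PowerSeries.coeff_mul, Matrix.sum_apply]
  rw [Finset.sum_comm]
@[simp] lemma cf_cst_mul [Fintype β] (n : ℕ) (A : Matrix α β ℂ) (B : Matrix β γ PS) :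
    cf n (cst A * B) = A * cf n B := by
  ext a b
  simp [Matrix.mul_apply]
@[simp] lemma cf_mul_cst [Fintype β] (n : ℕ) (A : Matrix α β PS) (B : Matrix β γ ℂ) :
    cf n (A * cst B) = cf n A * B := by
  ext a b
  simp [Matrix.mul_apply]
lemma cf_smul (N n : ℕ) (A : Matrix α β PS) :
    cf n (xx ^ N • A) = if N ≤ n then cf (n - N) A else 0 := by
  ext a b
  simp only [cf_apply, Matrix.smul_apply, smul_eq_mul, xx, PowerSeries.coeff_X_pow_mul']
  split_ifs <;> simp
lemma cf_cst (n : ℕ) (A : Matrix α β ℂ) : cf n (cst A) = if n = 0 then A else 0 := by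
  ext a b
  simp only [cf_apply, cst_apply, PowerSeries.coeff_C]
  split_ifs <;> simp
@[simp] lemma cst_mul [Fintype β] (A : Matrix α β ℂ) (B : Matrix β γ ℂ) :
    cst (A * B) = cst A * cst B := by
  ext1 a b; simp [Matrix.mul_apply]
@[simp] lemma cst_one [DecidableEq α] : cst (1 : Matrix α α ℂ) = 1 := by
  ext1 a b; by_cases h : a = b <;> simp [Matrix.one_apply, h]
lemma cst_add (A B : Matrix α β ℂ) : cst (A + B) = cst A + cst B := by
  ext1; simp
lemma cst_sub (A B : Matrix α β ℂ) : cst (A - B) = cst A - cst B := by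
  ext1; simp
lemma cst_neg (A : Matrix α β ℂ) : cst (-A) = - cst A := by
  ext1; simp
lemma cst_zero : cst (0 : Matrix α β ℂ) = 0 := by
  ext1; simp

lemma eq_of_dv_all {A : Matrix α β PS} (h : ∀ N, cf N A = 0) : A = 0 := by
  ext1 a b; ext n; exact congrFun (congrFun (h n) a) b

lemma dv_cst_smul {N n : ℕ} {A : Matrix α β PS} {A' : Matrix α β PS} (h : dv N (A - A')) (hn : n < N) :
    cf n A = cf n A' := by
  have := h.cf hn
  rwa [cf_sub, sub_eq_zero] at this

lemma exists_inv [Fintype α] [DecidableEq α] {b : Matrix α α PS} (h : dv 1 (b - 1)) :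
    ∃ c, b * c = 1 ∧ c * b = 1 ∧ dv 1 (c - 1) := by
  have h0 : b.map (PowerSeries.constantCoeff) = (1 : Matrix α α ℂ) := by
    have := dv_cst_smul h (show 0 < 1 by norm_num)
    ext i j
    have := congrFun (congrFun this i) j
    simp only [cf_apply, PowerSeries.coeff_zero_eq_constantCoeff] at this
    rw [Matrix.map_apply, this]
    by_cases hij : i = j <;> simp [hij, Matrix.one_apply]
  have hu : IsUnit b.det := by
    rw [PowerSeries.isUnit_iff_constantCoeff, RingHom.map_det]
    have : (PowerSeries.constantCoeff (R := ℂ)).mapMatrix b = 1 := h0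
    rw [this]; simp
  refine ⟨b⁻¹, Matrix.mul_nonsing_inv b hu, Matrix.nonsing_inv_mul b hu, ?_⟩
  have : b⁻¹ - 1 = - (b⁻¹ * (b - 1)) := by
    rw [Matrix.mul_sub, Matrix.nonsing_inv_mul b hu]; simp
  rw [this]
  exact (h.mul_left _).neg
end dvsec

/-- `L = s + x^N (T + O(x))`. -/
def shape {α : Type} [DecidableEq α] (s : PS) (N : ℕ) (T : Matrix α α ℂ) (L : Matrix α α PS) : Prop :=
  dv (N + 1) (L - (s • 1 + xx ^ N • cst T))

section syl
variable {α β : Type} [Fintype α] [DecidableEq α] [Fintype β] [DecidableEq β]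

lemma syl1 {s : PS} {N : ℕ} {c : ℂ} {t : β → ℂ} {L1 : Matrix α α PS} {L2 : Matrix β β PS}
    (h1 : shape s N (c • 1) L1) (h2 : shape s N (diagonal t) L2) (w : Matrix α β PS) :
    dv (N + 1) (w * L2 - L1 * w - xx ^ N • (w * cst (diagonal fun b => t b - c))) := by
  have e : w * L2 - L1 * w - xx ^ N • (w * cst (diagonal fun b => t b - c)) =
     w * (L2 - (s • 1 + xx ^ N • cst (diagonal t))) - (L1 - (s • 1 + xx ^ N • cst (c • 1))) * w := by
    have e1 : cst (diagonal fun b => t b - c) = cst (diagonal t) - PowerSeries.C c • (1 : Matrix β β PS) := by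
      ext1 a b; by_cases h : a = b <;> simp [h, Matrix.one_apply]
    have e2 : cst (c • (1 : Matrix α α ℂ)) = PowerSeries.C c • 1 := by
      ext1 a b; by_cases h : a = b <;> simp [h, Matrix.one_apply]
    rw [e1, e2]
    simp only [Matrix.mul_sub, Matrix.sub_mul, Matrix.mul_add, Matrix.add_mul, smul_sub,
      Matrix.mul_smul, Matrix.smul_mul, Matrix.mul_one, Matrix.one_mul]
    abel
  rw [e]
  exact (dv.mul_left h2 w).sub (dv.mul_right h1 w)

lemma syl2 {s : PS} {N : ℕ} {c : ℂ} {t : β → ℂ} {L1 : Matrix α α PS} {L2 : Matrix β β PS}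
    (h1 : shape s N (c • 1) L1) (h2 : shape s N (diagonal t) L2) (w : Matrix β α PS) :
    dv (N + 1) (L2 * w - w * L1 - xx ^ N • (cst (diagonal fun b => t b - c) * w)) := by
  have e : L2 * w - w * L1 - xx ^ N • (cst (diagonal fun b => t b - c) * w) =
     (L2 - (s • 1 + xx ^ N • cst (diagonal t))) * w - w * (L1 - (s • 1 + xx ^ N • cst (c • 1))) := by
    have e1 : cst (diagonal fun b => t b - c) = cst (diagonal t) - PowerSeries.C c • (1 : Matrix β β PS) := by
      ext1 a b; by_cases h : a = b <;> simp [h, Matrix.one_apply]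
    have e2 : cst (c • (1 : Matrix α α ℂ)) = PowerSeries.C c • 1 := by
      ext1 a b; by_cases h : a = b <;> simp [h, Matrix.one_apply]
    rw [e1, e2]
    simp only [Matrix.mul_sub, Matrix.sub_mul, Matrix.mul_add, Matrix.add_mul, smul_sub,
      Matrix.mul_smul, Matrix.smul_mul, Matrix.mul_one, Matrix.one_mul]
    abel
  rw [e]
  exact (dv.mul_right h2 w).sub (dv.mul_left h1 w)

lemma diag_inv {t : β → ℂ} {c : ℂ} (ht : ∀ b, t b ≠ c) :
    (diagonal fun b => t b - c) * (diagonal fun b => (t b - c)⁻¹) = (1 : Matrix β β ℂ) := by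
  rw [Matrix.diagonal_mul_diagonal, ← Matrix.diagonal_one]
  congr 1; ext b; exact mul_inv_cancel₀ (sub_ne_zero.2 (ht b))
lemma diag_inv' {t : β → ℂ} {c : ℂ} (ht : ∀ b, t b ≠ c) :
    (diagonal fun b => (t b - c)⁻¹) * (diagonal fun b => t b - c) = (1 : Matrix β β ℂ) := by
  rw [Matrix.diagonal_mul_diagonal, ← Matrix.diagonal_one]
  congr 1; ext b; exact inv_mul_cancel₀ (sub_ne_zero.2 (ht b))

/-- Solvability of the Sylvester equation. -/
lemma syl_solve {s : PS} {N : ℕ} {c : ℂ} {t : β → ℂ} {L1 : Matrix α α PS} {L2 : Matrix β β PS}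
    (h1 : shape s N (c • 1) L1) (h2 : shape s N (diagonal t) L2) (ht : ∀ b, t b ≠ c)
    {P : Matrix α β PS} (hP : dv (N + 1) P) (M : ℕ) :
    ∃ u : Matrix α β PS, dv 1 u ∧ dv (N + 1 + M) (u * L2 - L1 * u - P) := by
  induction M with
  | zero => exact ⟨0, dv_zero_right 1, by simpa using hP.neg⟩
  | succ M ih =>
    obtain ⟨u, hu, r, hr⟩ := ih
    set w := r * cst (diagonal fun b => (t b - c)⁻¹) with hw
    have hw' : w * cst (diagonal fun b => t b - c) = r := by
      rw [hw, Matrix.mul_assoc, ← cst_mul, diag_inv' ht]; simp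
    refine ⟨u - xx ^ (M + 1) • w, hu.sub ((dv_smul (M+1) w).mono (by omega)), ?_⟩
    have := (syl1 h1 h2 w).smul (M + 1)
    rw [hw'] at this
    have e : (u - xx ^ (M + 1) • w) * L2 - L1 * (u - xx ^ (M + 1) • w) - P =
      (u * L2 - L1 * u - P) - xx ^ (N + 1 + M) • r -
      xx ^ (M + 1) • (w * L2 - L1 * w - xx ^ N • r) := by
      rw [smul_sub, smul_smul, ← pow_add, show M + 1 + N = N + 1 + M by omega]
      simp only [Matrix.sub_mul, Matrix.mul_sub, Matrix.smul_mul, Matrix.mul_smul, smul_sub]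
      abel
    rw [e, hr, sub_self, zero_sub]
    exact (this.mono (by omega)).neg

/-- The leading coefficient of the Sylvester operator. -/
lemma syl_cf {s : PS} {N : ℕ} {c : ℂ} {t : β → ℂ} {L1 : Matrix α α PS} {L2 : Matrix β β PS}
    (h1 : shape s N (c • 1) L1) (h2 : shape s N (diagonal t) L2) {m : ℕ}
    {w : Matrix β α PS} (hw : dv m w) :
    dv (N + m) (L2 * w - w * L1) ∧
    cf (N + m) (L2 * w - w * L1) = (diagonal fun b => t b - c) * cf m w := by
  obtain ⟨w', rfl⟩ := hw
  have := (syl2 h1 h2 w').smul m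
  have e : L2 * (xx ^ m • w') - (xx ^ m • w') * L1 =
     xx ^ m • (L2 * w' - w' * L1 - xx ^ N • (cst (diagonal fun b => t b - c) * w')) +
     xx ^ (N + m) • (cst (diagonal fun b => t b - c) * w') := by
    rw [pow_add, mul_comm, mul_smul]
    simp only [Matrix.smul_mul, Matrix.mul_smul, smul_sub]
    abel
  rw [e]
  refine ⟨(this.mono (by omega)).add (dv_smul _ _), ?_⟩
  rw [cf_add, (this.cf (by omega)), cf_smul, cf_smul]
  simp

lemma syl_uniq {s : PS} {N : ℕ} {c : ℂ} {t : β → ℂ} {L1 : Matrix α α PS} {L2 : Matrix β β PS}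
    (h1 : shape s N (c • 1) L1) (h2 : shape s N (diagonal t) L2) (ht : ∀ b, t b ≠ c) {M : ℕ}
    {w : Matrix β α PS} (hw : dv (N + M) (L2 * w - w * L1)) : dv M w := by
  have : ∀ m ≤ M, dv m w := by
    intro m
    induction m with
    | zero => intro _; exact dv_zero w
    | succ m ih =>
      intro hm
      have h := ih (by omega)
      refine h.succ ?_
      have h3 := (syl_cf h1 h2 h).2
      rw [hw.cf (by omega)] at h3
      have : (diagonal fun b => (t b - c)⁻¹) * ((diagonal fun b => t b - c) * cf m w) = 0 := by
        rw [← h3]; simp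
      rwa [← Matrix.mul_assoc, diag_inv' ht, Matrix.one_mul] at this
  exact this M le_rfl
end syl
end

noncomputable section
set_option linter.unusedSimpArgs false
set_option linter.unusedSectionVars false

section ohat
variable {ι : Type} [Fintype ι] [DecidableEq ι]

/-- The irregular part in the polynomial encoding. -/
def Bq (k : ℕ) (q : ι → ℂ[X]) : Matrix ι ι PS :=
  diagonal fun a => ((reflect k (q a) : ℂ[X]) : PS)

/-- `A` is conjugate, by a matrix congruent to `1`, to `B + R x^{-1}`. -/
def Ohat (k : ℕ) (q : ι → ℂ[X]) (A : Matrix ι ι PS) (R : Matrix ι ι ℂ) : Prop :=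
  (∀ a b, q a ≠ q b → R a b = 0) ∧
  ∃ b : Matrix ι ι PS, dv 1 (b - 1) ∧ dv k (A * b - b * (Bq k q + xx ^ (k - 1) • cst R))

lemma Ohat.congr {k : ℕ} {q : ι → ℂ[X]} {A A' : Matrix ι ι PS} {R : Matrix ι ι ℂ}
    (h : Ohat k q A R) (hA : dv k (A - A')) : Ohat k q A' R := by
  obtain ⟨h1, b, hb, h2⟩ := h
  refine ⟨h1, b, hb, ?_⟩
  have e : A' * b - b * (Bq k q + xx ^ (k - 1) • cst R) =
    (A * b - b * (Bq k q + xx ^ (k - 1) • cst R)) - (A - A') * b := by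
    rw [Matrix.sub_mul]; abel
  rw [e]; exact h2.sub (hA.mul_right _)

lemma Ohat.conj {k : ℕ} {q : ι → ℂ[X]} {A : Matrix ι ι PS} {R h h' : Matrix ι ι ℂ}
    (H : Ohat k q A R) (h1 : h * h' = 1) (h2 : h' * h = 1) (hb : ∀ a b, q a ≠ q b → h a b = 0)
    (hb' : ∀ a b, q a ≠ q b → h' a b = 0) :
    Ohat k q (cst h * A * cst h') (h * R * h') := by
  obtain ⟨hR, b, hb1, h3⟩ := H
  have c1 : cst h * cst h' = 1 := by rw [← cst_mul, h1, cst_one]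
  have c2 : cst h' * cst h = 1 := by rw [← cst_mul, h2, cst_one]
  refine ⟨?_, cst h * b * cst h', ?_, ?_⟩
  · intro a d had
    simp only [Matrix.mul_apply]
    refine Finset.sum_eq_zero fun x _ => ?_
    by_cases hx : q x = q d
    · rw [Finset.sum_eq_zero, zero_mul]
      intro y _
      by_cases hy : q y = q a
      · rw [hR y x (by rw [hy, hx]; exact had), mul_zero]
      · rw [hb a y (Ne.symm hy), zero_mul]
    · rw [hb' x d hx, mul_zero]
  · have : cst h * b * cst h' - 1 = cst h * (b - 1) * cst h' := by
      rw [Matrix.mul_sub, Matrix.sub_mul, Matrix.mul_one, c1]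
    rw [this]; exact (hb1.mul_left _).mul_right _
  · have hB : cst h' * Bq k q = Bq k q * cst h' := by
      ext1 a d
      simp only [Bq, Matrix.mul_diagonal, Matrix.diagonal_mul]
      by_cases hq : q a = q d
      · rw [hq, mul_comm]
      · simp [hb' a d hq]
    have e : cst h * A * cst h' * (cst h * b * cst h') -
        cst h * b * cst h' * (Bq k q + xx ^ (k - 1) • cst (h * R * h')) =
        cst h * (A * b - b * (Bq k q + xx ^ (k - 1) • cst R)) * cst h' := by
      have e1 : cst h * A * cst h' * (cst h * b * cst h') = cst h * A * (cst h' * cst h) * b * cst h' := by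
        simp only [Matrix.mul_assoc]
      have e2 : cst h * b * cst h' * (xx ^ (k - 1) • cst (h * R * h')) =
        xx ^ (k-1) • (cst h * b * (cst h' * cst h) * cst R * cst h') := by
        simp only [cst_mul, Matrix.mul_smul, Matrix.mul_assoc]
      rw [Matrix.mul_add, e1, e2, c2, Matrix.mul_assoc _ (cst h'), hB]
      simp only [Matrix.mul_one, Matrix.mul_sub, Matrix.sub_mul, Matrix.mul_add, Matrix.add_mul,
        Matrix.mul_smul, Matrix.smul_mul, Matrix.mul_assoc]
    rw [e]; exact (h3.mul_left _).mul_right _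

lemma Ohat.shape {k N : ℕ} {q : ι → ℂ[X]} {A : Matrix ι ι PS} {R : Matrix ι ι ℂ}
    {s : PS} {t : ι → ℂ} (hN : N + 2 ≤ k)
    (hs : ∀ a, xx ^ (N + 1) ∣ ((reflect k (q a) : ℂ[X]) : PS) - (s + xx ^ N * PowerSeries.C (t a)))
    (H : Ohat k q A R) : shape s N (diagonal t) A := by
  obtain ⟨hR, b, hb1, h3⟩ := H
  obtain ⟨c, hbc, hcb, hc⟩ := exists_inv hb1
  have hB : dv (N + 1) (Bq k q - (s • 1 + xx ^ N • cst (diagonal t))) := by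
    choose r hr using hs
    refine ⟨diagonal r, ?_⟩
    ext1 a d
    by_cases had : a = d
    · subst had; simpa [Bq] using hr a
    · simp [Bq, had]
  have e : (A - (s • 1 + xx ^ N • cst (diagonal t))) * b =
     (A * b - b * (Bq k q + xx ^ (k - 1) • cst R)) +
     b * (Bq k q - (s • 1 + xx ^ N • cst (diagonal t))) +
     xx ^ (k - 1) • (b * cst R) +
     xx ^ N • ((b - 1) * cst (diagonal t) - cst (diagonal t) * (b - 1)) := by
    simp only [Matrix.mul_sub, Matrix.sub_mul, Matrix.mul_add, Matrix.add_mul, smul_sub,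
      Matrix.mul_smul, Matrix.smul_mul, Matrix.mul_one, Matrix.one_mul]
    abel
  have h4 : dv (N + 1) ((A - (s • 1 + xx ^ N • cst (diagonal t))) * b) := by
    rw [e]
    refine ((((h3.mono (by omega)).add (hB.mul_left _)).add ?_).add ?_)
    · exact (dv_smul _ _).mono (by omega)
    · exact ((hb1.mul_right _).sub (hb1.mul_left _)).smul N
  have h5 := h4.mul_right c
  rwa [Matrix.mul_assoc, hbc, Matrix.mul_one] at h5
end ohat

lemma refl_shape {k D : ℕ} (hD : D ≤ k) {p p0 : ℂ[X]} (h : (p - p0).natDegree ≤ D) :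
    xx ^ (k - D + 1) ∣ ((reflect k p : ℂ[X]) : PS) -
      ((((reflect k p0 : ℂ[X]) : PS) - xx ^ (k - D) * PowerSeries.C (p0.coeff D)) +
        xx ^ (k - D) * PowerSeries.C (p.coeff D)) := by
  refine PowerSeries.X_pow_dvd_iff.2 fun m hm => ?_
  simp only [map_sub, map_add, Polynomial.coeff_coe, xx, PowerSeries.coeff_X_pow_mul',
    PowerSeries.coeff_C, coeff_reflect]
  rw [revAt_le (by omega : m ≤ k)]
  by_cases hm' : m = k - D
  · subst hm'
    rw [show k - (k - D) = D by omega]; simp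
  · have h1 : (p - p0).coeff (k - m) = 0 := coeff_eq_zero_of_natDegree_lt (by omega)
    rw [coeff_sub, sub_eq_zero] at h1
    rw [if_neg (by omega), if_neg (by omega), h1]; simp

section split
variable {α β : Type} [Fintype α] [DecidableEq α] [Fintype β] [DecidableEq β]

lemma dv_blocks {N : ℕ} {a : Matrix α α PS} {b : Matrix α β PS} {c : Matrix β α PS} {d : Matrix β β PS} :
    dv N (fromBlocks a b c d) ↔ dv N a ∧ dv N b ∧ dv N c ∧ dv N d := by
  constructor
  · rintro ⟨M, hM⟩
    refine ⟨⟨M.toBlocks₁₁, ?_⟩, ⟨M.toBlocks₁₂, ?_⟩, ⟨M.toBlocks₂₁, ?_⟩, ⟨M.toBlocks₂₂, ?_⟩⟩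
    · ext1 i j; exact congrFun (congrFun hM (Sum.inl i)) (Sum.inl j)
    · ext1 i j; exact congrFun (congrFun hM (Sum.inl i)) (Sum.inr j)
    · ext1 i j; exact congrFun (congrFun hM (Sum.inr i)) (Sum.inl j)
    · ext1 i j; exact congrFun (congrFun hM (Sum.inr i)) (Sum.inr j)
  · rintro ⟨⟨a', rfl⟩, ⟨b', rfl⟩, ⟨c', rfl⟩, ⟨d', rfl⟩⟩
    exact ⟨fromBlocks a' b' c' d', by rw [fromBlocks_smul]⟩

/-- Hypotheses for splitting the set of blocks in two. -/
structure Split (k D : ℕ) (q : α ⊕ β → ℂ[X]) (s : PS) (c : ℂ) (t : β → ℂ) : Prop where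
  hD2 : 2 ≤ D
  hDk : D ≤ k
  h1 : ∀ a, xx ^ (k - D + 1) ∣ ((reflect k (q (.inl a)) : ℂ[X]) : PS) -
    (s + xx ^ (k - D) * PowerSeries.C c)
  h2 : ∀ b, xx ^ (k - D + 1) ∣ ((reflect k (q (.inr b)) : ℂ[X]) : PS) -
    (s + xx ^ (k - D) * PowerSeries.C (t b))
  ht : ∀ b, t b ≠ c
  hdeg : ∀ a b, (q (.inl a) - q (.inr b)).natDegree = D

variable {k D : ℕ} {q : α ⊕ β → ℂ[X]} {s : PS} {c : ℂ} {t : β → ℂ}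

lemma Split.ne (S : Split k D q s c t) (a b) : q (.inl a) ≠ q (.inr b) := by
  intro h
  have := S.hdeg a b
  rw [h, sub_self, natDegree_zero] at this
  have := S.hD2; omega

lemma Split.shape1 (S : Split k D q s c t) {L R} (h : Ohat k (q ∘ Sum.inl) L R) :
    shape s (k - D) (c • 1) L := by
  have := Ohat.shape (N := k - D) (t := fun _ : α => c) (s := s)
    (by have := S.hD2; have := S.hDk; omega) (fun a => S.h1 a) h
  rwa [Matrix.smul_one_eq_diagonal]

lemma Split.shape2 (S : Split k D q s c t) {L R} (h : Ohat k (q ∘ Sum.inr) L R) :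
    shape s (k - D) (diagonal t) L :=
  Ohat.shape (N := k - D) (s := s)
    (by have := S.hD2; have := S.hDk; omega) (fun a => S.h2 a) h

/-- The block decomposition of `A`. -/
structure Good (k D : ℕ) (q : α ⊕ β → ℂ[X]) (A11 : Matrix α α PS) (A12 : Matrix α β PS)
    (A21 : Matrix β α PS) (A22 : Matrix β β PS) (ν : Matrix β α PS)
    (R1 : Matrix α α ℂ) (R2 : Matrix β β ℂ) : Prop where
  hν : dv 1 ν
  hP : dv (k - D + 1) A12
  heq : dv k (A21 + A22 * ν - ν * (A11 + A12 * ν))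
  O1 : Ohat k (q ∘ Sum.inl) (A11 + A12 * ν) R1
  O2 : Ohat k (q ∘ Sum.inr) (A22 - ν * A12) R2

lemma Bq_blocks : Bq k q = fromBlocks (Bq k (q ∘ Sum.inl)) 0 0 (Bq k (q ∘ Sum.inr)) := by
  ext1 i j
  rcases i with i | i <;> rcases j with j | j <;> simp [Bq, Matrix.diagonal_apply]

lemma cst_blocks (a : Matrix α α ℂ) (b : Matrix α β ℂ) (c : Matrix β α ℂ) (d : Matrix β β ℂ) :
    cst (fromBlocks a b c d) = fromBlocks (cst a) (cst b) (cst c) (cst d) := by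
  ext1 i j
  rcases i with i | i <;> rcases j with j | j <;> simp

lemma cf_blocks (n : ℕ) (a : Matrix α α PS) (b : Matrix α β PS) (c : Matrix β α PS) (d : Matrix β β PS) :
    cf n (fromBlocks a b c d) = fromBlocks (cf n a) (cf n b) (cf n c) (cf n d) := by
  ext1 i j
  rcases i with i | i <;> rcases j with j | j <;> simp

lemma sub_blocks (a a' : Matrix α α PS) (b b' : Matrix α β PS) (c c' : Matrix β α PS) (d d' : Matrix β β PS) :
    fromBlocks a b c d - fromBlocks a' b' c' d' = fromBlocks (a - a') (b - b') (c - c') (d - d') := by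
  ext1 i j
  rcases i with i | i <;> rcases j with j | j <;> simp

lemma gauss (S : Split k D q s c t) {A11 : Matrix α α PS} {A12 : Matrix α β PS}
    {A21 : Matrix β α PS} {A22 : Matrix β β PS} {R : Matrix (α ⊕ β) (α ⊕ β) ℂ}
    (H : Ohat k q (fromBlocks A11 A12 A21 A22) R) :
    R = fromBlocks R.toBlocks₁₁ 0 0 R.toBlocks₂₂ ∧
    ∃ ν, Good k D q A11 A12 A21 A22 ν R.toBlocks₁₁ R.toBlocks₂₂ := by
  have hD2 := S.hD2
  have hDk := S.hDk
  have hsh := Ohat.shape (N := k - D) (s := s) (t := Sum.elim (fun _ => c) t)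
    (by omega) (by rintro (a | b); exacts [S.h1 a, S.h2 b]) H
  obtain ⟨hR, b, hb1, h3⟩ := H
  have hRe : R = fromBlocks R.toBlocks₁₁ 0 0 R.toBlocks₂₂ := by
    ext1 i j
    rcases i with i | i <;> rcases j with j | j
    · rfl
    · exact hR _ _ (S.ne i j)
    · exact hR _ _ (S.ne j i).symm
    · rfl
  refine ⟨hRe, ?_⟩
  have hP : dv (k - D + 1) A12 := by
    have e : fromBlocks A11 A12 A21 A22 -
        (s • 1 + xx ^ (k - D) • cst (diagonal (Sum.elim (fun _ => c) t))) =
        fromBlocks (A11 - (s • 1 + xx ^ (k - D) • cst (c • 1))) A12 A21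
         (A22 - (s • 1 + xx ^ (k - D) • cst (diagonal t))) := by
      ext1 i j
      rcases i with i | i <;> rcases j with j | j <;>
        simp [Matrix.one_apply, Matrix.diagonal_apply]
    unfold shape at hsh
    rw [e, dv_blocks] at hsh
    exact hsh.2.1
  generalize R.toBlocks₁₁ = R1 at *
  generalize R.toBlocks₂₂ = R2 at *
  subst hRe
  obtain ⟨b11, b12, b21, b22, rfl⟩ : ∃ b11 b12 b21 b22, b = fromBlocks b11 b12 b21 b22 :=
    ⟨_, _, _, _, (fromBlocks_toBlocks b).symm⟩
  rw [← fromBlocks_one, sub_blocks, dv_blocks] at hb1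
  obtain ⟨hb11, hb12, hb21, hb22⟩ := hb1
  rw [sub_zero] at hb12 hb21
  obtain ⟨c11, hbc, hcb, hc⟩ := exists_inv hb11
  rw [Bq_blocks, cst_blocks, fromBlocks_smul, fromBlocks_add, fromBlocks_multiply, fromBlocks_multiply,
    sub_blocks, dv_blocks] at h3
  simp only [cst_zero, smul_zero, add_zero, zero_add, Matrix.mul_zero] at h3
  obtain ⟨e11, e12, e21, e22⟩ := h3
  have hR1 : ∀ a b, (q ∘ Sum.inl) a ≠ (q ∘ Sum.inl) b → R1 a b = 0 := fun a b h => hR (.inl a) (.inl b) h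
  have hR2 : ∀ a b, (q ∘ Sum.inr) a ≠ (q ∘ Sum.inr) b → R2 a b = 0 := fun a b h => hR (.inr a) (.inr b) h
  set B1 := Bq k (q ∘ Sum.inl) + xx ^ (k - 1) • cst R1
  set B2 := Bq k (q ∘ Sum.inr) + xx ^ (k - 1) • cst R2
  have hνb : b21 * c11 * b11 = b21 := by rw [Matrix.mul_assoc, hcb, Matrix.mul_one]
  set ν := b21 * c11 with hνdef
  have hν : dv 1 ν := hb21.mul_right _
  have hL1 : dv k ((A11 + A12 * ν) * b11 - b11 * B1) := by
    rw [Matrix.add_mul, Matrix.mul_assoc, hνb]; exact e11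
  have heq : dv k (A21 + A22 * ν - ν * (A11 + A12 * ν)) := by
    have e : (A21 + A22 * ν - ν * (A11 + A12 * ν)) * b11 =
      (A21 * b11 + A22 * b21 - b21 * B1) - ν * ((A11 + A12 * ν) * b11 - b11 * B1) := by
      rw [Matrix.mul_sub, ← Matrix.mul_assoc ν b11, hνb]
      simp only [Matrix.sub_mul, Matrix.add_mul, Matrix.mul_assoc, hνb, Matrix.mul_add]
      abel
    have h5 : dv k ((A21 + A22 * ν - ν * (A11 + A12 * ν)) * b11) := by
      rw [e]; exact e21.sub (hL1.mul_left _)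
    have h6 := h5.mul_right c11
    rwa [Matrix.mul_assoc, hbc, Matrix.mul_one] at h6
  refine ⟨ν, hν, hP, heq, ⟨hR1, b11, hb11, hL1⟩, ⟨hR2, b22 - ν * b12, ?_, ?_⟩⟩
  · rw [sub_right_comm]; exact hb22.sub (hν.mul_right _)
  · have e : (A22 - ν * A12) * (b22 - ν * b12) - (b22 - ν * b12) * B2 =
       (A21 * b12 + A22 * b22 - b22 * B2) - ν * (A11 * b12 + A12 * b22 - b12 * B2)
       - (A21 + A22 * ν - ν * (A11 + A12 * ν)) * b12 := by
      simp only [Matrix.sub_mul, Matrix.add_mul, Matrix.mul_assoc, Matrix.mul_sub, Matrix.mul_add]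
      abel
    rw [e]
    exact (e22.sub (e12.mul_left _)).sub (heq.mul_right _)

lemma Good.ohat (S : Split k D q s c t) {A11 : Matrix α α PS} {A12 : Matrix α β PS}
    {A21 : Matrix β α PS} {A22 : Matrix β β PS} {ν : Matrix β α PS} {R1 R2}
    (H : Good k D q A11 A12 A21 A22 ν R1 R2) :
    Ohat k q (fromBlocks A11 A12 A21 A22) (fromBlocks R1 0 0 R2) := by
  have hD2 := S.hD2
  have hDk := S.hDk
  have s1 := S.shape1 H.O1
  have s2 := S.shape2 H.O2
  obtain ⟨u, hu, hu2⟩ := syl_solve s1 s2 S.ht H.hP (D - 1)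
  rw [show k - D + 1 + (D - 1) = k by omega] at hu2
  obtain ⟨hν, hP, heq, ⟨hR1, b1, hb1, h1⟩, ⟨hR2, b2, hb2, h2⟩⟩ := H
  refine ⟨?_, fromBlocks b1 (u * b2) (ν * b1) ((ν * u + 1) * b2), ?_, ?_⟩
  · rintro (a | a) (b | b) hab
    · exact hR1 a b hab
    · rfl
    · rfl
    · exact hR2 a b hab
  · rw [← fromBlocks_one, sub_blocks, dv_blocks]
    refine ⟨hb1, by simpa using hu.mul_right _, by simpa using hν.mul_right _, ?_⟩
    rw [Matrix.add_mul, Matrix.one_mul, add_sub_assoc]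
    exact ((hν.mul_right _).mul_right _).add hb2
  · rw [Bq_blocks, cst_blocks, fromBlocks_smul, fromBlocks_add, fromBlocks_multiply, fromBlocks_multiply,
      sub_blocks, dv_blocks]
    simp only [cst_zero, smul_zero, add_zero, zero_add, Matrix.mul_zero]
    set B1 := Bq k (q ∘ Sum.inl) + xx ^ (k - 1) • cst R1
    set B2 := Bq k (q ∘ Sum.inr) + xx ^ (k - 1) • cst R2
    refine ⟨?_, ?_, ?_, ?_⟩
    · have e : A11 * b1 + A12 * (ν * b1) - b1 * B1 = (A11 + A12 * ν) * b1 - b1 * B1 := by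
        simp only [Matrix.add_mul, Matrix.mul_assoc]
      rw [e]; exact h1
    · have e : A11 * (u * b2) + A12 * ((ν * u + 1) * b2) - u * b2 * B2 =
        u * ((A22 - ν * A12) * b2 - b2 * B2) -
        (u * (A22 - ν * A12) - (A11 + A12 * ν) * u - A12) * b2 := by
        simp only [Matrix.sub_mul, Matrix.add_mul, Matrix.mul_assoc, Matrix.mul_sub, Matrix.mul_add,
          Matrix.one_mul]
        abel
      rw [e]; exact (h2.mul_left _).sub (hu2.mul_right _)
    · have e : A21 * b1 + A22 * (ν * b1) - ν * b1 * B1 =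
        (A21 + A22 * ν - ν * (A11 + A12 * ν)) * b1 + ν * ((A11 + A12 * ν) * b1 - b1 * B1) := by
        simp only [Matrix.sub_mul, Matrix.add_mul, Matrix.mul_assoc, Matrix.mul_sub, Matrix.mul_add]
        abel
      rw [e]; exact (heq.mul_right _).add (h1.mul_left _)
    · have e : A21 * (u * b2) + A22 * ((ν * u + 1) * b2) - (ν * u + 1) * b2 * B2 =
        (A21 + A22 * ν - ν * (A11 + A12 * ν)) * (u * b2)
        - ν * ((u * (A22 - ν * A12) - (A11 + A12 * ν) * u - A12) * b2)
        + (ν * u + 1) * ((A22 - ν * A12) * b2 - b2 * B2) := by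
        simp only [Matrix.sub_mul, Matrix.add_mul, Matrix.mul_assoc, Matrix.mul_sub, Matrix.mul_add,
          Matrix.one_mul]
        abel
      rw [e]; exact ((heq.mul_right _).sub ((hu2.mul_right _).mul_left _)).add (h2.mul_left _)

lemma Good.uniq (S : Split k D q s c t) {A11 : Matrix α α PS} {A12 : Matrix α β PS}
    {A21 : Matrix β α PS} {A22 : Matrix β β PS} {ν ν' : Matrix β α PS} {R1 R2 R1' R2'}
    (H : Good k D q A11 A12 A21 A22 ν R1 R2) (H' : Good k D q A11 A12 A21 A22 ν' R1' R2') :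
    dv D (ν - ν') := by
  have hD2 := S.hD2
  have hDk := S.hDk
  refine syl_uniq (S.shape1 H.O1) (S.shape2 H'.O2) S.ht (M := D) ?_
  rw [show k - D + D = k by omega]
  have e : (A22 - ν' * A12) * (ν - ν') - (ν - ν') * (A11 + A12 * ν) =
    (A21 + A22 * ν - ν * (A11 + A12 * ν)) - (A21 + A22 * ν' - ν' * (A11 + A12 * ν')) := by
    simp only [Matrix.sub_mul, Matrix.add_mul, Matrix.mul_assoc, Matrix.mul_sub, Matrix.mul_add]
    abel
  rw [e]; exact H.heq.sub H'.heq
end split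
end

noncomputable section
set_option linter.unusedSimpArgs false
set_option linter.unusedSectionVars false

section kmap
variable {ι : Type} [Fintype ι] [DecidableEq ι]

/-- The (signed) moment map on edge data. -/
def mom (k : ℕ) (ε : ι → ι → ℂ) (X : ℕ → Matrix ι ι ℂ) : Matrix ι ι ℂ :=
  Matrix.of fun a b => ∑ t ∈ Finset.range k, ∑ c, ε a c * X t a c * X t c b

/-- `h` is block diagonal. -/
def blk (q : ι → ℂ[X]) (h : Matrix ι ι ℂ) : Prop := ∀ a b, q a ≠ q b → h a b = 0

/-- Sign functions. -/
structure EpsOK (q : ι → ℂ[X]) (ε : ι → ι → ℂ) : Prop where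
  cong : ∀ a a' c c', q a = q a' → q c = q c' → ε a c = ε a' c'
  anti : ∀ a c, q a ≠ q c → ε a c * ε c a = -1
  sq : ∀ a c, q a ≠ q c → ε a c * ε a c = 1

/-- Support condition for edge data. -/
def suppOK (q : ι → ℂ[X]) (X : ℕ → Matrix ι ι ℂ) : Prop :=
  ∀ t a b, ¬ (t + 2 < (q a - q b).natDegree) → X t a b = 0

/-- Properties of the decoupling map. -/
structure KMap (k : ℕ) (q : ι → ℂ[X]) (ε : ι → ι → ℂ)
    (Φ : Matrix ι ι PS → ℕ → Matrix ι ι ℂ) : Prop where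
  supp : ∀ A R, Ohat k q A R → suppOK q (Φ A)
  moment : ∀ A R, Ohat k q A R → ∀ a b, q a = q b →
    R a b = cf (k - 1) A a b - mom k ε (Φ A) a b
  inj : ∀ A R A' R', Ohat k q A R → Ohat k q A' R' → Φ A = Φ A' → cf (k - 1) A = cf (k - 1) A' →
    dv k (A - A')
  surj : ∀ X Y, suppOK q X → ∃ A R, Ohat k q A R ∧ Φ A = X ∧ cf (k - 1) A = Y
  equiv : ∀ A R h h', Ohat k q A R → h * h' = 1 → h' * h = 1 → blk q h → blk q h' →
    ∀ t, Φ (cst h * A * cst h') t = h * Φ A t * h'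
  congr : ∀ A R A', Ohat k q A R → dv k (A - A') → Φ A' = Φ A

lemma kmap_base {k : ℕ} (hk : 0 < k) {q : ι → ℂ[X]} (ε : ι → ι → ℂ)
    (hq1 : ∀ a, (q a).coeff 1 = 0) (hq : ∀ a b, q a = q b) : KMap k q ε (fun _ _ => 0) := by
  have key : ∀ A R, Ohat k q A R → dv k (A - (Bq k q + xx ^ (k - 1) • cst R)) := by
    rintro A R ⟨_, b, hb, h⟩
    obtain ⟨c, hbc, hcb, hc⟩ := exists_inv hb
    have hB : b * Bq k q = Bq k q * b := by
      ext1 a d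
      simp only [Bq, Matrix.mul_diagonal, Matrix.diagonal_mul]
      rw [hq a d, mul_comm]
    have e : (A - (Bq k q + xx ^ (k - 1) • cst R)) * b = (A * b - b * (Bq k q + xx ^ (k - 1) • cst R))
       + xx ^ (k - 1) • ((b - 1) * cst R - cst R * (b - 1)) := by
      rw [Matrix.mul_add, hB]
      simp only [Matrix.mul_sub, Matrix.sub_mul, Matrix.mul_add, Matrix.add_mul, smul_sub,
        Matrix.mul_smul, Matrix.smul_mul, Matrix.mul_one, Matrix.one_mul]
      abel
    have h1 : dv k ((A - (Bq k q + xx ^ (k - 1) • cst R)) * b) := by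
      rw [e]
      refine h.add ?_
      exact (((hb.mul_right _).sub (hb.mul_left _)).smul (k-1)).mono (by omega)
    have h2 := h1.mul_right c
    rwa [Matrix.mul_assoc, hbc, Matrix.mul_one] at h2
  have hBq : cf (k - 1) (Bq k q) = 0 := by
    ext a b
    by_cases hab : a = b
    · subst hab
      simp only [Bq, cf_apply, diagonal_apply_eq, Polynomial.coeff_coe, coeff_reflect]
      rw [revAt_le (by omega), show k - (k - 1) = 1 by omega, hq1]; rfl
    · simp [Bq, hab]
  have hres : ∀ A R, Ohat k q A R → cf (k - 1) A = R := by
    intro A R h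
    have := dv_cst_smul (key A R h) (show k - 1 < k by omega)
    rw [this, cf_add, hBq, cf_smul]; simp [cf_cst]
  refine ⟨?_, ?_, ?_, ?_, ?_, ?_⟩
  · intro A R _ t a b _; rfl
  · intro A R h a b _
    rw [hres A R h]; simp [mom]
  · intro A R A' R' h h' _ e
    rw [hres A R h, hres A' R' h'] at e
    subst e
    have := (key A R h).sub (key A' R h')
    simpa using this
  · intro X Y hX
    refine ⟨Bq k q + xx ^ (k - 1) • cst Y, Y, ?_, ?_, ?_⟩
    · exact ⟨fun a b h => absurd (hq a b) h, 1, by simpa using dv_zero_right 1,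
        by simpa using dv_zero_right k⟩
    · funext t
      ext a b
      exact (hX t a b (by rw [hq a b]; simp)).symm
    · rw [cf_add, hBq, cf_smul]; simp [cf_cst]
  · intros; simp
  · intros; rfl

lemma Ohat.reindex {ι' : Type} [Fintype ι'] [DecidableEq ι'] (e : ι' ≃ ι) {k : ℕ} {q : ι → ℂ[X]}
    {A : Matrix ι ι PS} {R : Matrix ι ι ℂ} (h : Ohat k q A R) :
    Ohat k (q ∘ e) (A.submatrix e e) (R.submatrix e e) := by
  obtain ⟨hR, b, hb, h⟩ := h
  have dvr : ∀ {N : ℕ} {A : Matrix ι ι PS}, dv N A → dv N (A.submatrix e e) := by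
    rintro N A ⟨A', rfl⟩; exact ⟨A'.submatrix e e, rfl⟩
  refine ⟨fun a c hac => hR _ _ hac, b.submatrix e e, ?_, ?_⟩
  · have h1 : b.submatrix e e - 1 = (b - 1).submatrix e e := by
      rw [← Matrix.submatrix_one_equiv e]; rfl
    rw [h1]; exact dvr hb
  · have hB : Bq k (q ∘ e) = (Bq k q).submatrix e e := by
      ext1 a b
      simp [Bq, Matrix.diagonal_apply]
    have h1 : A.submatrix e e * b.submatrix e e - b.submatrix e e *
        (Bq k (q ∘ e) + xx ^ (k - 1) • cst (R.submatrix e e)) =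
        (A * b - b * (Bq k q + xx ^ (k - 1) • cst R)).submatrix e e := by
      have h2 : Bq k (q ∘ e) + xx ^ (k - 1) • cst (R.submatrix e e) =
        (Bq k q + xx ^ (k - 1) • cst R).submatrix e e := by rw [hB]; rfl
      rw [h2, Matrix.submatrix_mul_equiv, Matrix.submatrix_mul_equiv]; rfl
    rw [h1]; exact dvr h

lemma KMap.reindex {ι' : Type} [Fintype ι'] [DecidableEq ι'] (e : ι' ≃ ι) {k : ℕ} {q : ι → ℂ[X]}
    {ε : ι → ι → ℂ} {Φ} (H : KMap k (q ∘ e) (fun a b => ε (e a) (e b)) Φ) :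
    KMap k q ε (fun A t => (Φ (A.submatrix e e) t).submatrix e.symm e.symm) := by
  have dvr : ∀ {N : ℕ} {A : Matrix ι ι PS}, dv N A → dv N (A.submatrix e e) := by
    rintro N A ⟨A', rfl⟩; exact ⟨A'.submatrix e e, rfl⟩
  have dvr' : ∀ {N : ℕ} {A : Matrix ι ι PS}, dv N (A.submatrix e e) → dv N A := by
    rintro N A ⟨A', hA⟩
    refine ⟨A'.submatrix e.symm e.symm, ?_⟩
    ext1 a b
    have := congrFun (congrFun hA (e.symm a)) (e.symm b)
    simpa using this
  refine ⟨?_, ?_, ?_, ?_, ?_, ?_⟩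
  · intro A R h t a b hab
    exact H.supp _ _ (h.reindex e) t _ _ (by simpa using hab)
  · intro A R h a b hab
    have := H.moment _ _ (h.reindex e) (e.symm a) (e.symm b) (by simpa using hab)
    simp only [Matrix.submatrix_apply, Equiv.apply_symm_apply, cf_apply] at this
    rw [this, cf_apply]
    congr 1
    simp only [mom, Matrix.of_apply, Matrix.submatrix_apply, Equiv.apply_symm_apply]
    refine Finset.sum_congr rfl fun t _ => ?_
    rw [← Equiv.sum_comp e]
    simp
  · intro A R A' R' h h' hΦ hc
    apply dvr'
    have := H.inj _ _ _ _ (h.reindex e) (h'.reindex e) ?_ ?_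
    · simpa [Matrix.submatrix_sub] using this
    · funext t
      have := congrFun hΦ t
      ext a b
      have := congrFun (congrFun this (e a)) (e b)
      simpa using this
    · have : (cf (k-1) A).submatrix e e = (cf (k-1) A').submatrix e e := by rw [hc]
      exact this
  · intro X Y hX
    obtain ⟨A, R, h1, h2, h3⟩ := H.surj (fun t => (X t).submatrix e e) (Y.submatrix e e)
      (fun t a b h => hX t _ _ h)
    have h1' := Ohat.reindex (q := q ∘ e) e.symm h1
    refine ⟨A.submatrix e.symm e.symm, R.submatrix e.symm e.symm, ?_, ?_, ?_⟩
    · convert h1' using 1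
      funext a; simp
    · funext t
      simp [Matrix.submatrix_submatrix, h2]
    · have : (cf (k-1) A).submatrix e.symm e.symm = Y := by rw [h3]; simp
      exact this
  · intro A R h h' hA h1 h2 hb hb' t
    have := H.equiv _ _ (h.submatrix e e) (h'.submatrix e e) (hA.reindex e)
      (by rw [Matrix.submatrix_mul_equiv, h1]; simp) (by rw [Matrix.submatrix_mul_equiv, h2]; simp)
      (fun a b hab => hb _ _ hab) (fun a b hab => hb' _ _ hab) t
    have e1 : (cst h * A * cst h').submatrix e e =
      cst (h.submatrix e e) * A.submatrix e e * cst (h'.submatrix e e) := by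
      rw [← Matrix.submatrix_mul_equiv _ _ _ e, ← Matrix.submatrix_mul_equiv _ _ _ e]; rfl
    rw [e1, this]
    rw [← Matrix.submatrix_mul_equiv _ _ _ e.symm, ← Matrix.submatrix_mul_equiv _ _ _ e.symm]
    simp [Matrix.submatrix_submatrix]
  · intro A R A' h hA
    have := H.congr _ _ (A'.submatrix e e) (h.reindex e) (by
      have := dvr hA
      simpa [Matrix.submatrix_sub] using this)
    simp only [this]
end kmap
end

noncomputable section
set_option linter.unusedSimpArgs false
set_option linter.unusedSectionVars false

section step
variable {α β : Type} [Fintype α] [DecidableEq α] [Fintype β] [DecidableEq β]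

lemma res_mul {k D : ℕ} (hD2 : 2 ≤ D) (hDk : D ≤ k) {P : Matrix α β PS} {ν : Matrix β α PS}
    (hP : dv (k - D + 1) P) (hν : dv 1 ν) :
    cf (k - 1) (P * ν) = ∑ t ∈ Finset.range k,
      if t + 2 < D then cf (k - 2 - t) P * cf (t + 1) ν else 0 := by
  rw [cf_mul, ← Finset.Nat.sum_antidiagonal_swap,
    Finset.Nat.sum_antidiagonal_eq_sum_range_succ_mk]
  obtain ⟨k, rfl⟩ : ∃ k', k = k' + 1 := ⟨k - 1, by omega⟩
  simp only [Nat.add_sub_cancel, Nat.succ_eq_add_one]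
  rw [Finset.sum_range_succ', Finset.sum_range_succ, if_neg (by omega)]
  simp only [Prod.swap, hν.cf (by norm_num : 0 < 1), Matrix.mul_zero]
  congr 1
  refine Finset.sum_congr rfl fun t ht => ?_
  rw [Finset.mem_range] at ht
  split_ifs with h
  · rw [show k - (t + 1) = k + 1 - 2 - t by omega]
  · rw [hP.cf (by omega), Matrix.zero_mul]

lemma res_mul' {k D : ℕ} (hD2 : 2 ≤ D) (hDk : D ≤ k) {P : Matrix α β PS} {ν : Matrix β α PS}
    (hP : dv (k - D + 1) P) (hν : dv 1 ν) :
    cf (k - 1) (ν * P) = ∑ t ∈ Finset.range k,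
      if t + 2 < D then cf (t + 1) ν * cf (k - 2 - t) P else 0 := by
  rw [cf_mul, Finset.Nat.sum_antidiagonal_eq_sum_range_succ_mk]
  obtain ⟨k, rfl⟩ : ∃ k', k = k' + 1 := ⟨k - 1, by omega⟩
  simp only [Nat.add_sub_cancel, Nat.succ_eq_add_one]
  rw [Finset.sum_range_succ', Finset.sum_range_succ, if_neg (by omega)]
  simp only [hν.cf (by norm_num : 0 < 1), Matrix.zero_mul]
  congr 1
  refine Finset.sum_congr rfl fun t ht => ?_
  rw [Finset.mem_range] at ht
  split_ifs with h
  · rw [show k - (t + 1) = k + 1 - 2 - t by omega]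
  · rw [hP.cf (by omega), Matrix.mul_zero]

variable {k D : ℕ} {q : α ⊕ β → ℂ[X]} {s : PS} {c : ℂ} {t : β → ℂ}

/-- The formula for the decoupling map of a split block. -/
def Pform (k D : ℕ) (ε : α ⊕ β → α ⊕ β → ℂ) (Φ1 : Matrix α α PS → ℕ → Matrix α α ℂ)
    (Φ2 : Matrix β β PS → ℕ → Matrix β β ℂ) (A11 : Matrix α α PS) (A12 : Matrix α β PS)
    (A22 : Matrix β β PS) (ν : Matrix β α PS) (t : ℕ) : Matrix (α ⊕ β) (α ⊕ β) ℂ :=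
  fromBlocks (Φ1 (A11 + A12 * ν) t)
    (Matrix.of fun x y => if t + 2 < D then ε (.inr y) (.inl x) * cf (k - 2 - t) A12 x y else 0)
    (if t + 2 < D then cf (t + 1) ν else 0) (Φ2 (A22 - ν * A12) t)

open Classical in
/-- A choice of `ν`. -/
def nuSel (k D : ℕ) (q : α ⊕ β → ℂ[X]) (A11 : Matrix α α PS) (A12 : Matrix α β PS)
    (A21 : Matrix β α PS) (A22 : Matrix β β PS) : Matrix β α PS :=
  if h : ∃ ν R1 R2, Good k D q A11 A12 A21 A22 ν R1 R2 then h.choose else 0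

lemma nuSel_spec {A11 : Matrix α α PS} {A12 : Matrix α β PS}
    {A21 : Matrix β α PS} {A22 : Matrix β β PS}
    (hex : ∃ ν R1 R2, Good k D q A11 A12 A21 A22 ν R1 R2) :
    ∃ R1 R2, Good k D q A11 A12 A21 A22 (nuSel k D q A11 A12 A21 A22) R1 R2 := by
  unfold nuSel
  rw [dif_pos hex]
  exact hex.choose_spec

/-- The decoupling map of a split block. -/
def PhiS (k D : ℕ) (q : α ⊕ β → ℂ[X]) (ε : α ⊕ β → α ⊕ β → ℂ)
    (Φ1 : Matrix α α PS → ℕ → Matrix α α ℂ)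
    (Φ2 : Matrix β β PS → ℕ → Matrix β β ℂ) (A : Matrix (α ⊕ β) (α ⊕ β) PS) :
    ℕ → Matrix (α ⊕ β) (α ⊕ β) ℂ :=
  Pform k D ε Φ1 Φ2 A.toBlocks₁₁ A.toBlocks₁₂ A.toBlocks₂₂
    (nuSel k D q A.toBlocks₁₁ A.toBlocks₁₂ A.toBlocks₂₁ A.toBlocks₂₂)

lemma Good.congr {A11 A11' : Matrix α α PS} {A12 A12' : Matrix α β PS}
    {A21 A21' : Matrix β α PS} {A22 A22' : Matrix β β PS} {ν : Matrix β α PS} {R1 R2}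
    (H : Good k D q A11 A12 A21 A22 ν R1 R2) (hD2 : 2 ≤ D) (hDk : D ≤ k)
    (h11 : dv k (A11 - A11')) (h12 : dv k (A12 - A12')) (h21 : dv k (A21 - A21'))
    (h22 : dv k (A22 - A22')) : Good k D q A11' A12' A21' A22' ν R1 R2 := by
  have e1 : dv k ((A11 + A12 * ν) - (A11' + A12' * ν)) := by
    have : (A11 + A12 * ν) - (A11' + A12' * ν) = (A11 - A11') + (A12 - A12') * ν := by
      rw [Matrix.sub_mul]; abel
    rw [this]; exact h11.add (h12.mul_right _)
  have e2 : dv k ((A22 - ν * A12) - (A22' - ν * A12')) := by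
    have : (A22 - ν * A12) - (A22' - ν * A12') = (A22 - A22') - ν * (A12 - A12') := by
      rw [Matrix.mul_sub]; abel
    rw [this]; exact h22.sub (h12.mul_left _)
  refine ⟨H.hν, ?_, ?_, H.O1.congr e1, H.O2.congr e2⟩
  · have : A12' = A12 - (A12 - A12') := by abel
    rw [this]; exact H.hP.sub (h12.mono (by omega))
  · have : A21' + A22' * ν - ν * (A11' + A12' * ν) = (A21 + A22 * ν - ν * (A11 + A12 * ν)) -
      (A21 - A21') - (A22 - A22') * ν + ν * ((A11 + A12 * ν) - (A11' + A12' * ν)) := by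
      simp only [Matrix.sub_mul, Matrix.mul_sub]; abel
    rw [this]
    exact ((H.heq.sub h21).sub (h22.mul_right _)).add (e1.mul_left _)

variable {ε : α ⊕ β → α ⊕ β → ℂ} {Φ1 : Matrix α α PS → ℕ → Matrix α α ℂ}
    {Φ2 : Matrix β β PS → ℕ → Matrix β β ℂ}

lemma PhiS_eq (S : Split k D q s c t)
    (K1 : KMap k (q ∘ Sum.inl) (fun a b => ε (.inl a) (.inl b)) Φ1)
    (K2 : KMap k (q ∘ Sum.inr) (fun a b => ε (.inr a) (.inr b)) Φ2)
    {A11 : Matrix α α PS} {A12 : Matrix α β PS}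
    {A21 : Matrix β α PS} {A22 : Matrix β β PS} {ν : Matrix β α PS} {R1 R2}
    (H : Good k D q A11 A12 A21 A22 ν R1 R2) :
    PhiS k D q ε Φ1 Φ2 (fromBlocks A11 A12 A21 A22) = Pform k D ε Φ1 Φ2 A11 A12 A22 ν := by
  have hD2 := S.hD2
  have hDk := S.hDk
  unfold PhiS
  simp only [toBlocks_fromBlocks₁₁, toBlocks_fromBlocks₁₂, toBlocks_fromBlocks₂₁,
    toBlocks_fromBlocks₂₂]
  have hex : ∃ ν R1 R2, Good k D q A11 A12 A21 A22 ν R1 R2 := ⟨_, _, _, H⟩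
  obtain ⟨R1', R2', H'⟩ := nuSel_spec hex
  generalize nuSel k D q A11 A12 A21 A22 = ν' at H'
  have hu := H'.uniq S H
  have h1 : Φ1 (A11 + A12 * ν') = Φ1 (A11 + A12 * ν) := by
    refine K1.congr _ _ _ H.O1 ?_
    have : A11 + A12 * ν - (A11 + A12 * ν') = - (A12 * (ν' - ν)) := by
      rw [Matrix.mul_sub]; abel
    rw [this]; exact ((H.hP.mul hu).mono (by omega)).neg
  have h2 : Φ2 (A22 - ν' * A12) = Φ2 (A22 - ν * A12) := by
    refine K2.congr _ _ _ H.O2 ?_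
    have : A22 - ν * A12 - (A22 - ν' * A12) = (ν' - ν) * A12 := by
      rw [Matrix.sub_mul]; abel
    rw [this]; exact ((hu.mul H.hP).mono (by omega))
  funext t
  unfold Pform
  rw [h1, h2]
  congr 1
  split_ifs with ht
  · exact dv_cst_smul hu (by omega)
  · rfl

lemma step_supp (S : Split k D q s c t)
    (K1 : KMap k (q ∘ Sum.inl) (fun a b => ε (.inl a) (.inl b)) Φ1)
    (K2 : KMap k (q ∘ Sum.inr) (fun a b => ε (.inr a) (.inr b)) Φ2)
    {A11 : Matrix α α PS} {A12 : Matrix α β PS}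
    {A21 : Matrix β α PS} {A22 : Matrix β β PS} {ν : Matrix β α PS} {R1 R2}
    (H : Good k D q A11 A12 A21 A22 ν R1 R2) :
    suppOK q (Pform k D ε Φ1 Φ2 A11 A12 A22 ν) := by
  rintro t (a | a) (b | b) h
  · exact K1.supp _ _ H.O1 t a b h
  · rw [S.hdeg] at h
    simp [Pform, h]
  · rw [← natDegree_neg, neg_sub, S.hdeg] at h
    simp [Pform, h]
  · exact K2.supp _ _ H.O2 t a b h

lemma step_moment (S : Split k D q s c t) (hε : EpsOK q ε)
    (K1 : KMap k (q ∘ Sum.inl) (fun a b => ε (.inl a) (.inl b)) Φ1)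
    (K2 : KMap k (q ∘ Sum.inr) (fun a b => ε (.inr a) (.inr b)) Φ2)
    {A11 : Matrix α α PS} {A12 : Matrix α β PS}
    {A21 : Matrix β α PS} {A22 : Matrix β β PS} {ν : Matrix β α PS} {R1 R2}
    (H : Good k D q A11 A12 A21 A22 ν R1 R2) (a b : α ⊕ β) (hab : q a = q b) :
    fromBlocks R1 0 0 R2 a b = cf (k - 1) (fromBlocks A11 A12 A21 A22) a b -
      mom k ε (Pform k D ε Φ1 Φ2 A11 A12 A22 ν) a b := by
  have hD2 := S.hD2
  have hDk := S.hDk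
  rcases a with a | a <;> rcases b with b | b
  · have h := K1.moment _ _ H.O1 a b hab
    have h2 := congrFun (congrFun (res_mul hD2 hDk H.hP H.hν) a) b
    rw [cf_add, Matrix.add_apply, h2] at h
    simp only [fromBlocks_apply₁₁, cf_blocks]
    rw [h]
    simp only [mom, Matrix.of_apply, Fintype.sum_sum_type, Finset.sum_add_distrib, Pform,
      fromBlocks_apply₁₁, fromBlocks_apply₁₂, fromBlocks_apply₂₁, Matrix.sum_apply]
    have : ∑ x ∈ Finset.range k, ((if x + 2 < D then cf (k - 2 - x) A12 * cf (x + 1) ν else 0) : Matrix α α ℂ) a b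
      = - ∑ x ∈ Finset.range k, ∑ y : β, ε (Sum.inl a) (Sum.inr y) *
        (if x + 2 < D then ε (Sum.inr y) (Sum.inl a) * cf (k - 2 - x) A12 a y else 0) *
        ((if x + 2 < D then cf (x + 1) ν else 0) : Matrix β α ℂ) y b := by
      rw [← Finset.sum_neg_distrib]
      refine Finset.sum_congr rfl fun x _ => ?_
      split_ifs with hx
      · rw [Matrix.mul_apply, ← Finset.sum_neg_distrib]
        refine Finset.sum_congr rfl fun y _ => ?_
        rw [← mul_assoc (ε _ _), hε.anti _ _ (S.ne a y)]; ring
      · simp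
    rw [this]; ring
  · exact absurd hab (S.ne a b)
  · exact absurd hab.symm (S.ne b a)
  · have h := K2.moment _ _ H.O2 a b hab
    have h2 := congrFun (congrFun (res_mul' hD2 hDk H.hP H.hν) a) b
    rw [cf_sub, Matrix.sub_apply, h2] at h
    simp only [fromBlocks_apply₂₂, cf_blocks]
    rw [h]
    simp only [mom, Matrix.of_apply, Fintype.sum_sum_type, Finset.sum_add_distrib, Pform,
      fromBlocks_apply₂₂, fromBlocks_apply₁₂, fromBlocks_apply₂₁, Matrix.sum_apply]
    have : ∑ x ∈ Finset.range k, ((if x + 2 < D then cf (x + 1) ν * cf (k - 2 - x) A12 else 0) : Matrix β β ℂ) a b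
      = ∑ x ∈ Finset.range k, ∑ y : α, ε (Sum.inr a) (Sum.inl y) *
        ((if x + 2 < D then cf (x + 1) ν else 0) : Matrix β α ℂ) a y *
        (if x + 2 < D then ε (Sum.inr b) (Sum.inl y) * cf (k - 2 - x) A12 y b else 0) := by
      refine Finset.sum_congr rfl fun x _ => ?_
      split_ifs with hx
      · rw [Matrix.mul_apply]
        refine Finset.sum_congr rfl fun y _ => ?_
        rw [hε.cong (.inr b) (.inr a) (.inl y) (.inl y) hab.symm rfl]
        linear_combination (- cf (x+1) ν a y * cf (k - 2 - x) A12 y b) * hε.sq (.inr a) (.inl y) (S.ne y a).symm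
      · simp
    rw [this]; ring

lemma step_inj (S : Split k D q s c t) (hε : EpsOK q ε)
    (K1 : KMap k (q ∘ Sum.inl) (fun a b => ε (.inl a) (.inl b)) Φ1)
    (K2 : KMap k (q ∘ Sum.inr) (fun a b => ε (.inr a) (.inr b)) Φ2)
    {A11 A11' : Matrix α α PS} {A12 A12' : Matrix α β PS}
    {A21 A21' : Matrix β α PS} {A22 A22' : Matrix β β PS} {ν ν' : Matrix β α PS} {R1 R2 R1' R2'}
    (H : Good k D q A11 A12 A21 A22 ν R1 R2) (H' : Good k D q A11' A12' A21' A22' ν' R1' R2')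
    (hΦ : Pform k D ε Φ1 Φ2 A11 A12 A22 ν = Pform k D ε Φ1 Φ2 A11' A12' A22' ν')
    (hc : cf (k - 1) (fromBlocks A11 A12 A21 A22) = cf (k - 1) (fromBlocks A11' A12' A21' A22')) :
    dv k (fromBlocks A11 A12 A21 A22 - fromBlocks A11' A12' A21' A22') := by
  have hD2 := S.hD2
  have hDk := S.hDk
  rw [cf_blocks, cf_blocks, fromBlocks_inj] at hc
  obtain ⟨c11, c12, c21, c22⟩ := hc
  have hΦ' : ∀ t, _ := fun t => fromBlocks_inj.1 (congrFun hΦ t)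
  have hcP : ∀ n, n < k → cf n A12 = cf n A12' := by
    intro n hn
    by_cases h1 : n = k - 1
    · rw [h1, c12]
    by_cases h2 : n < k - D + 1
    · rw [H.hP.cf h2, H'.hP.cf h2]
    · have := (hΦ' (k - 2 - n)).2.1
      ext x y
      have h3 := congrFun (congrFun this x) y
      simp only [Matrix.of_apply] at h3
      rw [if_pos (by omega), if_pos (by omega), show k - 2 - (k - 2 - n) = n by omega] at h3
      have h4 := hε.sq (.inr y) (.inl x) (S.ne x y).symm
      have h5 : ε (.inr y) (.inl x) ≠ 0 := by intro h0; rw [h0] at h4; simp at h4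
      exact mul_left_cancel₀ h5 h3
  have hP : dv k (A12 - A12') := dv_iff.2 fun n hn => by rw [cf_sub, hcP n hn, sub_self]
  have hδ : dv (D - 1) (ν - ν') := dv_iff.2 fun n hn => by
    rw [cf_sub]
    rcases n with _ | n
    · rw [H.hν.cf (by norm_num), H'.hν.cf (by norm_num), sub_self]
    · have := (hΦ' n).2.2.1
      rw [if_pos (by omega), if_pos (by omega)] at this
      rw [this, sub_self]
  -- products
  have hPν : dv k (A12 * ν - A12' * ν') := by
    have : A12 * ν - A12' * ν' = (A12 - A12') * ν + A12' * (ν - ν') := by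
      rw [Matrix.sub_mul, Matrix.mul_sub]; abel
    rw [this]
    exact (hP.mul_right _).add ((H'.hP.mul hδ).mono (by omega))
  have hνP : dv k (ν * A12 - ν' * A12') := by
    have : ν * A12 - ν' * A12' = ν * (A12 - A12') + (ν - ν') * A12' := by
      rw [Matrix.sub_mul, Matrix.mul_sub]; abel
    rw [this]
    exact (hP.mul_left _).add ((hδ.mul H'.hP).mono (by omega))
  have k0 : k - 1 < k := by omega
  have hL1 : dv k ((A11 + A12 * ν) - (A11' + A12' * ν')) := by
    refine K1.inj _ _ _ _ H.O1 H'.O1 (funext fun t => (hΦ' t).1) ?_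
    rw [cf_add, cf_add, c11, dv_cst_smul hPν k0]
  have hL2 : dv k ((A22 - ν * A12) - (A22' - ν' * A12')) := by
    refine K2.inj _ _ _ _ H.O2 H'.O2 (funext fun t => (hΦ' t).2.2.2) ?_
    rw [cf_sub, cf_sub, c22, dv_cst_smul hνP k0]
  have h11 : dv k (A11 - A11') := by
    have := hL1.sub hPν
    convert this using 1; abel
  have h22 : dv k (A22 - A22') := by
    have := hL2.add hνP
    convert this using 1; abel
  -- the lower left block
  have e0 : A21 - A21' = (A21 + A22 * ν - ν * (A11 + A12 * ν)) - (A21' + A22' * ν' - ν' * (A11' + A12' * ν'))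
      - ((A22 - A22') * ν + (-ν') * ((A11 + A12 * ν) - (A11' + A12' * ν')) +
        (ν' * A12') * (ν - ν'))
      - ((A22' - ν' * A12') * (ν - ν') - (ν - ν') * (A11 + A12 * ν)) := by
    simp only [Matrix.sub_mul, Matrix.mul_sub, Matrix.add_mul, Matrix.mul_add, Matrix.neg_mul, Matrix.mul_assoc]
    abel
  have hsmall : dv k ((ν' * A12') * (ν - ν')) :=
    ((H'.hν.mul H'.hP).mul hδ).mono (by omega)
  have hstep : dv k ((A21 - A21') + ((A22' - ν' * A12') * (ν - ν') - (ν - ν') * (A11 + A12 * ν))) := by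
    rw [e0, sub_add_cancel]
    exact (H.heq.sub H'.heq).sub (((h22.mul_right _).add (hL1.mul_left _)).add hsmall)
  have hsy := syl_cf (S.shape1 H.O1) (S.shape2 H'.O2) hδ
  rw [show k - D + (D - 1) = k - 1 by omega] at hsy
  have hz : cf (k - 1) ((A22' - ν' * A12') * (ν - ν') - (ν - ν') * (A11 + A12 * ν)) = 0 := by
    have := hstep.cf k0
    rwa [cf_add, cf_sub, c21, sub_self, zero_add] at this
  have hsk : dv k ((A22' - ν' * A12') * (ν - ν') - (ν - ν') * (A11 + A12 * ν)) := by
    have := hsy.1.succ hz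
    rwa [show k - 1 + 1 = k by omega] at this
  have h21 : dv k (A21 - A21') := by
    have := hstep.sub hsk
    rwa [add_sub_cancel_right] at this
  rw [sub_blocks, dv_blocks]
  exact ⟨h11, hP, h21, h22⟩
end step
end

noncomputable section
set_option linter.unusedSimpArgs false
set_option linter.unusedSectionVars false

section step
variable {α β : Type} [Fintype α] [DecidableEq α] [Fintype β] [DecidableEq β]
variable {k D : ℕ} {q : α ⊕ β → ℂ[X]} {s : PS} {c : ℂ} {t : β → ℂ}
variable {ε : α ⊕ β → α ⊕ β → ℂ} {Φ1 : Matrix α α PS → ℕ → Matrix α α ℂ}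
    {Φ2 : Matrix β β PS → ℕ → Matrix β β ℂ}

lemma step_surj (S : Split k D q s c t) (hε : EpsOK q ε)
    (K1 : KMap k (q ∘ Sum.inl) (fun a b => ε (.inl a) (.inl b)) Φ1)
    (K2 : KMap k (q ∘ Sum.inr) (fun a b => ε (.inr a) (.inr b)) Φ2)
    (X : ℕ → Matrix (α ⊕ β) (α ⊕ β) ℂ) (Y : Matrix (α ⊕ β) (α ⊕ β) ℂ) (hX : suppOK q X) :
    ∃ A11 A12 A21 A22 ν R1 R2, Good k D q A11 A12 A21 A22 ν R1 R2 ∧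
      Pform k D ε Φ1 Φ2 A11 A12 A22 ν = X ∧ cf (k - 1) (fromBlocks A11 A12 A21 A22) = Y := by
  have hD2 := S.hD2
  have hDk := S.hDk
  set P : Matrix α β PS := Matrix.of fun x y => PowerSeries.mk fun n =>
    if n = k - 1 then Y (.inl x) (.inr y) else if k - D + 1 ≤ n ∧ n + 2 ≤ k then
      ε (.inr y) (.inl x) * X (k - 2 - n) (.inl x) (.inr y) else 0 with hPdef
  set ν0 : Matrix β α PS := Matrix.of fun x y => PowerSeries.mk fun n =>
    if 1 ≤ n ∧ n + 1 < D then X (n - 1) (.inr x) (.inl y) else 0 with hnudef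
  have hP : dv (k - D + 1) P := dv_iff.2 fun n hn => by
    ext x y
    simp only [hPdef, cf_apply, Matrix.of_apply, PowerSeries.coeff_mk]
    rw [if_neg (by omega), if_neg (by omega)]; rfl
  have hν0 : dv 1 ν0 := dv_iff.2 fun n hn => by
    ext x y
    simp only [hnudef, cf_apply, Matrix.of_apply, PowerSeries.coeff_mk]
    rw [if_neg (by omega)]; rfl
  obtain ⟨L1, R1, O1, hL1, hc1⟩ := K1.surj (fun t => (X t).toBlocks₁₁)
    (Y.toBlocks₁₁ + cf (k - 1) (P * ν0)) (fun t a b h => hX t (.inl a) (.inl b) h)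
  obtain ⟨L2, R2, O2, hL2, hc2⟩ := K2.surj (fun t => (X t).toBlocks₂₂)
    (Y.toBlocks₂₂ - cf (k - 1) (ν0 * P)) (fun t a b h => hX t (.inr a) (.inr b) h)
  set w : Matrix β α ℂ := (diagonal fun b => (t b - c)⁻¹) *
    (cf (k - 1) (ν0 * L1 - L2 * ν0 - ν0 * P * ν0) - Y.toBlocks₂₁) with hw
  have hw' : (diagonal fun b => t b - c) * w =
    cf (k - 1) (ν0 * L1 - L2 * ν0 - ν0 * P * ν0) - Y.toBlocks₂₁ := by
    rw [hw, ← Matrix.mul_assoc, diag_inv S.ht, Matrix.one_mul]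
  set δ : Matrix β α PS := xx ^ (D - 1) • cst w with hδdef
  have hδ : dv (D - 1) δ := dv_smul _ _
  have hcδ : cf (D - 1) δ = w := by rw [hδdef, cf_smul]; simp [cf_cst]
  have hν : dv 1 (ν0 + δ) := hν0.add (hδ.mono (by omega))
  have k0 : k - 1 < k := by omega
  have hPδ : dv k (P * δ) := (hP.mul hδ).mono (by omega)
  have hδP : dv k (δ * P) := (hδ.mul hP).mono (by omega)
  have hsy := syl_cf (S.shape1 O1) (S.shape2 O2) hδ
  rw [show k - D + (D - 1) = k - 1 by omega, hcδ, hw'] at hsy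
  refine ⟨L1 - P * (ν0 + δ), P, (ν0 + δ) * L1 - (L2 + (ν0 + δ) * P) * (ν0 + δ),
    L2 + (ν0 + δ) * P, ν0 + δ, R1, R2, ⟨hν, hP, ?_, ?_, ?_⟩, ?_, ?_⟩
  · rw [sub_add_cancel, sub_add_cancel, sub_self]; exact dv_zero_right k
  · rw [sub_add_cancel]; exact O1
  · rw [add_sub_cancel_right]; exact O2
  · funext t
    unfold Pform
    rw [sub_add_cancel, add_sub_cancel_right, hL1, hL2]
    rw [← fromBlocks_toBlocks (X t)]
    congr 1
    · ext x y
      simp only [Matrix.of_apply, hPdef, cf_apply, PowerSeries.coeff_mk, toBlocks₁₂]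
      split_ifs with h1 h2 h3 <;> try omega
      · rw [show k - 2 - (k - 2 - t) = t by omega, ← mul_assoc, hε.sq _ _ (S.ne x y).symm, one_mul]
      · exact (hX t (.inl x) (.inr y) (by rw [S.hdeg]; exact h1)).symm
    · ext x y
      split_ifs with h1
      · have : cf (t + 1) δ = 0 := hδ.cf (by omega)
        rw [cf_add, this, add_zero]
        simp only [Matrix.of_apply, hnudef, cf_apply, PowerSeries.coeff_mk, toBlocks₂₁]
        rw [if_pos (by omega)]; rfl
      · exact (hX t (.inr x) (.inl y) (by rw [← natDegree_neg, neg_sub, S.hdeg]; exact h1)).symm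
  · rw [cf_blocks, ← fromBlocks_toBlocks Y]
    congr 1
    · rw [cf_sub, hc1, Matrix.mul_add, cf_add, hPδ.cf k0]; abel
    · ext x y
      simp only [Matrix.of_apply, hPdef, cf_apply, PowerSeries.coeff_mk, toBlocks₁₂]
      exact if_pos trivial
    · have e : (ν0 + δ) * L1 - (L2 + (ν0 + δ) * P) * (ν0 + δ) = (ν0 * L1 - L2 * ν0 - ν0 * P * ν0) -
        (L2 * δ - δ * L1) - (δ * P * (ν0 + δ) + ν0 * (P * δ)) := by
        simp only [Matrix.sub_mul, Matrix.mul_sub, Matrix.add_mul, Matrix.mul_add, Matrix.mul_assoc]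
        abel
      rw [e, cf_sub, cf_sub, hsy.2, ((hδP.mul_right (ν0 + δ)).add (hPδ.mul_left ν0)).cf k0]
      abel
    · rw [cf_add, hc2, Matrix.add_mul, cf_add, hδP.cf k0]; abel

lemma step_equiv (_ : Split k D q s c t) (hε : EpsOK q ε)
    (K1 : KMap k (q ∘ Sum.inl) (fun a b => ε (.inl a) (.inl b)) Φ1)
    (K2 : KMap k (q ∘ Sum.inr) (fun a b => ε (.inr a) (.inr b)) Φ2)
    {A11 : Matrix α α PS} {A12 : Matrix α β PS}
    {A21 : Matrix β α PS} {A22 : Matrix β β PS} {ν : Matrix β α PS} {R1 R2}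
    (H : Good k D q A11 A12 A21 A22 ν R1 R2) {h1 h1' : Matrix α α ℂ} {h2 h2' : Matrix β β ℂ}
    (e1 : h1 * h1' = 1) (e1' : h1' * h1 = 1) (e2 : h2 * h2' = 1) (e2' : h2' * h2 = 1)
    (b1 : blk (q ∘ Sum.inl) h1) (b1' : blk (q ∘ Sum.inl) h1')
    (b2 : blk (q ∘ Sum.inr) h2) (b2' : blk (q ∘ Sum.inr) h2') :
    Good k D q (cst h1 * A11 * cst h1') (cst h1 * A12 * cst h2') (cst h2 * A21 * cst h1')
      (cst h2 * A22 * cst h2') (cst h2 * ν * cst h1') (h1 * R1 * h1') (h2 * R2 * h2') ∧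
    ∀ t, Pform k D ε Φ1 Φ2 (cst h1 * A11 * cst h1') (cst h1 * A12 * cst h2')
      (cst h2 * A22 * cst h2') (cst h2 * ν * cst h1') t =
      fromBlocks h1 0 0 h2 * Pform k D ε Φ1 Φ2 A11 A12 A22 ν t * fromBlocks h1' 0 0 h2' := by
  have c1' : cst h1' * cst h1 = 1 := by rw [← cst_mul, e1', cst_one]
  have c2' : cst h2' * cst h2 = 1 := by rw [← cst_mul, e2', cst_one]
  have p1 : ∀ {γ : Type} (Z : Matrix α γ PS), cst h1' * (cst h1 * Z) = Z := by
    intro γ Z; rw [← Matrix.mul_assoc, c1', Matrix.one_mul]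
  have p2 : ∀ {γ : Type} (Z : Matrix β γ PS), cst h2' * (cst h2 * Z) = Z := by
    intro γ Z; rw [← Matrix.mul_assoc, c2', Matrix.one_mul]
  have L1 : cst h1 * A11 * cst h1' + cst h1 * A12 * cst h2' * (cst h2 * ν * cst h1') =
      cst h1 * (A11 + A12 * ν) * cst h1' := by
    simp only [Matrix.mul_add, Matrix.add_mul, Matrix.mul_assoc, p2]
  have L2 : cst h2 * A22 * cst h2' - (cst h2 * ν * cst h1') * (cst h1 * A12 * cst h2') =
      cst h2 * (A22 - ν * A12) * cst h2' := by
    simp only [Matrix.mul_sub, Matrix.sub_mul, Matrix.mul_assoc, p1]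
  refine ⟨⟨(H.hν.mul_left _).mul_right _, (H.hP.mul_left _).mul_right _, ?_, ?_, ?_⟩, ?_⟩
  · have : cst h2 * A21 * cst h1' + cst h2 * A22 * cst h2' * (cst h2 * ν * cst h1') -
        cst h2 * ν * cst h1' * (cst h1 * A11 * cst h1' + cst h1 * A12 * cst h2' * (cst h2 * ν * cst h1'))
        = cst h2 * (A21 + A22 * ν - ν * (A11 + A12 * ν)) * cst h1' := by
      rw [L1]
      simp only [Matrix.mul_sub, Matrix.sub_mul, Matrix.mul_add, Matrix.add_mul, Matrix.mul_assoc, p1, p2]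
    rw [this]; exact (H.heq.mul_left _).mul_right _
  · rw [L1]; exact H.O1.conj e1 e1' b1 b1'
  · rw [L2]; exact H.O2.conj e2 e2' b2 b2'
  · intro t
    unfold Pform
    rw [L1, L2, fromBlocks_multiply, fromBlocks_multiply]
    simp only [Matrix.zero_mul, Matrix.mul_zero, add_zero, zero_add]
    congr 1
    · exact K1.equiv _ _ _ _ H.O1 e1 e1' b1 b1' t
    · ext x y
      split_ifs with ht
      · rw [cf_mul_cst, cf_cst_mul]
        simp only [Matrix.of_apply, Matrix.mul_apply, Finset.mul_sum, Finset.sum_mul]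
        refine Finset.sum_congr rfl fun y' _ => Finset.sum_congr rfl fun x' _ => ?_
        by_cases hx : q (.inl x) = q (.inl x')
        · by_cases hy : q (.inr y') = q (.inr y)
          · rw [hε.cong (.inr y) (.inr y') (.inl x) (.inl x') hy.symm hx]; ring
          · rw [b2' y' y hy]; ring
        · rw [b1 x x' hx]; ring
      · simp [Matrix.mul_apply]
    · split_ifs with ht
      · rw [cf_mul_cst, cf_cst_mul]
      · simp
    · exact K2.equiv _ _ _ _ H.O2 e2 e2' b2 b2' t

lemma blk_blocks (S : Split k D q s c t) {h : Matrix (α ⊕ β) (α ⊕ β) ℂ} (hb : blk q h) :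
    h = fromBlocks h.toBlocks₁₁ 0 0 h.toBlocks₂₂ ∧ blk (q ∘ Sum.inl) h.toBlocks₁₁ ∧
      blk (q ∘ Sum.inr) h.toBlocks₂₂ := by
  refine ⟨?_, fun a b hab => hb _ _ hab, fun a b hab => hb _ _ hab⟩
  ext1 i j
  rcases i with i | i <;> rcases j with j | j
  · rfl
  · exact hb _ _ (S.ne i j)
  · exact hb _ _ (S.ne j i).symm
  · rfl

theorem step (S : Split k D q s c t) (hε : EpsOK q ε)
    (K1 : KMap k (q ∘ Sum.inl) (fun a b => ε (.inl a) (.inl b)) Φ1)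
    (K2 : KMap k (q ∘ Sum.inr) (fun a b => ε (.inr a) (.inr b)) Φ2) :
    KMap k q ε (PhiS k D q ε Φ1 Φ2) := by
  have key : ∀ A R, Ohat k q A R → ∃ A11 A12 A21 A22 ν R1 R2, A = fromBlocks A11 A12 A21 A22 ∧
      R = fromBlocks R1 0 0 R2 ∧ Good k D q A11 A12 A21 A22 ν R1 R2 := by
    intro A R H
    rw [← fromBlocks_toBlocks A] at H
    obtain ⟨hR, ν, hG⟩ := gauss S H
    exact ⟨_, _, _, _, ν, _, _, (fromBlocks_toBlocks A).symm, hR, hG⟩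
  refine ⟨?_, ?_, ?_, ?_, ?_, ?_⟩
  · intro A R H
    obtain ⟨A11, A12, A21, A22, ν, R1, R2, rfl, rfl, G⟩ := key A R H
    rw [PhiS_eq S K1 K2 G]
    exact step_supp S K1 K2 G
  · intro A R H a b hab
    obtain ⟨A11, A12, A21, A22, ν, R1, R2, rfl, rfl, G⟩ := key A R H
    rw [PhiS_eq S K1 K2 G]
    exact step_moment S hε K1 K2 G a b hab
  · intro A R A' R' H H' hΦ hc
    obtain ⟨A11, A12, A21, A22, ν, R1, R2, rfl, rfl, G⟩ := key A R H
    obtain ⟨A11', A12', A21', A22', ν', R1', R2', rfl, rfl, G'⟩ := key A' R' H'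
    rw [PhiS_eq S K1 K2 G, PhiS_eq S K1 K2 G'] at hΦ
    exact step_inj S hε K1 K2 G G' hΦ hc
  · intro X Y hX
    obtain ⟨A11, A12, A21, A22, ν, R1, R2, G, h1, h2⟩ := step_surj S hε K1 K2 X Y hX
    refine ⟨_, _, G.ohat S, ?_, h2⟩
    rw [PhiS_eq S K1 K2 G, h1]
  · intro A R h h' H e e' hb hb' t
    obtain ⟨A11, A12, A21, A22, ν, R1, R2, rfl, rfl, G⟩ := key A R H
    obtain ⟨hh, hb1, hb2⟩ := blk_blocks S hb
    obtain ⟨hh', hb1', hb2'⟩ := blk_blocks S hb'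
    rw [hh, hh'] at e e' ⊢
    rw [fromBlocks_multiply, ← fromBlocks_one, fromBlocks_inj] at e e'
    simp only [Matrix.zero_mul, Matrix.mul_zero, add_zero, zero_add] at e e'
    obtain ⟨G', hG'⟩ := step_equiv S hε K1 K2 G e.1 e'.1 e.2.2.2 e'.2.2.2 hb1 hb1' hb2 hb2'
    rw [PhiS_eq S K1 K2 G, ← hG' t, cst_blocks, cst_blocks, fromBlocks_multiply, fromBlocks_multiply]
    simp only [Matrix.zero_mul, Matrix.mul_zero, add_zero, zero_add, cst_zero]
    rw [PhiS_eq S K1 K2 G']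
  · intro A R A' H hA
    obtain ⟨A11, A12, A21, A22, ν, R1, R2, rfl, rfl, G⟩ := key A R H
    rw [← fromBlocks_toBlocks A'] at hA ⊢
    rw [sub_blocks, dv_blocks] at hA
    have G' := G.congr S.hD2 S.hDk hA.1 hA.2.1 hA.2.2.1 hA.2.2.2
    rw [PhiS_eq S K1 K2 G, PhiS_eq S K1 K2 G']
    have hDk := S.hDk
    have hD2 := S.hD2
    have f1 : Φ1 (A'.toBlocks₁₁ + A'.toBlocks₁₂ * ν) = Φ1 (A11 + A12 * ν) := by
      refine K1.congr _ _ _ G.O1 ?_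
      have : (A11 + A12 * ν) - (A'.toBlocks₁₁ + A'.toBlocks₁₂ * ν) =
        (A11 - A'.toBlocks₁₁) + (A12 - A'.toBlocks₁₂) * ν := by
        rw [Matrix.sub_mul]; abel
      rw [this]; exact hA.1.add (hA.2.1.mul_right _)
    have f2 : Φ2 (A'.toBlocks₂₂ - ν * A'.toBlocks₁₂) = Φ2 (A22 - ν * A12) := by
      refine K2.congr _ _ _ G.O2 ?_
      have : (A22 - ν * A12) - (A'.toBlocks₂₂ - ν * A'.toBlocks₁₂) =
        (A22 - A'.toBlocks₂₂) - ν * (A12 - A'.toBlocks₁₂) := by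
        rw [Matrix.mul_sub]; abel
      rw [this]; exact hA.2.2.2.sub (hA.2.1.mul_left _)
    funext t
    unfold Pform
    rw [f1, f2]
    congr 1
    ext x y
    simp only [Matrix.of_apply]
    split_ifs with ht
    · rw [dv_cst_smul hA.2.1 (by omega : k - 2 - t < k)]
    · rfl
end step

theorem exists_kmap (N : ℕ) : ∀ (ι : Type) [Fintype ι] [DecidableEq ι] (k : ℕ) (q : ι → ℂ[X])
    (ε : ι → ι → ℂ), Fintype.card ι = N → 0 < k → (∀ a, (q a).coeff 0 = 0) →
    (∀ a, (q a).coeff 1 = 0) → (∀ a, (q a).natDegree ≤ k) → EpsOK q ε → ∃ Φ, KMap k q ε Φ := by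
  induction N using Nat.strong_induction_on with
  | _ N ih =>
  intro ι _ _ k q ε hN hk hq0 hq1 hqk hε
  by_cases hall : ∀ a b, q a = q b
  · exact ⟨_, kmap_base hk ε hq1 hall⟩
  push Not at hall
  obtain ⟨x, y, hxy⟩ := hall
  obtain ⟨⟨a0, b0⟩, -, hmax⟩ := Finset.exists_max_image (Finset.univ : Finset (ι × ι))
    (fun z => (q z.1 - q z.2).natDegree) ⟨(x, y), Finset.mem_univ _⟩
  replace hmax : ∀ a b, (q a - q b).natDegree ≤ (q a0 - q b0).natDegree :=
    fun a b => hmax (a, b) (Finset.mem_univ _)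
  set D := (q a0 - q b0).natDegree with hD
  have big : ∀ a b, q a ≠ q b → 2 ≤ (q a - q b).natDegree := by
    intro a b hab
    by_contra hlt
    apply hab
    rw [← sub_eq_zero]
    ext n
    rcases n with _ | _ | n
    · rw [coeff_sub, hq0, hq0]; simp
    · rw [coeff_sub, hq1, hq1]; simp
    · rw [coeff_eq_zero_of_natDegree_lt (by omega)]; simp
  have hD2 : 2 ≤ D := (big x y hxy).trans (hmax x y)
  have hDk : D ≤ k := (natDegree_sub_le _ _).trans (max_le (hqk _) (hqk _))
  have hab0 : (q b0).coeff D ≠ (q a0).coeff D := by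
    intro h
    have h1 : (q a0 - q b0).coeff D = 0 := by rw [coeff_sub, h, sub_self]
    have h2 : q a0 - q b0 = 0 := leadingCoeff_eq_zero.1 h1
    rw [h2] at hD; simp at hD; omega
  let p : ι → Prop := fun a => (q a).coeff D = (q a0).coeff D
  have : DecidablePred p := Classical.decPred p
  let e : {a // p a} ⊕ {a // ¬ p a} ≃ ι := Equiv.sumCompl p
  have S : Split k D (q ∘ e) (((reflect k (q a0) : ℂ[X]) : PS) - xx ^ (k - D) *
      PowerSeries.C ((q a0).coeff D)) ((q a0).coeff D)
      (fun b : {a // ¬ p a} => (q b.1).coeff D) := by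
    refine ⟨hD2, hDk, ?_, ?_, ?_, ?_⟩
    · rintro ⟨a, ha⟩
      have := refl_shape hDk (p := q a) (p0 := q a0) (hmax a a0)
      rw [show (q a).coeff D = (q a0).coeff D from ha] at this
      exact this
    · rintro ⟨b, hb⟩
      exact refl_shape hDk (hmax b a0)
    · rintro ⟨b, hb⟩; exact hb
    · rintro ⟨a, ha⟩ ⟨b, hb⟩
      refine le_antisymm (hmax a b) (le_natDegree_of_ne_zero ?_)
      change (q a - q b).coeff D ≠ 0
      rw [coeff_sub, show (q a).coeff D = (q a0).coeff D from ha, sub_ne_zero]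
      exact Ne.symm hb
  have hcard : Fintype.card {a // p a} + Fintype.card {a // ¬ p a} = N := by
    rw [← Fintype.card_sum, Fintype.card_congr e, hN]
  have hc1 : 0 < Fintype.card {a // p a} := Fintype.card_pos_iff.2 ⟨⟨a0, rfl⟩⟩
  have hc2 : 0 < Fintype.card {a // ¬ p a} := Fintype.card_pos_iff.2 ⟨⟨b0, hab0⟩⟩
  have sub : ∀ {κ : Type} (i : κ → ι), EpsOK (q ∘ i) (fun a b => ε (i a) (i b)) := fun i =>
    ⟨fun a a' c c' h h' => hε.cong _ _ _ _ h h', fun a c h => hε.anti _ _ h,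
      fun a c h => hε.sq _ _ h⟩
  obtain ⟨Φ1, K1⟩ := ih (Fintype.card {a // p a}) (by omega) _ k ((q ∘ e) ∘ Sum.inl)
    (fun a b => ε (e (.inl a)) (e (.inl b))) rfl hk (fun a => hq0 _) (fun a => hq1 _) (fun a => hqk _)
    (sub (fun a => e (.inl a)))
  obtain ⟨Φ2, K2⟩ := ih (Fintype.card {a // ¬ p a}) (by omega) _ k ((q ∘ e) ∘ Sum.inr)
    (fun a b => ε (e (.inr a)) (e (.inr b))) rfl hk (fun a => hq0 _) (fun a => hq1 _) (fun a => hqk _)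
    (sub (fun a => e (.inr a)))
  exact ⟨_, KMap.reindex e (step S (ε := fun a b => ε (e a) (e b)) (sub e) K1 K2)⟩
end

noncomputable section
set_option linter.unusedSimpArgs false
set_option linter.unusedSectionVars false

/-- Constant matrices intertwining two elements are block diagonal. -/
lemma stab {ι : Type} [Fintype ι] [DecidableEq ι] {k : ℕ} {q : ι → ℂ[X]}
    (hq0 : ∀ a, (q a).coeff 0 = 0)
    (hq1 : ∀ a, (q a).coeff 1 = 0) (hqk : ∀ a, (q a).natDegree ≤ k)
    {A A' : Matrix ι ι PS} {R R' P : Matrix ι ι ℂ}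
    (h : Ohat k q A R) (h' : Ohat k q A' R') (hP : dv k (cst P * A - A' * cst P)) : blk q P := by
  intro x y hxy
  obtain ⟨-, b, hb, h⟩ := h
  obtain ⟨-, b', hb', h'⟩ := h'
  obtain ⟨c, hbc, hcb, hc⟩ := exists_inv hb'
  have hD2 : 2 ≤ (q y - q x).natDegree := by
    by_contra hlt
    apply hxy
    symm
    rw [← sub_eq_zero]
    ext n
    rcases n with _ | _ | n
    · rw [coeff_sub, hq0, hq0]; simp
    · rw [coeff_sub, hq1, hq1]; simp
    · rw [coeff_eq_zero_of_natDegree_lt (by omega)]; simp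
  have hDk : (q y - q x).natDegree ≤ k := (natDegree_sub_le _ _).trans (max_le (hqk _) (hqk _))
  set D := (q y - q x).natDegree with hD
  have hDc : (q y - q x).coeff D ≠ 0 := by
    intro h0
    have h2 : q y - q x = 0 := leadingCoeff_eq_zero.1 h0
    rw [h2] at hD; simp at hD; omega
  set L := Bq k q + xx ^ (k - 1) • cst R with hL
  set L' := Bq k q + xx ^ (k - 1) • cst R' with hL'
  have key : dv k (c * cst P * b * L - L' * (c * cst P * b)) := by
    have e : c * cst P * b * L - L' * (c * cst P * b) =
      - (c * cst P * (A * b - b * L)) + c * (cst P * A - A' * cst P) * b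
      + c * (A' * b' - b' * L') * c * cst P * b := by
      have e1 : c * (A' * b' - b' * L') * c = c * A' - L' * c := by
        rw [Matrix.mul_sub, Matrix.sub_mul, ← Matrix.mul_assoc c b' L', hcb, Matrix.one_mul]
        simp only [Matrix.mul_assoc, hbc, Matrix.mul_one]
      rw [e1]
      simp only [Matrix.sub_mul, Matrix.mul_sub, Matrix.mul_assoc]
      abel
    rw [e]
    exact (((h.mul_left _).neg).add ((hP.mul_left _).mul_right _)).add
      ((((h'.mul_left _).mul_right _).mul_right _).mul_right _)
  set g := c * cst P * b with hg
  have hg0 : cf 0 g = P := by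
    have : dv 1 (g - cst P) := by
      have e : g - cst P = (c - 1) * cst P * b + cst P * (b - 1) := by
        simp only [hg, Matrix.sub_mul, Matrix.mul_sub, Matrix.one_mul, Matrix.mul_one]; abel
      rw [e]
      exact ((hc.mul_right _).mul_right _).add (hb.mul_left _)
    rw [dv_cst_smul this (by norm_num), cf_cst]; simp
  have e2 : g * L - L' * g = (g * Bq k q - Bq k q * g) + xx ^ (k - 1) • (g * cst R - cst R' * g) := by
    simp only [hL, hL', Matrix.mul_add, Matrix.add_mul, Matrix.mul_smul, Matrix.smul_mul, smul_sub]
    abel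
  rw [e2] at key
  have h1 := key.cf (show k - D < k by omega)
  rw [cf_add, (dv_smul (k - 1) (g * cst R - cst R' * g)).cf (by omega), add_zero] at h1
  have h2 := congrFun (congrFun h1 x) y
  simp only [cf_apply, Matrix.sub_apply, Bq, Matrix.mul_diagonal, Matrix.diagonal_mul,
    Matrix.zero_apply] at h2
  rw [mul_comm (((reflect k (q x) : ℂ[X]) : PS)), ← mul_sub] at h2
  have hcoef : ∀ m ≤ k, PowerSeries.coeff m
      (((reflect k (q y) : ℂ[X]) : PS) - ((reflect k (q x) : ℂ[X]) : PS)) =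
      (q y - q x).coeff (k - m) := by
    intro m hm
    rw [map_sub, Polynomial.coeff_coe, Polynomial.coeff_coe, coeff_reflect, coeff_reflect,
      revAt_le hm, coeff_sub]
  obtain ⟨u, hu⟩ : xx ^ (k - D) ∣ (((reflect k (q y) : ℂ[X]) : PS) - ((reflect k (q x) : ℂ[X]) : PS)) := by
    refine PowerSeries.X_pow_dvd_iff.2 fun m hm => ?_
    rw [hcoef m (by omega)]
    exact coeff_eq_zero_of_natDegree_lt (by omega)
  have h3 := hcoef (k - D) (by omega)
  rw [hu, show k - (k - D) = D by omega, xx, PowerSeries.coeff_X_pow_mul', if_pos le_rfl,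
    Nat.sub_self] at h3
  rw [hu, mul_left_comm, xx, PowerSeries.coeff_X_pow_mul', if_pos le_rfl, Nat.sub_self,
    PowerSeries.coeff_zero_eq_constantCoeff_apply, map_mul] at h2
  rw [PowerSeries.coeff_zero_eq_constantCoeff_apply] at h3
  rw [h3] at h2
  have h4 := (mul_eq_zero.1 h2).resolve_right hDc
  rw [← hg0, cf_apply, PowerSeries.coeff_zero_eq_constantCoeff_apply]; exact h4
end

noncomputable section
set_option linter.unusedSimpArgs false
set_option linter.unusedSectionVars false

/-- left invertible rectangular matrices -/
def LI {ι κ : Type} [Fintype ι] [DecidableEq κ] (M : Matrix ι κ ℂ) : Prop :=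
  ∃ p : Matrix κ ι ℂ, p * M = 1

/-- right invertible rectangular matrices -/
def RI {ι κ : Type} [Fintype κ] [DecidableEq ι] (M : Matrix ι κ ℂ) : Prop :=
  ∃ p : Matrix κ ι ℂ, M * p = 1

theorem inj_iff {ι κ : Type} [Fintype ι] [DecidableEq ι] [Fintype κ] [DecidableEq κ]
    (M : Matrix ι κ ℂ) : Function.Injective M.mulVec ↔ LI M := by
  constructor
  · intro h
    obtain ⟨g, hg⟩ := LinearMap.exists_leftInverse_of_injective (Matrix.toLin' M)
      (LinearMap.ker_eq_bot.2 (by rw [Matrix.toLin'_apply', Matrix.coe_mulVecLin]; exact h))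
    refine ⟨LinearMap.toMatrix' g, ?_⟩
    apply Matrix.toLin'.injective
    rw [Matrix.toLin'_mul, Matrix.toLin'_toMatrix', hg, Matrix.toLin'_one]
  · rintro ⟨p, hp⟩ x y hxy
    have := congrArg (p.mulVec) hxy
    simpa [Matrix.mulVec_mulVec, hp] using this

theorem surj_iff {ι κ : Type} [Fintype ι] [DecidableEq ι] [Fintype κ] [DecidableEq κ]
    (M : Matrix ι κ ℂ) : Function.Surjective M.mulVec ↔ RI M :=
  Matrix.mulVec_surjective_iff_exists_right_inverse

/-- every solution can be improved until it is injective -/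
theorem basic_aux {V W : Type} [AddCommGroup V] [Module ℂ V] [AddCommGroup W] [Module ℂ W]
    [FiniteDimensional ℂ V] [FiniteDimensional ℂ W]
    (f f' : V →ₗ[ℂ] W) (g g' : W →ₗ[ℂ] V)
    (hf' : Function.Injective f') (hg : Function.Surjective g)
    (N : ℕ) : ∀ ψ : W →ₗ[ℂ] W, Module.finrank ℂ (LinearMap.ker ψ) = N → ψ ∘ₗ f = f' →
      g' ∘ₗ ψ = g →
      ∃ ψ : W →ₗ[ℂ] W, Function.Injective ψ ∧ ψ ∘ₗ f = f' ∧ g' ∘ₗ ψ = g := by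
  induction N using Nat.strong_induction_on with
  | _ N ih =>
  intro ψ hN h1 h2
  by_cases hinj : Function.Injective ψ
  · exact ⟨ψ, hinj, h1, h2⟩
  have hker : LinearMap.ker ψ ≠ ⊥ := fun h => hinj (LinearMap.ker_eq_bot.1 h)
  obtain ⟨w, hw, hw0⟩ := Submodule.exists_mem_ne_zero_of_ne_bot hker
  rw [LinearMap.mem_ker] at hw
  have hgψ : ∀ x, g' (ψ x) = g x := fun x => by rw [← h2]; rfl
  have hfψ : ∀ x, ψ (f x) = f' x := fun x => by rw [← h1]; rfl
  have hwI : w ∉ LinearMap.range f := by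
    rintro ⟨x, rfl⟩
    rw [hfψ] at hw
    have : x = 0 := hf' (by rw [hw, map_zero])
    apply hw0; rw [this, map_zero]
  obtain ⟨w', hw'N, hw'⟩ : ∃ w', g' w' = 0 ∧ w' ∉ LinearMap.range ψ := by
    by_contra hcon
    push Not at hcon
    -- then `ψ` is surjective
    apply hinj
    rw [LinearMap.injective_iff_surjective]
    intro y
    obtain ⟨x, hx⟩ := hg (g' y)
    obtain ⟨z, hz⟩ := hcon (y - ψ x) (by rw [map_sub, hgψ, hx, sub_self])
    exact ⟨x + z, by rw [map_add, hz]; abel⟩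
  obtain ⟨l, hl1, hl2⟩ := Submodule.exists_le_ker_of_notMem hwI
  set ψ' : W →ₗ[ℂ] W := ψ + l.smulRight w' with hψ'
  have hap : ∀ x, ψ' x = ψ x + l x • w' := fun x => rfl
  refine ih _ ?_ ψ' rfl ?_ ?_
  · rw [← hN]
    apply Submodule.finrank_lt_finrank_of_lt
    refine lt_of_le_of_ne ?_ ?_
    · intro u hu
      rw [LinearMap.mem_ker, hap] at hu
      rw [LinearMap.mem_ker]
      by_cases hlu : l u = 0
      · simpa [hlu] using hu
      · exfalso; apply hw'
        refine ⟨-(l u)⁻¹ • u, ?_⟩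
        have : ψ u = - (l u • w') := eq_neg_of_add_eq_zero_left hu
        rw [map_smul, this, smul_neg, neg_smul, neg_neg, smul_smul, inv_mul_cancel₀ hlu, one_smul]
    · intro h
      have hw2 : w ∈ LinearMap.ker ψ' := by rw [h]; exact hw
      rw [LinearMap.mem_ker, hap, hw, zero_add] at hw2
      rcases smul_eq_zero.1 hw2 with h3 | h3
      · exact hl1 h3
      · apply hw'; rw [h3]; exact Submodule.zero_mem _
  · ext x
    have : l (f x) = 0 := by
      have := hl2 (LinearMap.mem_range_self f x)
      exact this
    simp [hap, this, hfψ]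
  · ext x
    simp [hap, hgψ, hw'N]

theorem basic_mat {V W : Type} [Fintype V] [DecidableEq V] [Fintype W] [DecidableEq W]
    (f f' : Matrix W V ℂ) (g g' : Matrix V W ℂ)
    (hf : LI f) (hf' : LI f') (hg : RI g) (hg' : RI g')
    (h : g * f = g' * f') :
    ∃ ψ ψi : Matrix W W ℂ, ψ * ψi = 1 ∧ ψi * ψ = 1 ∧ ψ * f = f' ∧ g' * ψ = g := by
  obtain ⟨p, hp⟩ := hf
  obtain ⟨s', hs'⟩ := hg'
  have h1 : (f' * p + s' * (g - g' * f' * p)) * f = f' := by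
    rw [Matrix.add_mul, Matrix.mul_assoc, hp, Matrix.mul_assoc, Matrix.sub_mul,
      Matrix.mul_assoc _ p f, hp, Matrix.mul_one, h]; simp
  have h2 : g' * (f' * p + s' * (g - g' * f' * p)) = g := by
    rw [Matrix.mul_add, ← Matrix.mul_assoc g' s', hs', Matrix.one_mul, Matrix.mul_assoc]; abel
  obtain ⟨ψ, hi, ha, hb⟩ := basic_aux (Matrix.toLin' f) (Matrix.toLin' f') (Matrix.toLin' g)
    (Matrix.toLin' g')
    (by rw [Matrix.toLin'_apply', Matrix.coe_mulVecLin]; exact (inj_iff f').2 hf')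
    (by rw [Matrix.toLin'_apply', Matrix.coe_mulVecLin]; exact (surj_iff g).2 hg)
    _
    (Matrix.toLin' (f' * p + s' * (g - g' * f' * p))) rfl
    (by rw [← Matrix.toLin'_mul, h1]) (by rw [← Matrix.toLin'_mul, h2])
  obtain ⟨ψi, hψi⟩ := (inj_iff (LinearMap.toMatrix' ψ)).1 (by
    have : (LinearMap.toMatrix' ψ).mulVec = ψ := by
      rw [← Matrix.coe_mulVecLin, ← Matrix.toLin'_apply', Matrix.toLin'_toMatrix']
    rw [this]; exact hi)
  refine ⟨LinearMap.toMatrix' ψ, ψi, mul_eq_one_comm.1 hψi, hψi, ?_, ?_⟩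
  · apply Matrix.toLin'.injective
    rw [Matrix.toLin'_mul, Matrix.toLin'_toMatrix', ha]
  · apply Matrix.toLin'.injective
    rw [Matrix.toLin'_mul, Matrix.toLin'_toMatrix', hb]

theorem rank_fact {V T : Type} [Fintype V] [DecidableEq V] [Fintype T] [DecidableEq T]
    (M : Matrix V V ℂ) (h : M.rank = Fintype.card T) :
    ∃ (E : Matrix V T ℂ) (H : Matrix T V ℂ), M = E * H ∧ LI E ∧ RI H := by
  have hr : Module.finrank ℂ (LinearMap.range (Matrix.toLin' M)) = Module.finrank ℂ (T → ℂ) := by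
    rw [Module.finrank_fintype_fun_eq_card, ← h, Matrix.rank, Matrix.toLin'_apply']
  let e := LinearEquiv.ofFinrankEq _ _ hr
  let E : (T → ℂ) →ₗ[ℂ] (V → ℂ) := (LinearMap.range (Matrix.toLin' M)).subtype ∘ₗ e.symm.toLinearMap
  let H : (V → ℂ) →ₗ[ℂ] (T → ℂ) := e.toLinearMap ∘ₗ (Matrix.toLin' M).rangeRestrict
  have key : ∀ {A B : Type} [Fintype A] [DecidableEq A] [Fintype B] [DecidableEq B]
      (F : (A → ℂ) →ₗ[ℂ] (B → ℂ)), (LinearMap.toMatrix' F).mulVec = F := by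
    intro A B _ _ _ _ F
    rw [← Matrix.coe_mulVecLin, ← Matrix.toLin'_apply', Matrix.toLin'_toMatrix']
  refine ⟨LinearMap.toMatrix' E, LinearMap.toMatrix' H, ?_, ?_, ?_⟩
  · apply Matrix.toLin'.injective
    rw [Matrix.toLin'_mul, Matrix.toLin'_toMatrix', Matrix.toLin'_toMatrix']
    ext x : 2
    simp [E, H]
  · rw [← inj_iff, key]
    exact (Submodule.subtype_injective _).comp e.symm.injective
  · rw [← surj_iff, key]
    exact e.surjective.comp (LinearMap.surjective_rangeRestrict _)

end

noncomputable section
set_option linter.unusedSimpArgs false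
set_option linter.unusedSectionVars false

theorem LI.cancel {ι κ ν : Type} [Fintype ι] [Fintype κ] [DecidableEq κ] {M : Matrix ι κ ℂ}
    (h : LI M) {A B : Matrix κ ν ℂ} (hAB : M * A = M * B) : A = B := by
  obtain ⟨p, hp⟩ := h
  have := congrArg (fun Z => p * Z) hAB
  simpa [← Matrix.mul_assoc, hp] using this

structure IsLeg (T : ℕ → Type) [∀ k, Fintype (T k)] [∀ k, DecidableEq (T k)] (ξ : ℕ → ℂ)
    (f : ∀ k, Matrix (T k) (T (k+1)) ℂ) (g : ∀ k, Matrix (T (k+1)) (T k) ℂ) : Prop where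
  li : ∀ k, LI (f k)
  ri : ∀ k, RI (g k)
  mom : ∀ k, f (k+1) * g (k+1) - g k * f k = (ξ k - ξ (k+1)) • 1

section
variable {T : ℕ → Type} [∀ k, Fintype (T k)] [∀ k, DecidableEq (T k)] {ξ : ℕ → ℂ}
  {f f' : ∀ k, Matrix (T k) (T (k+1)) ℂ} {g g' : ∀ k, Matrix (T (k+1)) (T k) ℂ}

theorem legsim (h : IsLeg T ξ f g) (h' : IsLeg T ξ f' g') {K : ℕ} (hK : IsEmpty (T K)) :
    ∃ φ φi : Matrix (T 0) (T 0) ℂ, φ * φi = 1 ∧ φi * φ = 1 ∧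
      φ * (f 0 * g 0) = (f' 0 * g' 0) * φ := by
  have main : ∀ d κ, κ + d = K → ∃ φ φi : Matrix (T κ) (T κ) ℂ, φ * φi = 1 ∧ φi * φ = 1 ∧
      φ * (f κ * g κ) = (f' κ * g' κ) * φ := by
    intro d
    induction d with
    | zero =>
      intro κ hκ
      obtain rfl : κ = K := hκ
      exact ⟨0, 0, by ext a; exact hK.elim a, by ext a; exact hK.elim a, by ext a; exact hK.elim a⟩
    | succ d ih =>
      intro κ hκ
      obtain ⟨φ, φi, h1, h2, h3⟩ := ih (κ+1) (by omega)
      have e1 : g κ * f κ = f (κ+1) * g (κ+1) - (ξ κ - ξ (κ+1)) • 1 := by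
        rw [← h.mom κ]; abel
      have e2 : g' κ * f' κ = f' (κ+1) * g' (κ+1) - (ξ κ - ξ (κ+1)) • 1 := by
        rw [← h'.mom κ]; abel
      have e3 : φ * (g κ * f κ) = (g' κ * f' κ) * φ := by
        rw [e1, e2, Matrix.mul_sub, Matrix.sub_mul, h3]; simp
      obtain ⟨ψ, ψi, k1, k2, k3, k4⟩ := basic_mat (f κ) (f' κ * φ) (g κ) (φi * g' κ)
        (h.li κ) (by
          obtain ⟨p, hp⟩ := h'.li κ
          exact ⟨φi * p, by rw [Matrix.mul_assoc, ← Matrix.mul_assoc p, hp, Matrix.one_mul, h2]⟩)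
        (h.ri κ) (by
          obtain ⟨p, hp⟩ := h'.ri κ
          exact ⟨p * φ, by rw [Matrix.mul_assoc, ← Matrix.mul_assoc _ p, hp, Matrix.one_mul, h2]⟩)
        (by
          calc g κ * f κ = φi * (φ * (g κ * f κ)) := by rw [← Matrix.mul_assoc φi, h2, Matrix.one_mul]
          _ = _ := by rw [e3]; simp only [Matrix.mul_assoc])
      refine ⟨ψ, ψi, k1, k2, ?_⟩
      have k5 : φ * g κ = g' κ * ψ := by
        rw [← k4, ← Matrix.mul_assoc, ← Matrix.mul_assoc, h1, Matrix.one_mul]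
      rw [← Matrix.mul_assoc, k3, Matrix.mul_assoc, k5, Matrix.mul_assoc]
  exact main K 0 (by omega)

theorem legstep (h : IsLeg T ξ f g) (h' : IsLeg T ξ f' g') (κ : ℕ)
    {φ φi : Matrix (T κ) (T κ) ℂ} (h1 : φ * φi = 1) (h2 : φi * φ = 1)
    (h3 : φ * (f κ * g κ) = (f' κ * g' κ) * φ) :
    ∃ ψ ψi : Matrix (T (κ+1)) (T (κ+1)) ℂ, ψ * ψi = 1 ∧ ψi * ψ = 1 ∧
      ψ * (f (κ+1) * g (κ+1)) = (f' (κ+1) * g' (κ+1)) * ψ ∧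
      φ * f κ = f' κ * ψ ∧ ψ * g κ = g' κ * φ := by
  have key : ∀ {f f' : Matrix (T κ) (T (κ+1)) ℂ} {g g' : Matrix (T (κ+1)) (T κ) ℂ}
      {φ : Matrix (T κ) (T κ) ℂ}, LI f' → RI g → φ * (f * g) = (f' * g') * φ →
      ∃ ψ : Matrix (T (κ+1)) (T (κ+1)) ℂ, φ * f = f' * ψ ∧ ψ * g = g' * φ := by
    intro f f' g g' φ hf' hg h3
    obtain ⟨p', hp'⟩ := id hf'
    obtain ⟨s, hs⟩ := hg
    have a1 : φ * f = f' * (g' * (φ * s)) := by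
      have := congrArg (fun Z => Z * s) h3
      simp only [Matrix.mul_assoc, hs, Matrix.mul_one] at this
      exact this
    have a2 : φ * f = f' * (p' * (φ * f)) := by
      rw [a1, ← Matrix.mul_assoc p', hp', Matrix.one_mul]
    refine ⟨p' * (φ * f), a2, hf'.cancel ?_⟩
    rw [← Matrix.mul_assoc, ← a2, Matrix.mul_assoc, h3, Matrix.mul_assoc]
  obtain ⟨ψ, a1, a2⟩ := key (h'.li κ) (h.ri κ) h3
  have h3' : φi * (f' κ * g' κ) = (f κ * g κ) * φi := by
    calc φi * (f' κ * g' κ) = φi * ((f' κ * g' κ) * φ) * φi := by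
          rw [Matrix.mul_assoc, Matrix.mul_assoc (f' κ * g' κ), h1, Matrix.mul_one]
      _ = _ := by rw [← h3, ← Matrix.mul_assoc φi, h2, Matrix.one_mul]
  obtain ⟨ψi, b1, b2⟩ := key (h.li κ) (h'.ri κ) h3'
  have e1 : f (κ+1) * g (κ+1) = g κ * f κ + (ξ κ - ξ (κ+1)) • 1 := by
    rw [← h.mom κ]; abel
  have e2 : f' (κ+1) * g' (κ+1) = g' κ * f' κ + (ξ κ - ξ (κ+1)) • 1 := by
    rw [← h'.mom κ]; abel
  refine ⟨ψ, ψi, ?_, ?_, ?_, a1, a2⟩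
  · apply (h'.li κ).cancel
    rw [← Matrix.mul_assoc, ← a1, Matrix.mul_assoc, ← b1, ← Matrix.mul_assoc, h1, Matrix.one_mul,
      Matrix.mul_one]
  · apply (h.li κ).cancel
    rw [← Matrix.mul_assoc, ← b1, Matrix.mul_assoc, ← a1, ← Matrix.mul_assoc, h2, Matrix.one_mul,
      Matrix.mul_one]
  · have : ψ * (g κ * f κ) = (g' κ * f' κ) * ψ := by
      rw [← Matrix.mul_assoc, a2, Matrix.mul_assoc, a1, Matrix.mul_assoc]
    rw [e1, e2, Matrix.mul_add, Matrix.add_mul, this]; simp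

theorem legiso (h : IsLeg T ξ f g) (h' : IsLeg T ξ f' g')
    {φ φi : Matrix (T 0) (T 0) ℂ} (h1 : φ * φi = 1) (h2 : φi * φ = 1)
    (h3 : φ * (f 0 * g 0) = (f' 0 * g' 0) * φ) :
    ∃ ψ ψi : ∀ κ, Matrix (T κ) (T κ) ℂ, ψ 0 = φ ∧ ψi 0 = φi ∧
      (∀ κ, ψ κ * ψi κ = 1) ∧ (∀ κ, ψi κ * ψ κ = 1) ∧
      (∀ κ, ψ κ * f κ = f' κ * ψ (κ+1)) ∧ (∀ κ, ψ (κ+1) * g κ = g' κ * ψ κ) := by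
  let Y : ℕ → Type := fun κ => {x : Matrix (T κ) (T κ) ℂ × Matrix (T κ) (T κ) ℂ //
    x.1 * x.2 = 1 ∧ x.2 * x.1 = 1 ∧ x.1 * (f κ * g κ) = (f' κ * g' κ) * x.1}
  have step : ∀ κ (y : Y κ), ∃ z : Y (κ+1), y.1.1 * f κ = f' κ * z.1.1 ∧
      z.1.1 * g κ = g' κ * y.1.1 := by
    intro κ y
    obtain ⟨ψ, ψi, a, b, c, d, e⟩ := legstep h h' κ y.2.1 y.2.2.1 y.2.2.2
    exact ⟨⟨(ψ, ψi), a, b, c⟩, d, e⟩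
  choose nxt hn1 hn2 using step
  let y : ∀ κ, Y κ := fun κ => Nat.rec (motive := Y) ⟨(φ, φi), h1, h2, h3⟩ nxt κ
  exact ⟨fun κ => (y κ).1.1, fun κ => (y κ).1.2, rfl, rfl, fun κ => (y κ).2.1,
    fun κ => (y κ).2.2.1, fun κ => hn1 κ (y κ), fun κ => hn2 κ (y κ)⟩

/-- partial products -/
def pp {B : Type} [Fintype B] [DecidableEq B] (A : Matrix B B ℂ) (ξ : ℕ → ℂ) : ℕ → Matrix B B ℂ
  | 0 => 1
  | κ+1 => pp A ξ κ * (A - ξ κ • 1)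

theorem pp_comm {B : Type} [Fintype B] [DecidableEq B] (A : Matrix B B ℂ) (ξ : ℕ → ℂ) (c : ℂ) :
    ∀ κ, pp A ξ κ * (A - c • 1) = (A - c • 1) * pp A ξ κ
  | 0 => by simp [pp]
  | κ+1 => by
    have h1 : (A - ξ κ • 1) * (A - c • 1) = (A - c • 1) * (A - ξ κ • 1) := by
      simp only [Matrix.mul_sub, Matrix.sub_mul, smul_sub, smul_smul, mul_comm, Matrix.smul_mul,
        Matrix.mul_smul, Matrix.one_mul, Matrix.mul_one]; abel
    rw [pp, Matrix.mul_assoc, h1, ← Matrix.mul_assoc, pp_comm A ξ c κ, Matrix.mul_assoc]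

theorem legexist (A : Matrix (T 0) (T 0) ℂ)
    (hr : ∀ κ, (pp A ξ (κ+1)).rank = Fintype.card (T (κ+1))) :
    ∃ f g, IsLeg T ξ f g ∧ f 0 * g 0 = A - ξ 0 • 1 := by
  choose E' H' hEH' hE' hH' using fun κ => rank_fact (T := T (κ+1)) (pp A ξ (κ+1)) (hr κ)
  let E : ∀ κ, Matrix (T 0) (T κ) ℂ := fun κ => match κ with
    | 0 => 1
    | κ+1 => E' κ
  let H : ∀ κ, Matrix (T κ) (T 0) ℂ := fun κ => match κ with
    | 0 => 1
    | κ+1 => H' κ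
  have hEH : ∀ κ, pp A ξ κ = E κ * H κ := by
    intro κ
    cases κ with
    | zero => simp [pp, E, H]
    | succ κ => exact hEH' κ
  have hE : ∀ κ, LI (E κ) := by
    intro κ
    cases κ with
    | zero => exact ⟨1, Matrix.one_mul _⟩
    | succ κ => exact hE' κ
  have hH : ∀ κ, RI (H κ) := by
    intro κ
    cases κ with
    | zero => exact ⟨1, Matrix.one_mul _⟩
    | succ κ => exact hH' κ
  have hE0 : E 0 = 1 := rfl
  clear_value E H
  choose s hs using hH
  let f : ∀ k, Matrix (T k) (T (k+1)) ℂ := fun κ => H κ * ((A - ξ κ • 1) * s (κ+1))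
  let g : ∀ k, Matrix (T (k+1)) (T k) ℂ := fun κ => H (κ+1) * s κ
  have hEf : ∀ κ, E κ * f κ = E (κ+1) := by
    intro κ
    calc E κ * f κ = pp A ξ (κ+1) * s (κ+1) := by
          simp only [f, pp, hEH, Matrix.mul_assoc]
      _ = _ := by rw [hEH, Matrix.mul_assoc, hs, Matrix.mul_one]
  have hEg : ∀ κ, E (κ+1) * g κ = (A - ξ κ • 1) * E κ := by
    intro κ
    simp only [g]
    rw [← Matrix.mul_assoc, ← hEH, pp, pp_comm, hEH, Matrix.mul_assoc, Matrix.mul_assoc, hs,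
      Matrix.mul_one]
  have hgH : ∀ κ, g κ * H κ = H (κ+1) := by
    intro κ
    apply (hE (κ+1)).cancel
    rw [← Matrix.mul_assoc, hEg, Matrix.mul_assoc, ← hEH, ← hEH, pp, pp_comm]
  refine ⟨f, g, ⟨?_, ?_, ?_⟩, ?_⟩
  · intro κ
    obtain ⟨p, hp⟩ := hE (κ+1)
    exact ⟨p * E κ, by rw [Matrix.mul_assoc, hEf, hp]⟩
  · intro κ
    exact ⟨H κ * s (κ+1), by rw [← Matrix.mul_assoc, hgH, hs]⟩
  · intro κ
    apply (hE (κ+1)).cancel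
    rw [Matrix.mul_sub, ← Matrix.mul_assoc, hEf, hEg, ← Matrix.mul_assoc, hEg, Matrix.mul_assoc,
      hEf, ← Matrix.sub_mul, sub_sub_sub_cancel_left, ← sub_smul]
    simp
  · have := hEg 0
    rw [← hEf 0, hE0] at this
    simpa using this

end
end

noncomputable section
set_option linter.unusedSimpArgs false
set_option linter.unusedSectionVars false

/-- the indices in `I_irr` -/
abbrev Irr (S : Setup) := {i : Fin (S.p+1) // Iirr S i}

abbrev Mn (S : Setup) := Matrix (Fin S.n) (Fin S.n) ℂ

abbrev AR (S : Setup) := Rep S (alN S)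

/-- the `t`-th arrow map, extended by zero -/
def Ft {S : Setup} (M : AR S) (a b : V S) (t : ℕ) : Matrix (Fin (alN S b)) (Fin (alN S a)) ℂ :=
  if h : t < arr S a b then M.f a b ⟨t, h⟩ else 0

def Gt {S : Setup} (M : AR S) (a b : V S) (t : ℕ) : Matrix (Fin (alN S a)) (Fin (alN S b)) ℂ :=
  if h : t < arr S a b then M.g a b ⟨t, h⟩ else 0

section
variable {S : Setup} (M N : AR S)

theorem Ft_zero {a b : V S} {t : ℕ} (h : arr S a b ≤ t) : Ft M a b t = 0 := by
  rw [Ft, dif_neg (by omega)]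

theorem Gt_zero {a b : V S} {t : ℕ} (h : arr S a b ≤ t) : Gt M a b t = 0 := by
  rw [Gt, dif_neg (by omega)]

theorem Ft_val {a b : V S} (ρ : Fin (arr S a b)) : Ft M a b ρ = M.f a b ρ := by
  rw [Ft, dif_pos ρ.2]

theorem Gt_val {a b : V S} (ρ : Fin (arr S a b)) : Gt M a b ρ = M.g a b ρ := by
  rw [Gt, dif_pos ρ.2]

theorem sumFG {a b : V S} {K : ℕ} (h : arr S a b ≤ K) :
    (∑ ρ : Fin (arr S a b), M.f a b ρ * M.g a b ρ) =
      ∑ t ∈ Finset.range K, Ft M a b t * Gt M a b t := by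
  rw [← Finset.sum_subset (Finset.range_subset_range.2 h), Finset.sum_range]
  · exact Finset.sum_congr rfl fun ρ _ => by rw [Ft_val, Gt_val]
  · intro t _ ht
    rw [Ft_zero _ (by simpa using ht), Matrix.zero_mul]

theorem sumGF {a b : V S} {K : ℕ} (h : arr S a b ≤ K) :
    (∑ ρ : Fin (arr S a b), M.g a b ρ * M.f a b ρ) =
      ∑ t ∈ Finset.range K, Gt M a b t * Ft M a b t := by
  rw [← Finset.sum_subset (Finset.range_subset_range.2 h), Finset.sum_range]
  · exact Finset.sum_congr rfl fun ρ _ => by rw [Ft_val, Gt_val]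
  · intro t _ ht
    rw [Ft_zero _ (by simpa using ht), Matrix.mul_zero]

variable {M N}

/-- conjugation with explicit inverses -/
theorem repConj_of (γ γi : ∀ a : V S, Matrix (Fin (alN S a)) (Fin (alN S a)) ℂ)
    (h1 : ∀ a, γ a * γi a = 1) (h2 : ∀ a, γi a * γ a = 1)
    (hf : ∀ a b t, t < arr S a b → Ft N a b t * γ a = γ b * Ft M a b t)
    (hg : ∀ a b t, t < arr S a b → Gt N a b t * γ b = γ a * Gt M a b t) : repConj S M N := by
  refine ⟨fun a => ⟨γ a, γi a, h1 a, h2 a⟩, ?_, ?_⟩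
  · intro a b ρ
    have := hf a b ρ ρ.2
    rw [Ft_val, Ft_val] at this
    show N.f a b ρ = γ b * M.f a b ρ * γi a
    rw [← this, Matrix.mul_assoc, h1, Matrix.mul_one]
  · intro a b ρ
    have := hg a b ρ ρ.2
    rw [Gt_val, Gt_val] at this
    show N.g a b ρ = γ a * M.g a b ρ * γi b
    rw [← this, Matrix.mul_assoc, h1, Matrix.mul_one]

theorem repConj_dest (h : repConj S M N) :
    ∃ (γ γi : ∀ a : V S, Matrix (Fin (alN S a)) (Fin (alN S a)) ℂ),
      (∀ a, γ a * γi a = 1) ∧ (∀ a, γi a * γ a = 1) ∧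
      (∀ a b t, Ft N a b t * γ a = γ b * Ft M a b t) ∧
      (∀ a b t, Gt N a b t * γ b = γ a * Gt M a b t) := by
  obtain ⟨g, hf, hg⟩ := h
  refine ⟨fun a => (g a).val, fun a => (g a)⁻¹.val, fun a => Units.mul_inv _,
    fun a => Units.inv_mul _, ?_, ?_⟩
  · intro a b t
    by_cases ht : t < arr S a b
    · rw [Ft, dif_pos ht, Ft, dif_pos ht, hf, Matrix.mul_assoc, Units.inv_mul, Matrix.mul_one]
    · rw [Ft_zero _ (by omega), Ft_zero _ (by omega), Matrix.zero_mul, Matrix.mul_zero]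
  · intro a b t
    by_cases ht : t < arr S a b
    · rw [Gt, dif_pos ht, Gt, dif_pos ht, hg, Matrix.mul_assoc, Units.inv_mul, Matrix.mul_one]
    · rw [Gt_zero _ (by omega), Gt_zero _ (by omega), Matrix.zero_mul, Matrix.mul_zero]

/-! blocks -/

/-- the `(j, j')` block of a matrix, with respect to decompositions `i` and `i'` -/
def sub (S : Setup) (i i' : Fin (S.p+1)) (Z : Mn S) (j : Fin (S.m i)) (j' : Fin (S.m i')) :
    Matrix (Fin (S.nn i j)) (Fin (S.nn i' j')) ℂ :=
  Z.submatrix (fun x => S.emb i ⟨j, x⟩) (fun y => S.emb i' ⟨j', y⟩)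

theorem sub_ext {i i' : Fin (S.p+1)} {Z W : Mn S} (h : ∀ j j', sub S i i' Z j j' = sub S i i' W j j') :
    Z = W := by
  ext a b
  obtain ⟨⟨j, x⟩, rfl⟩ := (S.emb i).surjective a
  obtain ⟨⟨j', y⟩, rfl⟩ := (S.emb i').surjective b
  exact congrFun (congrFun (h j j') x) y

theorem sub_mul (i i' i'' : Fin (S.p+1)) (Z W : Mn S) (j j'') :
    sub S i i'' (Z * W) j j'' = ∑ j', sub S i i' Z j j' * sub S i' i'' W j' j'' := by
  ext x y
  simp only [sub, Matrix.submatrix_apply, Matrix.mul_apply, Matrix.sum_apply]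
  rw [← (S.emb i').sum_comp, Fintype.sum_sigma]

@[simp] theorem sub_add (i i' : Fin (S.p+1)) (Z W : Mn S) (j j') :
    sub S i i' (Z + W) j j' = sub S i i' Z j j' + sub S i i' W j j' := rfl
@[simp] theorem sub_sub' (i i' : Fin (S.p+1)) (Z W : Mn S) (j j') :
    sub S i i' (Z - W) j j' = sub S i i' Z j j' - sub S i i' W j j' := rfl
@[simp] theorem sub_neg (i i' : Fin (S.p+1)) (Z : Mn S) (j j') :
    sub S i i' (-Z) j j' = - sub S i i' Z j j' := rfl
@[simp] theorem sub_smul' (i i' : Fin (S.p+1)) (c : ℂ) (Z : Mn S) (j j') :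
    sub S i i' (c • Z) j j' = c • sub S i i' Z j j' := rfl
theorem sub_sum (i i' : Fin (S.p+1)) {τ : Type} (s : Finset τ) (Z : τ → Mn S) (j j') :
    sub S i i' (∑ t ∈ s, Z t) j j' = ∑ t ∈ s, sub S i i' (Z t) j j' := by
  ext x y; simp [sub, Matrix.sum_apply]

theorem sub_one_same (i : Fin (S.p+1)) (j) : sub S i i 1 j j = 1 := by
  ext x y; simp [sub, Matrix.one_apply, Sigma.ext_iff]

theorem sub_one_diff (i : Fin (S.p+1)) {j j'} (h : j ≠ j') : sub S i i 1 j j' = 0 := by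
  ext x y; simp [sub, Matrix.one_apply, Sigma.ext_iff, h]

/-- irregular part attached to an index -/
def qn (S : Setup) (i : Fin (S.p+1)) (a : Fin S.n) : ℂ[X] := S.q i ((S.emb i).symm a).1

@[simp] theorem qn_emb (i : Fin (S.p+1)) (j x) : qn S i (S.emb i ⟨j, x⟩) = S.q i j := by
  simp [qn]

theorem q_inj (i : Fin (S.p+1)) {j j'} : S.q i j = S.q i j' ↔ j = j' :=
  ⟨fun h => by by_contra hh; exact S.hqdist i j j' hh h, fun h => by rw [h]⟩

/-- block diagonal matrix -/
def bd (S : Setup) (i : Fin (S.p+1)) (Z : ∀ j, Matrix (Fin (S.nn i j)) (Fin (S.nn i j)) ℂ) : Mn S :=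
  (Matrix.blockDiagonal' Z).submatrix (S.emb i).symm (S.emb i).symm

@[simp] theorem sub_bd_same (i : Fin (S.p+1)) (Z) (j) : sub S i i (bd S i Z) j j = Z j := by
  ext x y; simp [sub, bd]

theorem sub_bd_diff (i : Fin (S.p+1)) (Z) {j j'} (h : j ≠ j') : sub S i i (bd S i Z) j j' = 0 := by
  ext x y; simp [sub, bd, Matrix.blockDiagonal'_apply_ne _ _ _ h]

theorem blk_iff (i : Fin (S.p+1)) (h : Mn S) :
    blk (qn S i) h ↔ ∀ j j', j ≠ j' → sub S i i h j j' = 0 := by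
  constructor
  · intro hb j j' hj
    ext x y
    exact hb _ _ (by simp [q_inj, hj])
  · intro hb a b hab
    obtain ⟨⟨j, x⟩, rfl⟩ := (S.emb i).surjective a
    obtain ⟨⟨j', y⟩, rfl⟩ := (S.emb i).surjective b
    simp only [qn_emb, ne_eq, q_inj] at hab
    exact congrFun (congrFun (hb j j' hab) x) y

theorem blk_bd (i : Fin (S.p+1)) (Z) : blk (qn S i) (bd S i Z) :=
  (blk_iff i _).2 fun _ _ h => sub_bd_diff i Z h

theorem sub_mul_blk {i i' : Fin (S.p+1)} {h : Mn S} (hb : blk (qn S i') h) (Z : Mn S) (j j') :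
    sub S i i' (Z * h) j j' = sub S i i' Z j j' * sub S i' i' h j' j' := by
  rw [sub_mul i i' i', Finset.sum_eq_single j']
  · intro b _ hb'
    rw [(blk_iff i' h).1 hb b j' hb', Matrix.mul_zero]
  · simp

theorem sub_blk_mul {i i' : Fin (S.p+1)} {h : Mn S} (hb : blk (qn S i) h) (Z : Mn S) (j j') :
    sub S i i' (h * Z) j j' = sub S i i h j j * sub S i i' Z j j' := by
  rw [sub_mul i i i', Finset.sum_eq_single j]
  · intro b _ hb'
    rw [(blk_iff i h).1 hb j b hb'.symm, Matrix.zero_mul]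
  · simp

theorem bd_mul_one {i : Fin (S.p+1)} {Z W : ∀ j, Matrix (Fin (S.nn i j)) (Fin (S.nn i j)) ℂ}
    (h : ∀ j, Z j * W j = 1) : bd S i Z * bd S i W = 1 := by
  apply sub_ext (i := i) (i' := i)
  intro j j'
  rw [sub_mul_blk (blk_bd i W), sub_bd_same]
  by_cases hj : j = j'
  · subst hj; rw [sub_bd_same, h, sub_one_same]
  · rw [sub_bd_diff i Z hj, sub_one_diff i hj, Matrix.zero_mul]

/-- rows of block `j` of a rectangular matrix -/
def rsub (S : Setup) (i : Fin (S.p+1)) {r : ℕ} (Z : Matrix (Fin S.n) (Fin r) ℂ) (j : Fin (S.m i)) :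
    Matrix (Fin (S.nn i j)) (Fin r) ℂ := Z.submatrix (fun x => S.emb i ⟨j, x⟩) id

def csub (S : Setup) (i : Fin (S.p+1)) {r : ℕ} (Z : Matrix (Fin r) (Fin S.n) ℂ) (j : Fin (S.m i)) :
    Matrix (Fin r) (Fin (S.nn i j)) ℂ := Z.submatrix id (fun x => S.emb i ⟨j, x⟩)

theorem rsub_ext {i : Fin (S.p+1)} {r : ℕ} {Z W : Matrix (Fin S.n) (Fin r) ℂ}
    (h : ∀ j, rsub S i Z j = rsub S i W j) : Z = W := by
  ext a b
  obtain ⟨⟨j, x⟩, rfl⟩ := (S.emb i).surjective a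
  exact congrFun (congrFun (h j) x) b

theorem csub_ext {i : Fin (S.p+1)} {r : ℕ} {Z W : Matrix (Fin r) (Fin S.n) ℂ}
    (h : ∀ j, csub S i Z j = csub S i W j) : Z = W := by
  ext a b
  obtain ⟨⟨j, x⟩, rfl⟩ := (S.emb i).surjective b
  exact congrFun (congrFun (h j) a) x

theorem rsub_mul {i : Fin (S.p+1)} {r s : ℕ} (Z : Matrix (Fin S.n) (Fin r) ℂ)
    (W : Matrix (Fin r) (Fin s) ℂ) (j) : rsub S i (Z * W) j = rsub S i Z j * W := rfl

theorem csub_mul {i : Fin (S.p+1)} {r s : ℕ} (Z : Matrix (Fin r) (Fin S.n) ℂ)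
    (W : Matrix (Fin s) (Fin r) ℂ) (j) : csub S i (W * Z) j = W * csub S i Z j := rfl

theorem sub_rc {i i' : Fin (S.p+1)} {r : ℕ} (Z : Matrix (Fin S.n) (Fin r) ℂ)
    (W : Matrix (Fin r) (Fin S.n) ℂ) (j j') : sub S i i' (Z * W) j j' = rsub S i Z j * csub S i' W j' :=
  rfl

theorem cr_sum (i : Fin (S.p+1)) {r s : ℕ} (Z : Matrix (Fin S.n) (Fin r) ℂ)
    (W : Matrix (Fin s) (Fin S.n) ℂ) : W * Z = ∑ j, csub S i W j * rsub S i Z j := by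
  ext x y
  simp only [csub, rsub, Matrix.submatrix_apply, Matrix.mul_apply, Matrix.sum_apply, id]
  rw [← (S.emb i).sum_comp, Fintype.sum_sigma]

theorem rsub_blk_mul {i : Fin (S.p+1)} {r : ℕ} {h : Mn S} (hb : blk (qn S i) h)
    (Z : Matrix (Fin S.n) (Fin r) ℂ) (j) : rsub S i (h * Z) j = sub S i i h j j * rsub S i Z j := by
  ext x y
  simp only [rsub, sub, Matrix.submatrix_apply, Matrix.mul_apply, id]
  rw [← (S.emb i).sum_comp, Fintype.sum_sigma, Finset.sum_eq_single j]
  · intro b _ hbj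
    refine Finset.sum_eq_zero fun z _ => ?_
    rw [hb _ _ (by simp [q_inj, hbj.symm]), zero_mul]
  · simp

theorem csub_mul_blk {i : Fin (S.p+1)} {r : ℕ} {h : Mn S} (hb : blk (qn S i) h)
    (Z : Matrix (Fin r) (Fin S.n) ℂ) (j) : csub S i (Z * h) j = csub S i Z j * sub S i i h j j := by
  ext x y
  simp only [csub, sub, Matrix.submatrix_apply, Matrix.mul_apply, id]
  rw [← (S.emb i).sum_comp, Fintype.sum_sigma, Finset.sum_eq_single j]
  · intro b _ hbj
    refine Finset.sum_eq_zero fun z _ => ?_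
    rw [hb _ _ (by simp [q_inj, hbj]), mul_zero]
  · simp

end
end

noncomputable section
set_option linter.unusedSimpArgs false
set_option linter.unusedSectionVars false

section
variable {S : Setup}

theorem dcnt_le (i : Fin (S.p+1)) (j j') : dcnt S i j j' ≤ S.kk i := by
  have h1 : (S.q i j - S.q i j').natDegree ≤ S.kk i :=
    (Polynomial.natDegree_sub_le _ _).trans (max_le (S.hqdeg i j) (S.hqdeg i j'))
  rw [dcnt]; omega

theorem arr_II (i : Irr S) (j j' : Fin (S.m i.1)) :
    arr S (vI S i j) (vI S i j') = if j < j' then dcnt S i.1 j j' else 0 := by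
  simp only [arr, vI, Fin.cast_refl, id]
  have h : ¬ (i.1 = 0 ∧ i.1 ≠ 0) := by tauto
  simp [h]

theorem arr_0I (i : Irr S) (hi : i.1 ≠ 0) (j) (j' : Fin (S.m i.1)) :
    arr S (v0 S j) (vI S i j') = 1 := by
  have h : i0 S ≠ i := by
    intro h; apply hi; rw [← h]
  simp only [arr, vI, v0]
  rw [dif_neg h]
  simp [i0, hi]

theorem arr_ne (i i' : Irr S) (hne : i ≠ i') (h : ¬ (i.1 = 0 ∧ i'.1 ≠ 0)) (j) (j') :
    arr S (vI S i j) (vI S i' j') = 0 := by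
  simp only [arr, vI]
  rw [dif_neg hne, if_neg h]

theorem arr_lr (a : Vb S) (b : Vr S) : arr S (Sum.inl a) (Sum.inr b) = 0 := rfl

theorem arr_rI (i : Irr S) (j) (κ) : arr S (Sum.inr ⟨i.1, j, κ⟩) (vI S i j) = if κ.val = 0 then 1 else 0 := by
  simp [arr, vI, i.2]

theorem arr_r0 (i : Fin (S.p+1)) (hi : ¬ Iirr S i) (j κ j') :
    arr S (Sum.inr ⟨i, j, κ⟩) (v0 S j') = if κ.val = 0 then 1 else 0 := by
  have h1 : i ≠ 0 := fun h => hi (Or.inr h)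
  have h2 : ¬ 1 < S.m i := fun h => hi (Or.inl h)
  have h3 : j.val = 0 := by have := j.2; omega
  simp [arr, v0, i0, h1, h3, hi]

theorem arr_rl_zero (i : Fin (S.p+1)) (j : Fin (S.m i)) (κ : Fin (S.e i j - 1)) (i' : Irr S)
    (j' : Fin (S.m i'.1))
    (h1 : ¬ (i = i'.1 ∧ (j : ℕ) = (j' : ℕ) ∧ (κ : ℕ) = 0)) (h2 : ¬ (¬ Iirr S i ∧ i'.1 = 0 ∧ (κ : ℕ) = 0)) :
    arr S (Sum.inr ⟨i, j, κ⟩) (vI S i' j') = 0 := by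
  simp only [arr, vI]
  rw [if_neg h1, if_neg (by tauto)]

theorem arr_rr (i : Fin (S.p+1)) (j κ κ') :
    arr S (Sum.inr ⟨i, j, κ⟩) (Sum.inr ⟨i, j, κ'⟩) = if (κ : ℕ) = κ' + 1 then 1 else 0 := by
  simp [arr]

theorem arr_rr_zero (i i' : Fin (S.p+1)) (j : Fin (S.m i)) (j' : Fin (S.m i'))
    (κ : Fin (S.e i j - 1)) (κ' : Fin (S.e i' j' - 1))
    (h : ¬ (i = i' ∧ (j : ℕ) = (j' : ℕ) ∧ (κ : ℕ) = κ' + 1)) :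
    arr S (Sum.inr ⟨i, j, κ⟩) (Sum.inr ⟨i', j', κ'⟩) = 0 := by
  simp only [arr]
  rw [if_neg h]

/-- ranks -/
abbrev rk (S : Setup) (i : Fin (S.p+1)) (j : Fin (S.m i)) (κ : ℕ) : ℕ :=
  ((((List.finRange (S.e i j)).take (κ + 1)).map fun l => S.R i j - S.xi i j l • 1).prod).rank

theorem alN_r (i : Fin (S.p+1)) (j κ) : alN S (Sum.inr ⟨i, j, κ⟩) = rk S i j κ.val := rfl
theorem alN_l (i : Irr S) (j) : alN S (vI S i j) = S.nn i.1 j := rfl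

/-- extended eigenvalues -/
def xe (S : Setup) (i : Fin (S.p+1)) (j : Fin (S.m i)) (κ : ℕ) : ℂ :=
  if h : κ < S.e i j then S.xi i j ⟨κ, h⟩ else 0

theorem rk_zero (i : Fin (S.p+1)) (j) {κ : ℕ} (h : S.e i j - 1 ≤ κ) : rk S i j κ = 0 := by
  rw [rk, List.take_of_length_le (by simp; omega), S.hxi]; simp

theorem rk_pp (i : Fin (S.p+1)) (j) (κ : ℕ) : rk S i j κ = (pp (S.R i j) (xe S i j) (κ+1)).rank := by
  have key : ∀ κ, κ ≤ S.e i j → (((List.finRange (S.e i j)).take κ).map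
      fun l => S.R i j - S.xi i j l • 1).prod = pp (S.R i j) (xe S i j) κ := by
    intro κ
    induction κ with
    | zero => intro _; simp [pp]
    | succ κ ih =>
      intro hκ
      rw [List.take_succ_eq_append_getElem (by simp; omega), List.map_append, List.prod_append, ih (by omega), pp]
      simp [xe, dif_pos (show κ < S.e i j by omega)]
  by_cases h : κ + 1 ≤ S.e i j
  · rw [rk, key _ h]
  · have hz : pp (S.R i j) (xe S i j) (S.e i j) = 0 := by
      rw [← key _ le_rfl, List.take_of_length_le (by simp), S.hxi]
    have : ∀ d, pp (S.R i j) (xe S i j) (S.e i j + d) = 0 := by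
      intro d
      induction d with
      | zero => exact hz
      | succ d ih => rw [← add_assoc, pp, ih, Matrix.zero_mul]
    rw [rk_zero _ _ (by omega), show κ + 1 = S.e i j + (κ + 1 - S.e i j) by omega, this]; simp

/-! accessors -/

/-- index set of a decomposition -/
abbrev Ix (S : Setup) (i : Fin (S.p+1)) := Σ j : Fin (S.m i), Fin (S.nn i j)

def XS (M : AR S) (i : Irr S) (t : ℕ) (a b : Ix S i.1) : ℂ :=
  if b.1 < a.1 then Ft M (vI S i b.1) (vI S i a.1) t a.2 b.2
  else if a.1 < b.1 then Gt M (vI S i a.1) (vI S i b.1) t a.2 b.2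
  else 0

def XM (M : AR S) (i : Irr S) (t : ℕ) : Mn S := Matrix.of fun a b =>
  XS M i t ((S.emb i.1).symm a) ((S.emb i.1).symm b)

theorem XM_lt (M : AR S) (i : Irr S) (t : ℕ) {j j'} (h : j < j') :
    sub S i.1 i.1 (XM M i t) j' j = Ft M (vI S i j) (vI S i j') t := by
  ext x y
  simp only [sub, XM, Matrix.submatrix_apply, Matrix.of_apply, Equiv.symm_apply_apply]
  rw [XS, if_pos h]

theorem XM_gt (M : AR S) (i : Irr S) (t : ℕ) {j j'} (h : j < j') :
    sub S i.1 i.1 (XM M i t) j j' = Gt M (vI S i j) (vI S i j') t := by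
  ext x y
  simp only [sub, XM, Matrix.submatrix_apply, Matrix.of_apply, Equiv.symm_apply_apply]
  rw [XS, if_neg h.asymm, if_pos h]

theorem XM_eq (M : AR S) (i : Irr S) (t : ℕ) (j) :
    sub S i.1 i.1 (XM M i t) j j = 0 := by
  ext x y
  simp only [sub, XM, Matrix.submatrix_apply, Matrix.of_apply, Equiv.symm_apply_apply]
  simp [XS]

def CS (M : AR S) (i : Irr S) (a : Ix S i.1) (b : Ix S 0) : ℂ :=
  Ft M (v0 S b.1) (vI S i a.1) 0 a.2 b.2

def CsS (M : AR S) (i : Irr S) (a : Ix S 0) (b : Ix S i.1) : ℂ :=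
  Gt M (v0 S a.1) (vI S i b.1) 0 a.2 b.2

def CM (M : AR S) (i : Irr S) : Mn S := Matrix.of fun a b =>
  CS M i ((S.emb i.1).symm a) ((S.emb 0).symm b)

def CsM (M : AR S) (i : Irr S) : Mn S := Matrix.of fun a b =>
  CsS M i ((S.emb 0).symm a) ((S.emb i.1).symm b)

theorem sub_CM (M : AR S) (i : Irr S) (j j') :
    sub S i.1 0 (CM M i) j j' = Ft M (v0 S j') (vI S i j) 0 := by
  ext x y
  simp only [sub, CM, Matrix.submatrix_apply, Matrix.of_apply, Equiv.symm_apply_apply]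
  rfl

theorem sub_CsM (M : AR S) (i : Irr S) (j j') :
    sub S 0 i.1 (CsM M i) j j' = Gt M (v0 S j) (vI S i j') 0 := by
  ext x y
  simp only [sub, CsM, Matrix.submatrix_apply, Matrix.of_apply, Equiv.symm_apply_apply]
  rfl

def bFM (M : AR S) (i : Irr S) (j : Fin (S.m i.1)) : Matrix (Fin (S.nn i.1 j)) (Fin (rk S i.1 j 0)) ℂ :=
  if h : 0 < S.e i.1 j - 1 then Ft M (Sum.inr ⟨i.1, j, ⟨0, h⟩⟩) (vI S i j) 0 else 0

def bGM (M : AR S) (i : Irr S) (j : Fin (S.m i.1)) : Matrix (Fin (rk S i.1 j 0)) (Fin (S.nn i.1 j)) ℂ :=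
  if h : 0 < S.e i.1 j - 1 then Gt M (Sum.inr ⟨i.1, j, ⟨0, h⟩⟩) (vI S i j) 0 else 0

def rFS (M : AR S) (i : Fin (S.p+1)) (j : Fin (S.m i)) (h : 0 < S.e i j - 1) (a : Ix S 0)
    (y : Fin (rk S i j 0)) : ℂ := Ft M (Sum.inr ⟨i, j, ⟨0, h⟩⟩) (v0 S a.1) 0 a.2 y

def rGS (M : AR S) (i : Fin (S.p+1)) (j : Fin (S.m i)) (h : 0 < S.e i j - 1) (a : Ix S 0)
    (y : Fin (rk S i j 0)) : ℂ := Gt M (Sum.inr ⟨i, j, ⟨0, h⟩⟩) (v0 S a.1) 0 y a.2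

def rFM (M : AR S) (i : Fin (S.p+1)) (j : Fin (S.m i)) : Matrix (Fin S.n) (Fin (rk S i j 0)) ℂ :=
  if h : 0 < S.e i j - 1 then Matrix.of fun a y =>
    rFS M i j h ((S.emb 0).symm a) y else 0

def rGM (M : AR S) (i : Fin (S.p+1)) (j : Fin (S.m i)) : Matrix (Fin (rk S i j 0)) (Fin S.n) ℂ :=
  if h : 0 < S.e i j - 1 then Matrix.of fun y a =>
    rGS M i j h ((S.emb 0).symm a) y else 0

def lFM (M : AR S) (i : Fin (S.p+1)) (j : Fin (S.m i)) (κ : ℕ) :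
    Matrix (Fin (rk S i j κ)) (Fin (rk S i j (κ+1))) ℂ :=
  if h : κ + 1 < S.e i j - 1 then
    Ft M (Sum.inr ⟨i, j, ⟨κ+1, h⟩⟩) (Sum.inr ⟨i, j, ⟨κ, by omega⟩⟩) 0 else 0

def lGM (M : AR S) (i : Fin (S.p+1)) (j : Fin (S.m i)) (κ : ℕ) :
    Matrix (Fin (rk S i j (κ+1))) (Fin (rk S i j κ)) ℂ :=
  if h : κ + 1 < S.e i j - 1 then
    Gt M (Sum.inr ⟨i, j, ⟨κ+1, h⟩⟩) (Sum.inr ⟨i, j, ⟨κ, by omega⟩⟩) 0 else 0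

theorem rsub_rFM (M : AR S) (i : Fin (S.p+1)) (j) (h : 0 < S.e i j - 1) (j') :
    rsub S 0 (rFM M i j) j' = Ft M (Sum.inr ⟨i, j, ⟨0, h⟩⟩) (v0 S j') 0 := by
  ext x y
  rw [rFM, dif_pos h]
  simp only [rsub, Matrix.submatrix_apply, Matrix.of_apply, Equiv.symm_apply_apply, id]
  rfl

theorem csub_rGM (M : AR S) (i : Fin (S.p+1)) (j) (h : 0 < S.e i j - 1) (j') :
    csub S 0 (rGM M i j) j' = Gt M (Sum.inr ⟨i, j, ⟨0, h⟩⟩) (v0 S j') 0 := by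
  ext x y
  rw [rGM, dif_pos h]
  simp only [csub, Matrix.submatrix_apply, Matrix.of_apply, Equiv.symm_apply_apply, id]
  rfl

/-- leg dimensions -/
@[reducible] def ld (b : ℕ) (r : ℕ → ℕ) : ℕ → ℕ
  | 0 => b
  | κ+1 => r κ

def lfam {b : ℕ} {r : ℕ → ℕ} (f0 : Matrix (Fin b) (Fin (r 0)) ℂ)
    (fs : ∀ κ, Matrix (Fin (r κ)) (Fin (r (κ+1))) ℂ) :
    ∀ κ, Matrix (Fin (ld b r κ)) (Fin (ld b r (κ+1))) ℂ
  | 0 => f0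
  | κ+1 => fs κ

def gfam {b : ℕ} {r : ℕ → ℕ} (f0 : Matrix (Fin (r 0)) (Fin b) ℂ)
    (fs : ∀ κ, Matrix (Fin (r (κ+1))) (Fin (r κ)) ℂ) :
    ∀ κ, Matrix (Fin (ld b r (κ+1))) (Fin (ld b r κ)) ℂ
  | 0 => f0
  | κ+1 => fs κ

/-- signs -/
def ep (S : Setup) (i : Fin (S.p+1)) (a c : Fin S.n) : ℂ :=
  if ((S.emb i).symm c).1 < ((S.emb i).symm a).1 then 1
  else if ((S.emb i).symm a).1 < ((S.emb i).symm c).1 then -1 else 0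

end
end

noncomputable section
set_option linter.unusedSimpArgs false
set_option linter.unusedSectionVars false

section
variable {S : Setup}

def Pin (M : AR S) (a c : V S) : Matrix (Fin (alN S c)) (Fin (alN S c)) ℂ :=
  ∑ ρ : Fin (arr S a c), M.f a c ρ * M.g a c ρ

def Pout (M : AR S) (c b : V S) : Matrix (Fin (alN S c)) (Fin (alN S c)) ℂ :=
  ∑ ρ : Fin (arr S c b), M.g c b ρ * M.f c b ρ

theorem Pin_zero (M : AR S) {a c : V S} (h : arr S a c = 0) : Pin M a c = 0 := by
  rw [Pin, sumFG M h.le]; simp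

theorem Pout_zero (M : AR S) {a c : V S} (h : arr S a c = 0) : Pout M a c = 0 := by
  rw [Pout, sumGF M h.le]; simp

theorem Pin_one (M : AR S) {a c : V S} (h : arr S a c ≤ 1) : Pin M a c = Ft M a c 0 * Gt M a c 0 := by
  rw [Pin, sumFG M h]; simp

theorem Pout_one (M : AR S) {a c : V S} (h : arr S a c ≤ 1) : Pout M a c = Gt M a c 0 * Ft M a c 0 := by
  rw [Pout, sumGF M h]; simp

theorem moment_eq (M : AR S) (c : V S) : moment S M c = (∑ a, Pin M a c) - ∑ b, Pout M c b := rfl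

theorem sub_mom (M : AR S) (i : Irr S) (j) :
    sub S i.1 i.1 (mom (S.kk i.1) (ep S i.1) (XM M i)) j j =
      (∑ j', Pin M (vI S i j') (vI S i j)) - ∑ j', Pout M (vI S i j) (vI S i j') := by
  have h1 : mom (S.kk i.1) (ep S i.1) (XM M i) =
      ∑ t ∈ Finset.range (S.kk i.1), (Matrix.of fun a c => ep S i.1 a c * XM M i t a c) * XM M i t := by
    ext a b
    simp [mom, Matrix.sum_apply, Matrix.mul_apply]
  rw [h1, sub_sum]
  simp only [sub_mul i.1 i.1 i.1]
  rw [Finset.sum_comm, ← Finset.sum_sub_distrib]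
  refine Finset.sum_congr rfl fun j' _ => ?_
  rcases lt_trichotomy j j' with h | h | h
  · rw [Pin_zero M (by rw [arr_II, if_neg h.asymm]), zero_sub, Pout,
      sumGF M (K := S.kk i.1) (by rw [arr_II, if_pos h]; exact dcnt_le _ _ _), ← Finset.sum_neg_distrib]
    refine Finset.sum_congr rfl fun t _ => ?_
    have : sub S i.1 i.1 (Matrix.of fun a c => ep S i.1 a c * XM M i t a c) j j' =
        - sub S i.1 i.1 (XM M i t) j j' := by
      ext x y
      simp [sub, ep, h, h.asymm]
    rw [this, XM_lt M i t h, XM_gt M i t h, Matrix.neg_mul]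
  · subst h
    rw [Pin_zero M (by rw [arr_II, if_neg (lt_irrefl _)]), Pout_zero M (by rw [arr_II, if_neg (lt_irrefl _)]),
      sub_zero]
    refine Finset.sum_eq_zero fun t _ => ?_
    rw [XM_eq, Matrix.mul_zero]
  · rw [Pout_zero M (by rw [arr_II, if_neg h.asymm]), sub_zero, Pin,
      sumFG M (K := S.kk i.1) (by rw [arr_II, if_pos h]; exact dcnt_le _ _ _)]
    refine Finset.sum_congr rfl fun t _ => ?_
    have : sub S i.1 i.1 (Matrix.of fun a c => ep S i.1 a c * XM M i t a c) j j' =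
        sub S i.1 i.1 (XM M i t) j j' := by
      ext x y
      simp [sub, ep, h, h.asymm]
    rw [this, XM_lt M i t h, XM_gt M i t h]

theorem sum_fin_zero {N : ℕ} {A : Type} [AddCommMonoid A] (F : Fin N → A)
    (hF : ∀ κ, κ.val ≠ 0 → F κ = 0) : ∑ κ, F κ = if h : 0 < N then F ⟨0, h⟩ else 0 := by
  by_cases h : 0 < N
  · rw [dif_pos h, Finset.sum_eq_single ⟨0, h⟩]
    · intro b _ hb
      exact hF b fun h' => hb (Fin.ext h')
    · simp
  · rw [dif_neg h]
    exact Finset.sum_eq_zero fun κ _ => absurd κ.2 (by omega)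

/-- index of the only block of a regular point -/
def z0 (S : Setup) (i : Fin (S.p+1)) : Fin (S.m i) := ⟨0, S.hm i⟩

theorem eq_z0 {i : Fin (S.p+1)} (hi : ¬ Iirr S i) (j : Fin (S.m i)) : j = z0 S i := by
  have h2 : ¬ 1 < S.m i := fun h => hi (Or.inl h)
  apply Fin.ext
  have := j.2
  show j.val = 0
  omega

/-- contribution of the leg vertices at a vertex `[i,j]` -/
theorem leg_in_irr (M : AR S) (i : Irr S) (j) :
    (∑ j' : Fin (S.m i.1), ∑ κ, Pin M (Sum.inr ⟨i.1, j', κ⟩) (vI S i j)) = bFM M i j * bGM M i j := by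
  rw [Finset.sum_eq_single j]
  · rw [sum_fin_zero]
    · by_cases h : 0 < S.e i.1 j - 1
      · rw [dif_pos h, bFM, dif_pos h, bGM, dif_pos h]
        exact Pin_one M (by rw [arr_rI]; simp)
      · rw [dif_neg h, bFM, dif_neg h, Matrix.zero_mul]
    · intro κ hκ
      exact Pin_zero M (by rw [arr_rI, if_neg hκ])
  · intro j' _ hj'
    refine Finset.sum_eq_zero fun κ _ => ?_
    refine Pin_zero M (arr_rl_zero _ _ _ _ _ ?_ ?_)
    · rintro ⟨-, h, -⟩; exact hj' (Fin.ext h)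
    · rintro ⟨h, -⟩; exact h i.2
  · simp

theorem leg_in_reg (M : AR S) (i : Fin (S.p+1)) (hi : ¬ Iirr S i) (j) :
    (∑ j' : Fin (S.m i), ∑ κ, Pin M (Sum.inr ⟨i, j', κ⟩) (v0 S j)) =
      sub S 0 0 (rFM M i (z0 S i) * rGM M i (z0 S i)) j j := by
  rw [Finset.sum_eq_single (z0 S i)]
  · rw [sum_fin_zero]
    · by_cases h : 0 < S.e i (z0 S i) - 1
      · rw [dif_pos h, sub_rc, rsub_rFM M i _ h, csub_rGM M i _ h]
        exact Pin_one M (by rw [arr_r0 _ hi]; simp)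
      · rw [dif_neg h, rFM, dif_neg h, Matrix.zero_mul]; rfl
    · intro κ hκ
      exact Pin_zero M (by rw [arr_r0 _ hi, if_neg hκ])
  · intro j' _ hj'
    exact absurd (eq_z0 hi j') hj'
  · simp

theorem leg_in_ne (M : AR S) (i : Irr S) (i' : Fin (S.p+1)) (h : i' ≠ i.1) (h2 : i.1 ≠ 0 ∨ Iirr S i') (j) :
    (∑ j' : Fin (S.m i'), ∑ κ, Pin M (Sum.inr ⟨i', j', κ⟩) (vI S i j)) = 0 := by
  refine Finset.sum_eq_zero fun j' _ => Finset.sum_eq_zero fun κ _ => ?_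
  refine Pin_zero M (arr_rl_zero _ _ _ _ _ ?_ ?_)
  · rintro ⟨h', -⟩; exact h h'
  · tauto

theorem out_r (M : AR S) (a : Vb S) : (∑ b : Vr S, Pout M (Sum.inl a) (Sum.inr b)) = 0 :=
  Finset.sum_eq_zero fun b _ => Pout_zero M (arr_lr a b)

theorem i0_ne {i : Irr S} (hi : i.1 ≠ 0) : i0 S ≠ i := by
  intro h; apply hi; rw [← h]

theorem moment_I (M : AR S) (i : Irr S) (hi : i.1 ≠ 0) (j) :
    moment S M (vI S i j) = sub S i.1 i.1 (mom (S.kk i.1) (ep S i.1) (XM M i)) j j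
      + sub S i.1 i.1 (CM M i * CsM M i) j j + bFM M i j * bGM M i j := by
  have hI : (∑ a : Vb S, Pin M (Sum.inl a) (vI S i j)) =
      (∑ j', Pin M (vI S i j') (vI S i j)) + sub S i.1 i.1 (CM M i * CsM M i) j j := by
    rw [Fintype.sum_sigma, ← Finset.add_sum_erase _ _ (Finset.mem_univ i)]
    congr 1
    rw [Finset.sum_eq_single (i0 S), sub_mul i.1 0 i.1]
    · refine Finset.sum_congr rfl fun j' _ => ?_
      rw [sub_CM, sub_CsM]
      exact Pin_one M (arr_0I i hi j' j).le
    · intro i' h1 h2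
      refine Finset.sum_eq_zero fun j' _ => Pin_zero M (arr_ne _ _ (by simpa using h1) ?_ _ _)
      rintro ⟨h, -⟩
      exact h2 (Subtype.ext h)
    · intro h
      exact absurd (Finset.mem_erase.2 ⟨i0_ne hi, Finset.mem_univ _⟩) h
  have hO : (∑ a : Vb S, Pout M (vI S i j) (Sum.inl a)) =
      (∑ j', Pout M (vI S i j) (vI S i j')) := by
    rw [Fintype.sum_sigma, Finset.sum_eq_single i]
    · intro i' _ h2
      refine Finset.sum_eq_zero fun j' _ => Pout_zero M (arr_ne _ _ h2.symm ?_ _ _)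
      tauto
    · simp
  have hR : (∑ a : Vr S, Pin M (Sum.inr a) (vI S i j)) = bFM M i j * bGM M i j := by
    rw [Fintype.sum_sigma, Finset.sum_eq_single i.1]
    · rw [Fintype.sum_sigma]; exact leg_in_irr M i j
    · intro i' _ h
      rw [Fintype.sum_sigma]; exact leg_in_ne M i i' h (Or.inl hi) j
    · simp
  rw [moment_eq, Fintype.sum_sum_type, Fintype.sum_sum_type, hI, hR, hO, out_r, sub_mom]
  simp only [vI]
  abel

theorem moment_0 (M : AR S) (j) :
    moment S M (v0 S j) = sub S 0 0 (mom (S.kk 0) (ep S 0) (XM M (i0 S))) j j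
      - (∑ i ∈ Finset.univ.filter (fun i : Irr S => i.1 ≠ 0), sub S 0 0 (CsM M i * CM M i) j j)
      + bFM M (i0 S) j * bGM M (i0 S) j
      + ∑ i ∈ Finset.univ.filter (fun i : Fin (S.p+1) => ¬ Iirr S i),
          sub S 0 0 (rFM M i (z0 S i) * rGM M i (z0 S i)) j j := by
  have hI : (∑ a : Vb S, Pin M (Sum.inl a) (v0 S j)) =
      (∑ j', Pin M (vI S (i0 S) j') (v0 S j)) := by
    rw [Fintype.sum_sigma, Finset.sum_eq_single (i0 S)]
    · intro i' _ h2
      refine Finset.sum_eq_zero fun j' _ => Pin_zero M (arr_ne _ _ h2 ?_ _ _)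
      rintro ⟨-, h⟩
      exact h rfl
    · simp
  have hO : (∑ a : Vb S, Pout M (v0 S j) (Sum.inl a)) =
      (∑ j', Pout M (v0 S j) (vI S (i0 S) j')) +
      ∑ i ∈ Finset.univ.filter (fun i : Irr S => i.1 ≠ 0), sub S 0 0 (CsM M i * CM M i) j j := by
    rw [Fintype.sum_sigma, ← Finset.add_sum_erase _ _ (Finset.mem_univ (i0 S))]
    congr 1
    have : Finset.univ.erase (i0 S) = Finset.univ.filter (fun i : Irr S => i.1 ≠ 0) := by
      ext i
      simp only [Finset.mem_erase, Finset.mem_univ, and_true, Finset.mem_filter, true_and, i0, ne_eq,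
        Subtype.ext_iff]
    rw [this]
    refine Finset.sum_congr rfl fun i hi => ?_
    rw [sub_mul 0 i.1 0]
    refine Finset.sum_congr rfl fun j' _ => ?_
    rw [sub_CM, sub_CsM]
    exact Pout_one M (arr_0I i (Finset.mem_filter.1 hi).2 j j').le
  have hR : (∑ a : Vr S, Pin M (Sum.inr a) (v0 S j)) = bFM M (i0 S) j * bGM M (i0 S) j +
      ∑ i ∈ Finset.univ.filter (fun i : Fin (S.p+1) => ¬ Iirr S i),
          sub S 0 0 (rFM M i (z0 S i) * rGM M i (z0 S i)) j j := by
    rw [Fintype.sum_sigma, ← Finset.add_sum_erase _ _ (Finset.mem_univ (0 : Fin (S.p+1)))]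
    congr 1
    · rw [Fintype.sum_sigma]; exact leg_in_irr M (i0 S) j
    · rw [← Finset.sum_subset (s₁ := Finset.univ.filter (fun i : Fin (S.p+1) => ¬ Iirr S i))]
      · refine Finset.sum_congr rfl fun i hi => ?_
        rw [Fintype.sum_sigma]
        exact leg_in_reg M i (Finset.mem_filter.1 hi).2 j
      · intro i hi
        refine Finset.mem_erase.2 ⟨?_, Finset.mem_univ _⟩
        rintro rfl
        exact (Finset.mem_filter.1 hi).2 (Or.inr rfl)
      · intro i hi h2
        rw [Fintype.sum_sigma]
        refine leg_in_ne M (i0 S) i ?_ (Or.inr (by simpa using h2)) j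
        exact (Finset.mem_erase.1 hi).1
  have hm := sub_mom M (i0 S) j
  have hm' : sub S 0 0 (mom (S.kk 0) (ep S 0) (XM M (i0 S))) j j =
      (∑ j', Pin M (vI S (i0 S) j') (v0 S j)) - ∑ j', Pout M (v0 S j) (vI S (i0 S) j') := hm
  rw [moment_eq, Fintype.sum_sum_type, Fintype.sum_sum_type, hI, hR, hO, hm']
  rw [out_r]
  simp only [alN]
  abel

/-- the irregular leg of a representation -/
abbrev iF (M : AR S) (i : Irr S) (j) := lfam (bFM M i j) (lFM M i.1 j)
abbrev iG (M : AR S) (i : Irr S) (j) := gfam (bGM M i j) (lGM M i.1 j)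
abbrev rF (M : AR S) (i : Fin (S.p+1)) (j) := lfam (rFM M i j) (lFM M i j)
abbrev rG (M : AR S) (i : Fin (S.p+1)) (j) := gfam (rGM M i j) (lGM M i j)

theorem moment_r_in (M : AR S) (i : Fin (S.p+1)) (j) (κ : Fin (S.e i j - 1)) :
    (∑ a, Pin M a (Sum.inr ⟨i, j, κ⟩)) = lFM M i j κ * lGM M i j κ := by
  rw [Fintype.sum_sum_type, Finset.sum_eq_zero (fun a _ => Pin_zero M (arr_lr _ _)), zero_add]
  by_cases h : κ.val + 1 < S.e i j - 1
  · rw [Finset.sum_eq_single ⟨i, j, ⟨κ.val + 1, h⟩⟩]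
    · rw [lFM, dif_pos h, lGM, dif_pos h]
      exact Pin_one M (by rw [arr_rr]; simp)
    · rintro ⟨i', j', κ'⟩ _ hne
      refine Pin_zero M (arr_rr_zero _ _ _ _ _ _ ?_)
      rintro ⟨rfl, h2, h3⟩
      obtain rfl := Fin.ext h2
      obtain rfl : κ' = ⟨κ.val + 1, h⟩ := Fin.ext h3
      exact hne rfl
    · simp
  · rw [lFM, dif_neg h, Matrix.zero_mul]
    refine Finset.sum_eq_zero ?_
    rintro ⟨i', j', κ'⟩ _
    refine Pin_zero M (arr_rr_zero _ _ _ _ _ _ ?_)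
    rintro ⟨rfl, h2, h3⟩
    obtain rfl := Fin.ext h2
    have := κ'.2
    omega

theorem out_rr (M : AR S) (i : Fin (S.p+1)) (j) (κ : ℕ) (h : κ + 1 < S.e i j - 1) :
    (∑ a, Pout M (Sum.inr ⟨i, j, ⟨κ+1, h⟩⟩) (Sum.inr a)) = lGM M i j κ * lFM M i j κ := by
  rw [Finset.sum_eq_single ⟨i, j, ⟨κ, by omega⟩⟩]
  · rw [lFM, dif_pos h, lGM, dif_pos h]
    exact Pout_one M (by rw [arr_rr]; simp)
  · rintro ⟨i', j', κ'⟩ _ hne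
    refine Pout_zero M (arr_rr_zero _ _ _ _ _ _ ?_)
    rintro ⟨rfl, h2, h3⟩
    obtain rfl := Fin.ext h2
    have h4 : κ' = ⟨κ, by omega⟩ := Fin.ext (by simpa using h3.symm)
    exact hne (by rw [h4])
  · simp

theorem out_rr0 (M : AR S) (i : Fin (S.p+1)) (j) (h : 0 < S.e i j - 1) :
    (∑ a, Pout M (Sum.inr ⟨i, j, ⟨0, h⟩⟩) (Sum.inr a)) = 0 := by
  refine Finset.sum_eq_zero ?_
  rintro ⟨i', j', κ'⟩ _
  refine Pout_zero M (arr_rr_zero _ _ _ _ _ _ ?_)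
  simp

theorem out_rl_succ (M : AR S) (i : Fin (S.p+1)) (j) (κ : ℕ) (h : κ + 1 < S.e i j - 1) :
    (∑ a, Pout M (Sum.inr ⟨i, j, ⟨κ+1, h⟩⟩) (Sum.inl a)) = 0 := by
  refine Finset.sum_eq_zero ?_
  rintro ⟨i', j'⟩ _
  exact Pout_zero M (arr_rl_zero _ _ _ _ _ (by simp) (by simp))

theorem moment_ri (M : AR S) (i : Irr S) (j) (κ : Fin (S.e i.1 j - 1)) :
    moment S M (Sum.inr ⟨i.1, j, κ⟩) = iF M i j (κ.val+1) * iG M i j (κ.val+1) -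
      iG M i j κ.val * iF M i j κ.val := by
  rw [moment_eq, moment_r_in]
  congr 1
  obtain ⟨κ, h⟩ := κ
  cases κ with
  | zero =>
    rw [Fintype.sum_sum_type, out_rr0, add_zero, Finset.sum_eq_single ⟨i, j⟩]
    · show _ = bGM M i j * bFM M i j
      rw [bFM, dif_pos h, bGM, dif_pos h]
      exact Pout_one M (by have := arr_rI i j ⟨0, h⟩; rw [vI] at this; rw [this]; simp)
    · rintro ⟨i', j'⟩ _ hne
      refine Pout_zero M (arr_rl_zero _ _ _ _ _ ?_ ?_)
      · rintro ⟨h1, h2, -⟩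
        obtain rfl := Subtype.ext h1
        obtain rfl := Fin.ext h2
        exact hne rfl
      · rintro ⟨h1, -⟩; exact h1 i.2
    · simp
  | succ κ =>
    rw [Fintype.sum_sum_type, out_rr, out_rl_succ, zero_add]; rfl

theorem moment_rr (M : AR S) (i : Fin (S.p+1)) (hi : ¬ Iirr S i) (j) (κ : Fin (S.e i j - 1)) :
    moment S M (Sum.inr ⟨i, j, κ⟩) = rF M i j (κ.val+1) * rG M i j (κ.val+1) -
      rG M i j κ.val * rF M i j κ.val := by
  rw [moment_eq, moment_r_in]
  congr 1
  obtain ⟨κ, h⟩ := κ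
  cases κ with
  | zero =>
    rw [Fintype.sum_sum_type, out_rr0, add_zero, Fintype.sum_sigma, Finset.sum_eq_single (i0 S)]
    · show _ = rGM M i j * rFM M i j
      rw [cr_sum 0]
      refine Finset.sum_congr rfl fun j' _ => ?_
      rw [rsub_rFM M i j h, csub_rGM M i j h]
      exact Pout_one M (by have := arr_r0 i hi j ⟨0, h⟩ j'; rw [v0] at this; rw [this]; simp)
    · intro i' _ hne
      refine Finset.sum_eq_zero fun j' _ => Pout_zero M (arr_rl_zero _ _ _ _ _ ?_ ?_)
      · rintro ⟨h1, -⟩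
        exact hi (h1 ▸ i'.2)
      · rintro ⟨-, h1, -⟩
        exact hne (Subtype.ext h1)
    · simp
  | succ κ =>
    rw [Fintype.sum_sum_type, out_rr, out_rl_succ, zero_add]; rfl

end
end

noncomputable section
set_option linter.unusedSimpArgs false
set_option linter.unusedSectionVars false

section
variable {S : Setup}

def ent {a b : ℕ} (M : Matrix (Fin a) (Fin b) ℂ) (x y : ℕ) : ℂ :=
  if h : x < a ∧ y < b then M ⟨x, h.1⟩ ⟨y, h.2⟩ else 0

theorem ent_val {a b : ℕ} (M : Matrix (Fin a) (Fin b) ℂ) (x : Fin a) (y : Fin b) :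
    ent M x.val y.val = M x y := by
  rw [ent, dif_pos ⟨x.2, y.2⟩]

/-- block data of a representation -/
structure Dat (S : Setup) where
  X : Irr S → ℕ → Mn S
  C : Irr S → Mn S
  Cs : Irr S → Mn S
  bF : ∀ (i : Irr S) (j : Fin (S.m i.1)), Matrix (Fin (S.nn i.1 j)) (Fin (rk S i.1 j 0)) ℂ
  bG : ∀ (i : Irr S) (j : Fin (S.m i.1)), Matrix (Fin (rk S i.1 j 0)) (Fin (S.nn i.1 j)) ℂ
  rF : ∀ (i : Fin (S.p+1)) (j : Fin (S.m i)), Matrix (Fin S.n) (Fin (rk S i j 0)) ℂ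
  rG : ∀ (i : Fin (S.p+1)) (j : Fin (S.m i)), Matrix (Fin (rk S i j 0)) (Fin S.n) ℂ
  lF : ∀ (i : Fin (S.p+1)) (j : Fin (S.m i)) (κ : ℕ), Matrix (Fin (rk S i j κ)) (Fin (rk S i j (κ+1))) ℂ
  lG : ∀ (i : Fin (S.p+1)) (j : Fin (S.m i)) (κ : ℕ), Matrix (Fin (rk S i j (κ+1))) (Fin (rk S i j κ)) ℂ

def F0 (D : Dat S) : ∀ (a b : V S) (_ : ℕ), Matrix (Fin (alN S b)) (Fin (alN S a)) ℂ
  | .inl ⟨i, j⟩, .inl ⟨i', j'⟩, t => Matrix.of fun x y =>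
      if i = i' then D.X i' t (S.emb i'.1 ⟨j', x⟩) (S.emb i.1 ⟨j, y⟩)
      else D.C i' (S.emb i'.1 ⟨j', x⟩) (S.emb i.1 ⟨j, y⟩)
  | .inl _, .inr _, _ => 0
  | .inr ⟨i, j, _⟩, .inl ⟨i', j'⟩, _ => Matrix.of fun x y =>
      if h : Iirr S i then ent (D.bF ⟨i, h⟩ j) x.val y.val
      else ent (D.rF i j) (S.emb i'.1 ⟨j', x⟩).val y.val
  | .inr _, .inr ⟨i', j', κ'⟩, _ => Matrix.of fun x y => ent (D.lF i' j' κ'.val) x.val y.val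

def G0 (D : Dat S) : ∀ (a b : V S) (_ : ℕ), Matrix (Fin (alN S a)) (Fin (alN S b)) ℂ
  | .inl ⟨i, j⟩, .inl ⟨i', j'⟩, t => Matrix.of fun y x =>
      if i = i' then D.X i' t (S.emb i.1 ⟨j, y⟩) (S.emb i'.1 ⟨j', x⟩)
      else D.Cs i' (S.emb i.1 ⟨j, y⟩) (S.emb i'.1 ⟨j', x⟩)
  | .inl _, .inr _, _ => 0
  | .inr ⟨i, j, _⟩, .inl ⟨i', j'⟩, _ => Matrix.of fun y x =>
      if h : Iirr S i then ent (D.bG ⟨i, h⟩ j) y.val x.val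
      else ent (D.rG i j) y.val (S.emb i'.1 ⟨j', x⟩).val
  | .inr _, .inr ⟨i', j', κ'⟩, _ => Matrix.of fun y x => ent (D.lG i' j' κ'.val) y.val x.val

def mkRep (D : Dat S) : AR S := ⟨fun a b ρ => F0 D a b ρ.val, fun a b ρ => G0 D a b ρ.val⟩

theorem Ft_mk (D : Dat S) {a b : V S} {t : ℕ} (h : t < arr S a b) : Ft (mkRep D) a b t = F0 D a b t := by
  rw [Ft, dif_pos h]; rfl

theorem Gt_mk (D : Dat S) {a b : V S} {t : ℕ} (h : t < arr S a b) : Gt (mkRep D) a b t = G0 D a b t := by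
  rw [Gt, dif_pos h]; rfl

theorem XM_mk (D : Dat S) (i : Irr S) (hs : suppOK (qn S i.1) (D.X i)) : XM (mkRep D) i = D.X i := by
  funext t
  refine sub_ext (i := i.1) (i' := i.1) fun j j' => ?_
  rcases lt_trichotomy j j' with h | h | h
  · rw [XM_gt _ _ _ h]
    by_cases ht : t < arr S (vI S i j) (vI S i j')
    · rw [Gt_mk _ ht]
      ext x y
      simp [G0, sub]
    · rw [Gt_zero _ (not_lt.1 ht)]
      ext x y
      rw [arr_II, if_pos h, dcnt] at ht
      symm
      apply hs
      rw [qn_emb, qn_emb]; omega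
  · subst h
    rw [XM_eq]
    ext x y
    symm
    apply hs
    rw [qn_emb, qn_emb]; simp
  · rw [XM_lt _ _ _ h]
    by_cases ht : t < arr S (vI S i j') (vI S i j)
    · rw [Ft_mk _ ht]
      ext x y
      simp [F0, sub]
    · rw [Ft_zero _ (not_lt.1 ht)]
      ext x y
      rw [arr_II, if_pos h, dcnt] at ht
      symm
      apply hs
      rw [qn_emb, qn_emb, ← neg_sub, natDegree_neg]; omega

theorem CM_mk (D : Dat S) (i : Irr S) (hi : i.1 ≠ 0) : CM (mkRep D) i = D.C i := by
  refine sub_ext (i := i.1) (i' := 0) fun j j' => ?_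
  rw [sub_CM, Ft_mk _ (by rw [arr_0I i hi]; exact one_pos)]
  ext x y
  simp only [F0, sub, Matrix.of_apply, if_neg (i0_ne hi)]
  rfl

theorem CsM_mk (D : Dat S) (i : Irr S) (hi : i.1 ≠ 0) : CsM (mkRep D) i = D.Cs i := by
  refine sub_ext (i := 0) (i' := i.1) fun j j' => ?_
  rw [sub_CsM, Gt_mk _ (by rw [arr_0I i hi]; exact one_pos)]
  ext x y
  simp only [G0, sub, Matrix.of_apply, if_neg (i0_ne hi)]
  rfl

theorem rk_sub1 {a : Type} {i : Fin (S.p+1)} {j} {κ : ℕ} (h : ¬ κ < S.e i j - 1)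
    (P Q : Matrix a (Fin (rk S i j κ)) ℂ) : P = Q := by
  ext x y
  exact absurd (lt_of_lt_of_eq y.2 (rk_zero i j (not_lt.1 h))) (Nat.not_lt_zero _)

theorem rk_sub2 {a : Type} {i : Fin (S.p+1)} {j} {κ : ℕ} (h : ¬ κ < S.e i j - 1)
    (P Q : Matrix (Fin (rk S i j κ)) a ℂ) : P = Q := by
  ext x y
  exact absurd (lt_of_lt_of_eq x.2 (rk_zero i j (not_lt.1 h))) (Nat.not_lt_zero _)

theorem bFM_mk (D : Dat S) (i : Irr S) (j) : bFM (mkRep D) i j = D.bF i j := by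
  by_cases h : 0 < S.e i.1 j - 1
  · rw [bFM, dif_pos h, Ft_mk _ (by rw [arr_rI]; simp)]
    ext x y
    simp only [F0, Matrix.of_apply, dif_pos i.2]
    exact ent_val _ _ _
  · exact rk_sub1 h _ _

theorem bGM_mk (D : Dat S) (i : Irr S) (j) : bGM (mkRep D) i j = D.bG i j := by
  by_cases h : 0 < S.e i.1 j - 1
  · rw [bGM, dif_pos h, Gt_mk _ (by rw [arr_rI]; simp)]
    ext x y
    simp only [G0, Matrix.of_apply, dif_pos i.2]
    exact ent_val _ _ _
  · exact rk_sub2 h _ _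

theorem rFM_mk (D : Dat S) (i : Fin (S.p+1)) (hi : ¬ Iirr S i) (j) : rFM (mkRep D) i j = D.rF i j := by
  by_cases h : 0 < S.e i j - 1
  · refine rsub_ext (i := 0) fun j' => ?_
    rw [rsub_rFM _ _ _ h, Ft_mk _ (by rw [arr_r0 _ hi]; simp)]
    ext x y
    simp only [F0, Matrix.of_apply, dif_neg hi]
    exact ent_val _ _ _
  · exact rk_sub1 h _ _

theorem rGM_mk (D : Dat S) (i : Fin (S.p+1)) (hi : ¬ Iirr S i) (j) : rGM (mkRep D) i j = D.rG i j := by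
  by_cases h : 0 < S.e i j - 1
  · refine csub_ext (i := 0) fun j' => ?_
    rw [csub_rGM _ _ _ h, Gt_mk _ (by rw [arr_r0 _ hi]; simp)]
    ext x y
    simp only [G0, Matrix.of_apply, dif_neg hi]
    exact ent_val _ _ _
  · exact rk_sub2 h _ _

theorem lFM_mk (D : Dat S) (i : Fin (S.p+1)) (j) (κ) : lFM (mkRep D) i j κ = D.lF i j κ := by
  by_cases h : κ + 1 < S.e i j - 1
  · rw [lFM, dif_pos h, Ft_mk _ (by rw [arr_rr]; simp)]
    ext x y
    simp only [F0, Matrix.of_apply]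
    exact ent_val _ _ _
  · exact rk_sub1 h _ _

theorem lGM_mk (D : Dat S) (i : Fin (S.p+1)) (j) (κ) : lGM (mkRep D) i j κ = D.lG i j κ := by
  by_cases h : κ + 1 < S.e i j - 1
  · rw [lGM, dif_pos h, Gt_mk _ (by rw [arr_rr]; simp)]
    ext x y
    simp only [G0, Matrix.of_apply]
    exact ent_val _ _ _
  · exact rk_sub2 h _ _

end
end

noncomputable section
set_option linter.unusedSimpArgs false
set_option linter.unusedSectionVars false

section
variable {S : Setup}

theorem LI_reindex {ι κ ι' κ' : Type} [Fintype ι] [DecidableEq ι] [Fintype κ] [DecidableEq κ]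
    [Fintype ι'] [DecidableEq ι'] [Fintype κ'] [DecidableEq κ'] (e : ι' ≃ ι) (e' : κ' ≃ κ)
    {M : Matrix ι κ ℂ} : LI (M.submatrix e e') ↔ LI M := by
  have key : ∀ {ι κ ι' κ' : Type} [Fintype ι] [DecidableEq ι] [Fintype κ] [DecidableEq κ]
    [Fintype ι'] [DecidableEq ι'] [Fintype κ'] [DecidableEq κ'] (e : ι' ≃ ι) (e' : κ' ≃ κ)
    {M : Matrix ι κ ℂ}, LI M → LI (M.submatrix e e') := by
    rintro ι κ ι' κ' _ _ _ _ _ _ _ _ e e' M ⟨p, hp⟩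
    refine ⟨p.submatrix e' e, ?_⟩
    rw [Matrix.submatrix_mul_equiv, hp, Matrix.submatrix_one_equiv]
  constructor
  · intro h
    have := key e.symm e'.symm h
    simpa using this
  · exact key e e'

theorem RI_reindex {ι κ ι' κ' : Type} [Fintype ι] [DecidableEq ι] [Fintype κ] [DecidableEq κ]
    [Fintype ι'] [DecidableEq ι'] [Fintype κ'] [DecidableEq κ'] (e : ι' ≃ ι) (e' : κ' ≃ κ)
    {M : Matrix ι κ ℂ} : RI (M.submatrix e e') ↔ RI M := by
  have key : ∀ {ι κ ι' κ' : Type} [Fintype ι] [DecidableEq ι] [Fintype κ] [DecidableEq κ]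
    [Fintype ι'] [DecidableEq ι'] [Fintype κ'] [DecidableEq κ'] (e : ι' ≃ ι) (e' : κ' ≃ κ)
    {M : Matrix ι κ ℂ}, RI M → RI (M.submatrix e e') := by
    rintro ι κ ι' κ' _ _ _ _ _ _ _ _ e e' M ⟨p, hp⟩
    refine ⟨p.submatrix e' e, ?_⟩
    rw [Matrix.submatrix_mul_equiv, hp, Matrix.submatrix_one_equiv]
  constructor
  · intro h
    have := key e.symm e'.symm h
    simpa using this
  · exact key e e'

abbrev LT (S : Setup) (b : ℕ) (i : Fin (S.p+1)) (j : Fin (S.m i)) (κ : ℕ) : Type := Fin (ld b (rk S i j) κ)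

theorem legOf {b : ℕ} {i : Fin (S.p+1)} {j : Fin (S.m i)}
    {f : ∀ k, Matrix (LT S b i j k) (LT S b i j (k+1)) ℂ} {g : ∀ k, Matrix (LT S b i j (k+1)) (LT S b i j k) ℂ}
    (h : ∀ k, k < S.e i j - 1 → LI (f k) ∧ RI (g k) ∧
      f (k+1) * g (k+1) - g k * f k = (xe S i j k - xe S i j (k+1)) • 1) :
    IsLeg (LT S b i j) (xe S i j) f g := by
  refine ⟨fun k => ?_, fun k => ?_, fun k => ?_⟩
  · by_cases hk : k < S.e i j - 1
    · exact (h k hk).1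
    · exact ⟨0, rk_sub1 hk _ _⟩
  · by_cases hk : k < S.e i j - 1
    · exact (h k hk).2.1
    · exact ⟨0, rk_sub2 hk _ _⟩
  · by_cases hk : k < S.e i j - 1
    · exact (h k hk).2.2
    · exact rk_sub1 hk _ _

theorem lt_empty (b : ℕ) (i : Fin (S.p+1)) (j : Fin (S.m i)) : IsEmpty (LT S b i j (S.e i j - 1 + 1)) :=
  ⟨fun x => absurd (lt_of_lt_of_eq x.2 (rk_zero i j le_rfl)) (Nat.not_lt_zero _)⟩

structure Val (M : AR S) : Prop where
  vI : ∀ i : Irr S, i.1 ≠ 0 → ∀ j, sub S i.1 i.1 (mom (S.kk i.1) (ep S i.1) (XM M i)) j j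
      + sub S i.1 i.1 (CM M i * CsM M i) j j + bFM M i j * bGM M i j = (- xe S i.1 j 0) • 1
  v0 : ∀ j, sub S 0 0 (mom (S.kk 0) (ep S 0) (XM M (i0 S))) j j
      - (∑ i ∈ Finset.univ.filter (fun i : Irr S => i.1 ≠ 0), sub S 0 0 (CsM M i * CM M i) j j)
      + bFM M (i0 S) j * bGM M (i0 S) j
      + ∑ i ∈ Finset.univ.filter (fun i : Fin (S.p+1) => ¬ Iirr S i),
          sub S 0 0 (rFM M i (z0 S i) * rGM M i (z0 S i)) j j =
      (- xe S 0 j 0 - ∑ i ∈ Finset.univ.filter (fun i : Fin (S.p+1) => ¬ Iirr S i), xe S i (z0 S i) 0) • 1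
  legI : ∀ (i : Irr S) j, IsLeg (LT S (S.nn i.1 j) i.1 j) (xe S i.1 j) (iF M i j) (iG M i j)
  legR : ∀ (i : Fin (S.p+1)) (_ : ¬ Iirr S i) j, IsLeg (LT S S.n i j) (xe S i j) (rF M i j) (rG M i j)
  inv : ∀ i : Irr S, i.1 ≠ 0 → LI (CM M i) ∧ RI (CM M i)

theorem CM_cross (M : AR S) (i : Irr S) :
    CM M i = (crossMat S M i).submatrix (S.emb i.1).symm (S.emb 0).symm := by
  ext a b
  simp only [CM, CS, crossMat, Ft, Matrix.of_apply, Matrix.submatrix_apply]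
  split_ifs <;> rfl

theorem rFM_reg (M : AR S) (i : Fin (S.p+1)) (j) (h : 0 < S.e i j - 1) :
    rFM M i j = (regMatF S M i j ⟨0, h⟩).submatrix (S.emb 0).symm (Equiv.refl _) := by
  ext a b
  simp only [rFM, dif_pos h, rFS, regMatF, Ft, Matrix.of_apply, Matrix.submatrix_apply]
  split_ifs <;> rfl

theorem rGM_reg (M : AR S) (i : Fin (S.p+1)) (j) (h : 0 < S.e i j - 1) :
    rGM M i j = (regMatG S M i j ⟨0, h⟩).submatrix (Equiv.refl _) (S.emb 0).symm := by
  ext a b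
  simp only [rGM, dif_pos h, rGS, regMatG, Gt, Matrix.of_apply, Matrix.submatrix_apply]
  split_ifs <;> rfl

theorem lam_r (i : Fin (S.p+1)) (j) (κ : Fin (S.e i j - 1)) :
    lam S (Sum.inr ⟨i, j, κ⟩) = xe S i j κ.val - xe S i j (κ.val+1) := by
  have := κ.2
  rw [xe, xe, dif_pos (by omega), dif_pos (by omega)]; rfl

theorem lam_I (i : Irr S) (hi : i.1 ≠ 0) (j) : lam S (vI S i j) = - xe S i.1 j 0 := by
  rw [xe, dif_pos (S.he _ _)]
  simp only [lam, dif_neg hi]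

theorem lam_0 (j) : lam S (v0 S j) = - xe S 0 j 0 -
    ∑ i ∈ Finset.univ.filter (fun i : Fin (S.p+1) => ¬ Iirr S i), xe S i (z0 S i) 0 := by
  rw [xe, dif_pos (S.he _ _)]
  simp only [lam, dif_pos, i0]
  congr 1
  refine Finset.sum_congr rfl fun i _ => ?_
  rw [xe, dif_pos (S.he _ _)]; rfl

theorem f_eq (M : AR S) {a b : V S} (h : arr S a b ≤ 1) (ρ : Fin (arr S a b)) : M.f a b ρ = Ft M a b 0 := by
  have h1 : ρ.val = 0 := by have := ρ.2; omega
  rw [← Ft_val, h1]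

theorem g_eq (M : AR S) {a b : V S} (h : arr S a b ≤ 1) (ρ : Fin (arr S a b)) : M.g a b ρ = Gt M a b 0 := by
  have h1 : ρ.val = 0 := by have := ρ.2; omega
  rw [← Gt_val, h1]

theorem val_of {M : AR S} (hmu : onMu S (lam S) M) (hd : difCond S M) : Val M := by
  obtain ⟨hc, hr, hl⟩ := hd
  have hl2 : ∀ (i : Fin (S.p+1)) (j) (κ : ℕ), κ + 1 < S.e i j - 1 → LI (lFM M i j κ) ∧ RI (lGM M i j κ) := by
    intro i j κ hκ
    have ha : arr S (Sum.inr ⟨i, j, ⟨κ+1, hκ⟩⟩) (Sum.inr ⟨i, j, ⟨κ, by omega⟩⟩) = 1 := by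
      rw [arr_rr]; simp
    have := (hl i j ⟨κ+1, hκ⟩ (Sum.inr ⟨i, j, ⟨κ, by omega⟩⟩) ⟨0, by omega⟩).resolve_left (by simp)
    rw [inj_iff, surj_iff, f_eq M ha.le, g_eq M ha.le] at this
    rw [lFM, dif_pos hκ, lGM, dif_pos hκ]
    exact this
  refine ⟨?_, ?_, ?_, ?_, ?_⟩
  · intro i hi j
    rw [← moment_I M i hi, hmu, lam_I i hi]
  · intro j
    rw [← moment_0 M, hmu, lam_0]
  · intro i j
    refine legOf fun κ hκ => ?_
    have hm := hmu (Sum.inr ⟨i.1, j, ⟨κ, hκ⟩⟩)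
    rw [moment_ri, lam_r] at hm
    refine and_assoc.1 ⟨?_, hm⟩
    cases κ with
    | zero =>
      have ha : arr S (Sum.inr ⟨i.1, j, ⟨0, hκ⟩⟩) (vI S i j) = 1 := by rw [arr_rI]; simp
      have := (hl i.1 j ⟨0, hκ⟩ (vI S i j) ⟨0, by omega⟩).resolve_left (fun h => h.1 i.2)
      rw [inj_iff, surj_iff, f_eq M ha.le, g_eq M ha.le] at this
      show LI (bFM M i j) ∧ RI (bGM M i j)
      rw [bFM, dif_pos hκ, bGM, dif_pos hκ]
      exact this
    | succ κ => exact hl2 i.1 j κ hκ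
  · intro i hi j
    refine legOf fun κ hκ => ?_
    have hm := hmu (Sum.inr ⟨i, j, ⟨κ, hκ⟩⟩)
    rw [moment_rr _ _ hi, lam_r] at hm
    refine and_assoc.1 ⟨?_, hm⟩
    cases κ with
    | zero =>
      have := hr i hi j ⟨0, hκ⟩ rfl
      rw [inj_iff, surj_iff] at this
      show LI (rFM M i j) ∧ RI (rGM M i j)
      rw [rFM_reg M i j hκ, rGM_reg M i j hκ, LI_reindex, RI_reindex]
      exact this
    | succ κ => exact hl2 i j κ hκ
  · intro i hi
    have := hc i hi
    rw [Function.Bijective, inj_iff, surj_iff] at this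
    rw [CM_cross, LI_reindex, RI_reindex]
    exact this

theorem of_val {M : AR S} (h : Val M) : onMu S (lam S) M ∧ difCond S M := by
  refine ⟨?_, ?_, ?_, ?_⟩
  · rintro (⟨i, j⟩ | ⟨i, j, κ⟩)
    · by_cases hi : i.1 = 0
      · obtain rfl : i = i0 S := Subtype.ext hi
        have := h.v0 j
        rw [← moment_0 M, ← lam_0] at this
        exact this
      · have := h.vI i hi j
        rw [← moment_I M i hi, ← lam_I i hi] at this
        exact this
    · by_cases hi : Iirr S i
      · have := (h.legI ⟨i, hi⟩ j).mom κ
        rw [lam_r, ← this]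
        exact moment_ri M ⟨i, hi⟩ j κ
      · have := (h.legR i hi j).mom κ
        rw [lam_r, ← this]
        exact moment_rr M i hi j κ
  · intro i hi
    have := h.inv i hi
    rw [CM_cross, LI_reindex, RI_reindex] at this
    rw [Function.Bijective, inj_iff, surj_iff]
    exact this
  · rintro i hi j ⟨κ, hκ⟩ h0
    obtain rfl : κ = 0 := h0
    have h1 := (h.legR i hi j).li 0
    have h2 := (h.legR i hi j).ri 0
    change LI (rFM M i j) at h1
    change RI (rGM M i j) at h2
    rw [rFM_reg M i j hκ, LI_reindex] at h1
    rw [rGM_reg M i j hκ, RI_reindex] at h2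
    rw [inj_iff, surj_iff]
    exact ⟨h1, h2⟩
  · rintro i j ⟨κ, hκ⟩ (⟨i', j'⟩ | ⟨i', j', κ'⟩) ρ
    · rw [or_iff_not_imp_left]
      intro hn
      by_cases h1 : i = i'.1 ∧ (j : ℕ) = (j' : ℕ) ∧ κ = 0
      · obtain ⟨rfl, h2, rfl⟩ := h1
        obtain rfl : j = j' := Fin.ext h2
        have ha : arr S (Sum.inr ⟨i'.1, j, ⟨0, hκ⟩⟩) (vI S i' j) = 1 := by rw [arr_rI]; simp
        rw [inj_iff, surj_iff, f_eq M ha.le, g_eq M ha.le]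
        have h1 := (h.legI i' j).li 0
        have h2 := (h.legI i' j).ri 0
        change LI (bFM M i' j) at h1
        change RI (bGM M i' j) at h2
        rw [bFM, dif_pos hκ] at h1
        rw [bGM, dif_pos hκ] at h2
        exact ⟨h1, h2⟩
      · have h0 : arr S (Sum.inr ⟨i, j, ⟨κ, hκ⟩⟩) (vI S i' j') = 0 :=
          arr_rl_zero _ _ _ _ _ h1 (fun h => hn ⟨h.1, h.2.2⟩)
        exact absurd (lt_of_lt_of_eq ρ.2 h0) (Nat.not_lt_zero _)
    · right
      by_cases h1 : i = i' ∧ (j : ℕ) = (j' : ℕ) ∧ κ = κ'.val + 1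
      · obtain ⟨rfl, h2, rfl⟩ := h1
        obtain rfl : j = j' := Fin.ext h2
        obtain ⟨κ', hκ'⟩ := κ'
        have ha : arr S (Sum.inr ⟨i, j, ⟨κ'+1, hκ⟩⟩) (Sum.inr ⟨i, j, ⟨κ', hκ'⟩⟩) = 1 := by rw [arr_rr]; simp
        rw [inj_iff, surj_iff, f_eq M ha.le, g_eq M ha.le]
        have : LI (lFM M i j κ') ∧ RI (lGM M i j κ') := by
          by_cases hi : Iirr S i
          · exact ⟨(h.legI ⟨i, hi⟩ j).li (κ'+1), (h.legI ⟨i, hi⟩ j).ri (κ'+1)⟩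
          · exact ⟨(h.legR i hi j).li (κ'+1), (h.legR i hi j).ri (κ'+1)⟩
        rw [lFM, dif_pos hκ, lGM, dif_pos hκ] at this
        exact this
      · have h0 := arr_rr_zero i i' j j' ⟨κ, hκ⟩ κ' h1
        exact absurd (lt_of_lt_of_eq ρ.2 h0) (Nat.not_lt_zero _)

end
end

noncomputable section
set_option linter.unusedSimpArgs false
set_option linter.unusedSectionVars false

section
variable {S : Setup}

/-- polynomial matrix as power series matrix -/
def ps {S : Setup} (A : PMat S) : Matrix (Fin S.n) (Fin S.n) PS := A.map (fun r => (r : PS))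

theorem ps_mul (A B : PMat S) : ps (A * B) = ps A * ps B := by
  ext1 a b
  simp only [ps, Matrix.map_apply, Matrix.mul_apply]
  rw [← Polynomial.coeToPowerSeries.ringHom_apply, map_sum]
  simp [Polynomial.coe_mul]

theorem ps_sub (A B : PMat S) : ps (A - B) = ps A - ps B := by
  ext1 a b
  simp only [ps, Matrix.map_apply, Matrix.sub_apply]
  rw [← Polynomial.coeToPowerSeries.ringHom_apply, map_sub]
  simp

theorem ps_C (g : Mn S) : ps (g.map Polynomial.C) = cst g := by
  ext1 a b
  simp [ps]

theorem ps_dv {k : ℕ} {A : PMat S} : (∀ a b, (Polynomial.X ^ k : ℂ[X]) ∣ A a b) ↔ dv k (ps A) := by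
  rw [dv_iff]
  simp only [Polynomial.X_pow_dvd_iff]
  constructor
  · intro h n hn; ext a b; simpa [ps] using h a b n hn
  · intro h a b n hn; simpa [ps] using congrFun (congrFun (h n hn) a) b

/-- truncation -/
def tr {S : Setup} (k : ℕ) (A : Matrix (Fin S.n) (Fin S.n) PS) : PMat S :=
  A.map (fun r => PowerSeries.trunc k r)

theorem tr_deg (k : ℕ) (A : Matrix (Fin S.n) (Fin S.n) PS) : degLT S k (tr k A) := fun a b =>
  PowerSeries.degree_trunc_lt _ _

theorem tr_dv (k : ℕ) (A : Matrix (Fin S.n) (Fin S.n) PS) : dv k (ps (tr k A) - A) := by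
  rw [dv_iff]
  intro n hn
  ext a b
  simp [ps, tr, PowerSeries.coeff_trunc, hn]

theorem deg_uniq {k : ℕ} {A A' : PMat S} (h : degLT S k A) (h' : degLT S k A')
    (hd : dv k (ps A - ps A')) : A = A' := by
  ext a b n
  by_cases hn : n < k
  · have := congrFun (congrFun (hd.cf hn) a) b
    simp [ps] at this
    exact sub_eq_zero.1 this
  · rw [Polynomial.coeff_eq_zero_of_degree_lt, Polynomial.coeff_eq_zero_of_degree_lt]
    · exact lt_of_lt_of_le (h' a b) (by exact_mod_cast (not_lt.1 hn))
    · exact lt_of_lt_of_le (h a b) (by exact_mod_cast (not_lt.1 hn))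

theorem deg_conj {k : ℕ} {A : PMat S} (h : degLT S k A) (g g' : Mn S) :
    degLT S k (g.map Polynomial.C * A * g'.map Polynomial.C) := by
  intro a b
  rw [Polynomial.degree_lt_iff_coeff_zero]
  intro m hm
  have : ∀ x y, (A x y).coeff m = 0 := fun x y =>
    Polynomial.coeff_eq_zero_of_degree_lt (lt_of_lt_of_le (h x y) (by exact_mod_cast hm))
  simp [Matrix.mul_apply, Finset.sum_mul, Polynomial.finsetSum_coeff, this]

theorem Bmat_same (i : Fin (S.p+1)) (j) (x y : Fin (S.nn i j)) :
    Bmat S i (S.emb i ⟨j, x⟩) (S.emb i ⟨j, y⟩) =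
      (if x = y then Polynomial.reflect (S.kk i) (S.q i j) else 0) +
        Polynomial.C (S.R i j x y) * Polynomial.X ^ (S.kk i - 1) := by
  rw [Bmat, Matrix.of_apply]
  have key : ∀ u v : (Σ j : Fin (S.m i), Fin (S.nn i j)), u = ⟨j, x⟩ → v = ⟨j, y⟩ →
    (if h : u.1 = v.1 then
      (if Fin.cast (by rw [h]) u.2 = v.2 then
          Polynomial.reflect (S.kk i) (S.q i v.1) else 0)
        + Polynomial.C (S.R i v.1 (Fin.cast (by rw [h]) u.2) v.2)
          * Polynomial.X ^ (S.kk i - 1)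
    else 0) = (if x = y then Polynomial.reflect (S.kk i) (S.q i j) else 0) +
        Polynomial.C (S.R i j x y) * Polynomial.X ^ (S.kk i - 1) := by
    rintro u v rfl rfl
    rw [dif_pos rfl]; rfl
  exact key _ _ (by simp) (by simp)

theorem ps_Bmat (i : Fin (S.p+1)) :
    ps (Bmat S i) = Bq (S.kk i) (qn S i) + xx ^ (S.kk i - 1) • cst (bd S i (S.R i)) := by
  ext1 a b
  obtain ⟨⟨j, x⟩, rfl⟩ := (S.emb i).surjective a
  obtain ⟨⟨j', y⟩, rfl⟩ := (S.emb i).surjective b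
  by_cases h : j = j'
  · subst h
    rw [ps, Matrix.map_apply, Bmat_same]
    by_cases hx : x = y
    · subst hx
      simp [Bq, bd, xx]
      exact mul_comm _ _
    · simp [Bq, bd, xx, hx, Matrix.diagonal_apply]
      exact mul_comm _ _
  · simp [ps, Bmat, Bq, bd, xx, h, Matrix.diagonal_apply, Matrix.blockDiagonal'_apply_ne _ _ _ h]

theorem res_ps (i : Fin (S.p+1)) (A : PMat S) : resMat S i A = cf (S.kk i - 1) (ps A) := by
  ext a b; simp [resMat, ps]

theorem orb_dest {i : Fin (S.p+1)} {A : PMat S} (h : inOrbit S i A) :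
    ∃ P Q : Mn S, P * Q = 1 ∧ Q * P = 1 ∧
      Ohat (S.kk i) (qn S i) (cst P * ps A * cst Q) (bd S i (S.R i)) := by
  obtain ⟨-, g, hu, hg⟩ := h
  obtain ⟨u, hu⟩ := hu
  rw [ps_dv, ps_sub, ps_mul, ps_mul, ps_Bmat] at hg
  have c2 : cst u.val * cst u⁻¹.val = 1 := by rw [← cst_mul, Units.mul_inv, cst_one]
  refine ⟨u⁻¹.val, u.val, Units.inv_mul _, Units.mul_inv _, blk_bd i _, cst u⁻¹.val * ps g, ?_, ?_⟩
  · have e : cf 0 (ps g) = u.val := by rw [hu]; ext a b; simp [ps]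
    rw [dv_iff]; intro n hn
    obtain rfl : n = 0 := by omega
    rw [cf_sub, cf_cst_mul, e, Units.inv_mul, ← cst_one, cf_cst, if_pos rfl, sub_self]
  · have := (hg.mul_left (cst u⁻¹.val)).neg
    convert this using 1
    rw [Matrix.mul_sub, neg_sub, Matrix.mul_assoc _ (cst u.val), ← Matrix.mul_assoc (cst u.val), c2,
      Matrix.one_mul]
    simp only [Matrix.mul_assoc]

theorem orb_of {i : Fin (S.p+1)} {A : PMat S} (hd : degLT S (S.kk i) A) {P Q R' : Mn S}
    (hPQ : P * Q = 1) (hQP : Q * P = 1)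
    (hO : Ohat (S.kk i) (qn S i) (cst P * ps A * cst Q) R')
    (hR : ∀ j, ∃ h h' : Matrix (Fin (S.nn i j)) (Fin (S.nn i j)) ℂ, h * h' = 1 ∧ h' * h = 1 ∧
      h * sub S i i R' j j = S.R i j * h) : inOrbit S i A := by
  choose h h' h1 h2 h3 using hR
  have H1 := bd_mul_one h1
  have H2 := bd_mul_one h2
  have hbR : blk (qn S i) R' := hO.1
  have H3 : bd S i h * R' * bd S i h' = bd S i (S.R i) := by
    apply sub_ext (i := i) (i' := i)
    intro j j'
    rw [sub_mul_blk (blk_bd i _), sub_blk_mul (blk_bd i _)]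
    by_cases hj : j = j'
    · subst hj
      rw [sub_bd_same, sub_bd_same, sub_bd_same, h3, Matrix.mul_assoc, h1, Matrix.mul_one]
    · rw [(blk_iff i _).1 hbR _ _ hj, sub_bd_diff _ _ hj]; simp
  have hO2 := hO.conj H1 H2 (blk_bd i _) (blk_bd i _)
  rw [H3] at hO2
  obtain ⟨-, b, hb1, hb2⟩ := hO2
  set P' := bd S i h * P with hP'
  set Q' := Q * bd S i h' with hQ'
  have e1 : P' * Q' = 1 := by
    rw [hP', hQ', Matrix.mul_assoc, ← Matrix.mul_assoc P, hPQ, Matrix.one_mul, H1]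
  have e2 : Q' * P' = 1 := by
    rw [hP', hQ', Matrix.mul_assoc, ← Matrix.mul_assoc (bd S i h'), H2, Matrix.one_mul, hQP]
  have e3 : cst (bd S i h) * (cst P * ps A * cst Q) * cst (bd S i h') = cst P' * ps A * cst Q' := by
    rw [hP', hQ', cst_mul, cst_mul]; simp only [Matrix.mul_assoc]
  rw [e3] at hb2
  have hk := S.hkk i
  have ht := tr_dv (S.kk i) (cst Q' * b)
  refine ⟨hd, tr (S.kk i) (cst Q' * b), ?_, ?_⟩
  · have e4 : ((tr (S.kk i) (cst Q' * b)).map fun r => r.coeff 0) = Q' := by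
      have h4 := dv_cst_smul ht hk
      have h5 := dv_cst_smul hb1 zero_lt_one
      rw [cf_cst_mul, h5, ← cst_one, cf_cst, if_pos rfl, Matrix.mul_one] at h4
      refine Eq.trans ?_ h4; ext a b; simp [ps]
    rw [e4]
    exact ⟨⟨Q', P', e2, e1⟩, rfl⟩
  · rw [ps_dv, ps_sub, ps_mul, ps_mul, ps_Bmat]
    have h4 := (hb2.mul_left (cst Q')).neg
    have c : cst Q' * cst P' = 1 := by rw [← cst_mul, e2, cst_one]
    have h5 := (ht.mul_right (Bq (S.kk i) (qn S i) + xx ^ (S.kk i - 1) • cst (bd S i (S.R i)))).sub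
      (ht.mul_left (ps A))
    have h6 := h4.add h5
    convert h6 using 1
    have : cst Q' * (cst P' * ps A * cst Q' * b) = ps A * (cst Q' * b) := by
      rw [← Matrix.mul_assoc, ← Matrix.mul_assoc, ← Matrix.mul_assoc, c, Matrix.one_mul,
        Matrix.mul_assoc]
    rw [Matrix.mul_sub, this]
    simp only [Matrix.mul_sub, Matrix.sub_mul, Matrix.mul_assoc]
    abel

theorem reg_m {i : Fin (S.p+1)} (hi : ¬ Iirr S i) : S.m i = 1 := by
  have := S.hm i
  unfold Iirr at hi; push Not at hi; omega

theorem reg_kk {i : Fin (S.p+1)} (hi : ¬ Iirr S i) : S.kk i = 1 := S.hreg i hi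

theorem reg_qn {i : Fin (S.p+1)} (hi : ¬ Iirr S i) (a) : qn S i a = 0 := by
  have h1 := S.hqdeg i ((S.emb i).symm a).1
  rw [reg_kk hi] at h1
  ext n
  rcases n with _ | _ | n
  · simpa [qn] using S.hq0 i _
  · simpa [qn] using S.hq1 i _
  · rw [Polynomial.coeff_zero]
    exact Polynomial.coeff_eq_zero_of_natDegree_lt (lt_of_le_of_lt h1 (by omega))

theorem reg_Ohat {i : Fin (S.p+1)} (hi : ¬ Iirr S i) (A : Matrix (Fin S.n) (Fin S.n) PS) (R : Mn S) :
    Ohat (S.kk i) (qn S i) A R ↔ cf 0 A = R := by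
  have hB : Bq (S.kk i) (qn S i) = 0 := by
    ext1 a b; simp [Bq, Matrix.diagonal_apply, reg_qn hi]
  rw [reg_kk hi] at *
  constructor
  · rintro ⟨-, b, hb, h⟩
    have h5 := dv_cst_smul hb zero_lt_one
    rw [← cst_one, cf_cst, if_pos rfl] at h5
    have := dv_cst_smul h zero_lt_one
    rw [hB, zero_add, cf_mul, cf_mul] at this
    simpa [h5, cf_cst] using this
  · intro h
    refine ⟨fun a b hab => absurd (by rw [reg_qn hi, reg_qn hi]) hab, 1, by simpa using dv_zero_right _, ?_⟩
    rw [hB, dv_iff]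
    intro n hn
    obtain rfl : n = 0 := by omega
    simp [h, cf_cst]

theorem pp_conj {a b : Type} [Fintype a] [DecidableEq a] [Fintype b] [DecidableEq b]
    {L : Matrix a b ℂ} {L' : Matrix b a ℂ} (h1 : L * L' = 1) (h2 : L' * L = 1) (A : Matrix b b ℂ)
    (ξ : ℕ → ℂ) (κ : ℕ) : pp (L * A * L') ξ κ = L * pp A ξ κ * L' := by
  induction κ with
  | zero => simp [pp, h1]
  | succ κ ih =>
    rw [pp, pp, ih]
    have : L * A * L' - ξ κ • 1 = L * (A - ξ κ • 1) * L' := by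
      simp [Matrix.mul_sub, Matrix.sub_mul, h1]
    rw [this]
    simp only [Matrix.mul_assoc]
    rw [← Matrix.mul_assoc L' L, h2, Matrix.one_mul]

theorem pp_rank {a b : Type} [Fintype a] [DecidableEq a] [Fintype b] [DecidableEq b]
    {L : Matrix a b ℂ} {L' : Matrix b a ℂ} (h1 : L * L' = 1) (h2 : L' * L = 1) (A : Matrix b b ℂ)
    (ξ : ℕ → ℂ) (κ : ℕ) : (pp (L * A * L') ξ κ).rank = (pp A ξ κ).rank := by
  have key : ∀ {a b : Type} [Fintype a] [DecidableEq a] [Fintype b] [DecidableEq b]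
    {L : Matrix a b ℂ} {L' : Matrix b a ℂ} (A : Matrix b b ℂ), (L * A * L').rank ≤ A.rank := by
    intro a b _ _ _ _ L L' A
    exact (Matrix.rank_mul_le_left _ _).trans (Matrix.rank_mul_le_right _ _)
  apply le_antisymm
  · rw [pp_conj h1 h2]; exact key _
  · have : A = L' * (L * A * L') * L := by
      simp only [Matrix.mul_assoc]
      rw [h2, ← Matrix.mul_assoc L' L, h2]; simp
    conv_lhs => rw [this, pp_conj h2 h1]
    exact key _

theorem leg_irr (i : Fin (S.p+1)) (j : Fin (S.m i)) : ∃ f g,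
    IsLeg (LT S (S.nn i j) i j) (xe S i j) f g ∧ f 0 * g 0 = S.R i j - xe S i j 0 • 1 := by
  apply legexist (T := LT S (S.nn i j) i j) (S.R i j)
  intro κ
  rw [← rk_pp]
  simp [LT, ld]

theorem leg_reg {i : Fin (S.p+1)} (hi : ¬ Iirr S i) (j : Fin (S.m i)) {P Q : Mn S} (h1 : P * Q = 1)
    (h2 : Q * P = 1) : ∃ f g,
    IsLeg (LT S S.n i j) (xe S i j) f g ∧ f 0 * g 0 = P * bd S i (S.R i) * Q - xe S i j 0 • 1 := by
  apply legexist (T := LT S S.n i j) (P * bd S i (S.R i) * Q)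
  intro κ
  have hm := reg_m hi
  have hsub : ∀ j' : Fin (S.m i), j' = j := fun j' => by
    ext; have := j.2; have := j'.2; omega
  rw [pp_rank (a := Fin S.n) h1 h2]
  let e : Fin (S.nn i j) ≃ Fin S.n := Equiv.ofBijective (fun x => S.emb i ⟨j, x⟩) (by
    constructor
    · intro x y hxy
      simpa using hxy
    · intro a
      obtain ⟨⟨j', x⟩, rfl⟩ := (S.emb i).surjective a
      obtain rfl := hsub j'
      exact ⟨x, rfl⟩)
  let E : Matrix (Fin S.n) (Fin (S.nn i j)) ℂ := (1 : Mn S).submatrix id e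
  let E' : Matrix (Fin (S.nn i j)) (Fin S.n) ℂ := (1 : Mn S).submatrix e id
  have g2 : E' * E = 1 := by
    ext x y
    simp [E, E', Matrix.mul_apply, Matrix.one_apply]
  have g1 : E * E' = 1 := by
    show (1 : Mn S).submatrix id e * (1 : Mn S).submatrix e id = 1
    rw [Matrix.submatrix_mul_equiv]; simp
  have g3 : S.R i j = E' * bd S i (S.R i) * E := by
    have : E' * bd S i (S.R i) * E = sub S i i (bd S i (S.R i)) j j := by
      show (1 : Mn S).submatrix e id * bd S i (S.R i) * (1 : Mn S).submatrix id e = _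
      ext x y
      simp [Matrix.mul_apply, Matrix.one_apply, sub, e]
      rfl
    rw [this, sub_bd_same]
  have := pp_rank g2 g1 (bd S i (S.R i)) (xe S i j) (κ+1)
  rw [← this, ← g3, ← rk_pp]
  simp [LT, ld]
end
end

noncomputable section
set_option linter.unusedSimpArgs false
set_option linter.unusedSectionVars false

section
variable {S : Setup}

theorem epsOK (i : Fin (S.p+1)) : EpsOK (qn S i) (ep S i) := by
  have hq : ∀ a c, qn S i a = qn S i c ↔ ((S.emb i).symm a).1 = ((S.emb i).symm c).1 :=
    fun a c => q_inj i
  refine ⟨?_, ?_, ?_⟩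
  · intro a a' c c' h1 h2
    rw [hq] at h1 h2
    rw [ep, ep, h1, h2]
  · intro a c h
    rw [ne_eq, hq] at h
    rw [ep, ep]
    rcases lt_or_gt_of_ne h with h | h
    · simp [h, h.asymm]
    · simp [h, h.asymm]
  · intro a c h
    rw [ne_eq, hq] at h
    rw [ep]
    rcases lt_or_gt_of_ne h with h | h
    · simp [h, h.asymm]
    · simp [h, h.asymm]

theorem exists_Ph (S : Setup) (i : Fin (S.p+1)) : ∃ Φ, KMap (S.kk i) (qn S i) (ep S i) Φ :=
  exists_kmap _ _ _ _ _ rfl (S.hkk i) (fun _ => S.hq0 i _) (fun _ => S.hq1 i _)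
    (fun _ => S.hqdeg i _) (epsOK i)

def Ph (S : Setup) (i : Fin (S.p+1)) := (exists_Ph S i).choose
theorem Ph_spec (S : Setup) (i : Fin (S.p+1)) : KMap (S.kk i) (qn S i) (ep S i) (Ph S i) :=
  (exists_Ph S i).choose_spec

theorem XM_supp (M : AR S) (i : Irr S) : suppOK (qn S i.1) (XM M i) := by
  intro t a b h
  obtain ⟨⟨j, x⟩, rfl⟩ := (S.emb i.1).surjective a
  obtain ⟨⟨j', y⟩, rfl⟩ := (S.emb i.1).surjective b
  rw [qn_emb, qn_emb] at h
  show sub S i.1 i.1 (XM M i t) j j' x y = 0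
  rcases lt_trichotomy j j' with hj | rfl | hj
  · rw [XM_gt _ _ _ hj, Gt_zero _ (by rw [arr_II, if_pos hj, dcnt]; omega)]; rfl
  · rw [XM_eq]; rfl
  · rw [XM_lt _ _ _ hj, Ft_zero _ (by
      rw [arr_II, if_pos hj, dcnt, ← Polynomial.natDegree_neg, neg_sub]; omega)]; rfl

/-- The correspondence between tuples and representations. -/
structure Rl (A : Fin (S.p+1) → PMat S) (M : AR S) (P Q R' : Irr S → Mn S) : Prop where
  pq : ∀ i, P i * Q i = 1
  qp : ∀ i, Q i * P i = 1
  oh : ∀ i, Ohat (S.kk i.1) (qn S i.1) (cst (P i) * ps (A i.1) * cst (Q i)) (R' i)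
  ph : ∀ i, Ph S i.1 (cst (P i) * ps (A i.1) * cst (Q i)) = XM M i
  c : ∀ i : Irr S, i.1 ≠ 0 → CM M i = P i * Q (i0 S)
  cs : ∀ i : Irr S, i.1 ≠ 0 → CsM M i = - (P (i0 S) * resMat S i.1 (A i.1) * Q i)
  rg : ∀ i, ¬ Iirr S i → P (i0 S) * resMat S i (A i) * Q (i0 S) =
    rFM M i (z0 S i) * rGM M i (z0 S i) + xe S i (z0 S i) 0 • 1

theorem sum_split (S : Setup) {E : Type} [AddCommGroup E] (F : Fin (S.p+1) → E) :
    ∑ i, F i = F 0 + ∑ i ∈ Finset.univ.filter (fun i : Irr S => i.1 ≠ 0), F i.1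
      + ∑ i ∈ Finset.univ.filter (fun i : Fin (S.p+1) => ¬ Iirr S i), F i := by
  rw [← Finset.sum_filter_add_sum_filter_not Finset.univ (fun i => Iirr S i)]
  congr 1
  have e1 : ∑ i ∈ Finset.univ.filter (fun i : Fin (S.p+1) => Iirr S i), F i = ∑ i : Irr S, F i.1 := by
    rw [Finset.sum_subtype (p := fun i => Iirr S i) _ (by simp)]
  rw [e1, ← Finset.sum_filter_add_sum_filter_not Finset.univ (fun i : Irr S => i.1 = 0)]
  congr 1
  have : (Finset.univ.filter (fun i : Irr S => i.1 = 0)) = {i0 S} := by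
    ext i
    simp [Subtype.ext_iff, i0]
  rw [this, Finset.sum_singleton]

theorem cf_PAQ (P Q : Mn S) (A : PMat S) (i) : cf (S.kk i - 1) (cst P * ps A * cst Q) = P * resMat S i A * Q := by
  rw [cf_mul_cst, cf_cst_mul, res_ps]

namespace Rl
variable {A : Fin (S.p+1) → PMat S} {M : AR S} {P Q R' : Irr S → Mn S}

theorem blockR (h : Rl A M P Q R') (i : Irr S) (j) :
    sub S i.1 i.1 (R' i) j j = sub S i.1 i.1 (P i * resMat S i.1 (A i.1) * Q i) j j
      - sub S i.1 i.1 (mom (S.kk i.1) (ep S i.1) (XM M i)) j j := by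
  ext x y
  have := (Ph_spec S i.1).moment _ _ (h.oh i) (S.emb i.1 ⟨j, x⟩) (S.emb i.1 ⟨j, y⟩) (by simp)
  rw [cf_PAQ, h.ph] at this
  exact this

theorem YI (h : Rl A M P Q R') (i : Irr S) (hi : i.1 ≠ 0) :
    P i * resMat S i.1 (A i.1) * Q i = - (CM M i * CsM M i) := by
  rw [h.c i hi, h.cs i hi, Matrix.mul_neg, neg_neg]
  simp only [Matrix.mul_assoc]
  rw [← Matrix.mul_assoc (Q (i0 S)) (P (i0 S)), h.qp, Matrix.one_mul]

theorem YI0 (h : Rl A M P Q R') (i : Irr S) (hi : i.1 ≠ 0) :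
    P (i0 S) * resMat S i.1 (A i.1) * Q (i0 S) = - (CsM M i * CM M i) := by
  rw [h.c i hi, h.cs i hi, Matrix.neg_mul, neg_neg, Matrix.mul_assoc (P (i0 S) * _), ← Matrix.mul_assoc (Q i),
    h.qp, Matrix.one_mul]

theorem sumY (h : Rl A M P Q R') :
    P (i0 S) * (∑ i, resMat S i (A i)) * Q (i0 S) = P (i0 S) * resMat S 0 (A 0) * Q (i0 S)
      - (∑ i ∈ Finset.univ.filter (fun i : Irr S => i.1 ≠ 0), CsM M i * CM M i)
      + ∑ i ∈ Finset.univ.filter (fun i : Fin (S.p+1) => ¬ Iirr S i),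
        (rFM M i (z0 S i) * rGM M i (z0 S i) + xe S i (z0 S i) 0 • (1 : Mn S)) := by
  rw [sum_split]
  simp only [Matrix.mul_add, Matrix.add_mul, Finset.mul_sum, Finset.sum_mul]
  rw [sub_eq_add_neg, ← Finset.sum_neg_distrib]
  congr 1
  · congr 1
    refine Finset.sum_congr rfl fun i hi => h.YI0 i (by simpa using hi)
  · refine Finset.sum_congr rfl fun i hi => h.rg i (by simpa using hi)

theorem mI (h : Rl A M P Q R') (i : Irr S) (hi : i.1 ≠ 0) (j) :
    (sub S i.1 i.1 (R' i) j j = bFM M i j * bGM M i j + xe S i.1 j 0 • 1) ↔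
    sub S i.1 i.1 (mom (S.kk i.1) (ep S i.1) (XM M i)) j j
      + sub S i.1 i.1 (CM M i * CsM M i) j j + bFM M i j * bGM M i j = (- xe S i.1 j 0) • 1 := by
  rw [h.blockR, h.YI i hi, sub_neg, neg_smul]
  constructor
  · intro e
    rw [← sub_eq_zero] at e ⊢
    rw [← neg_eq_zero, ← e]; abel
  · intro e
    rw [← sub_eq_zero] at e ⊢
    rw [← neg_eq_zero, ← e]; abel

theorem m0 (h : Rl A M P Q R') (hs : ∑ i, resMat S i (A i) = 0) (j) :
    (sub S 0 0 (R' (i0 S)) j j = bFM M (i0 S) j * bGM M (i0 S) j + xe S 0 j 0 • 1) ↔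
    sub S 0 0 (mom (S.kk 0) (ep S 0) (XM M (i0 S))) j j
      - (∑ i ∈ Finset.univ.filter (fun i : Irr S => i.1 ≠ 0), sub S 0 0 (CsM M i * CM M i) j j)
      + bFM M (i0 S) j * bGM M (i0 S) j
      + ∑ i ∈ Finset.univ.filter (fun i : Fin (S.p+1) => ¬ Iirr S i),
          sub S 0 0 (rFM M i (z0 S i) * rGM M i (z0 S i)) j j =
      (- xe S 0 j 0 - ∑ i ∈ Finset.univ.filter (fun i : Fin (S.p+1) => ¬ Iirr S i), xe S i (z0 S i) 0) • 1 := by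
  have e1 := h.sumY
  rw [hs, Matrix.mul_zero, Matrix.zero_mul, Finset.sum_add_distrib, ← Finset.sum_smul] at e1
  have e2 : P (i0 S) * resMat S 0 (A 0) * Q (i0 S) =
     (∑ i ∈ Finset.univ.filter (fun i : Irr S => i.1 ≠ 0), CsM M i * CM M i)
      - ((∑ i ∈ Finset.univ.filter (fun i : Fin (S.p+1) => ¬ Iirr S i),
        rFM M i (z0 S i) * rGM M i (z0 S i)) + (∑ i ∈ Finset.univ.filter (fun i : Fin (S.p+1) => ¬ Iirr S i), xe S i (z0 S i) 0) • (1 : Mn S)) := by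
    rw [← sub_eq_zero, e1]; abel
  have e3 := h.blockR (i0 S) j
  change sub S 0 0 (R' (i0 S)) j j = sub S 0 0 (P (i0 S) * resMat S 0 (A 0) * Q (i0 S)) j j
     - sub S 0 0 (mom (S.kk 0) (ep S 0) (XM M (i0 S))) j j at e3
  rw [e2, sub_sub', sub_add, sub_smul', sub_one_same, sub_sum, sub_sum] at e3
  rw [e3, _root_.sub_smul, neg_smul]
  constructor
  · intro e
    rw [← sub_eq_zero] at e ⊢
    rw [← neg_eq_zero, ← e]; abel
  · intro e
    rw [← sub_eq_zero] at e ⊢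
    rw [← neg_eq_zero, ← e]; abel

end Rl

end
end

noncomputable section
set_option linter.unusedSimpArgs false
set_option linter.unusedSectionVars false

section
variable {S : Setup}

theorem total {A : Fin (S.p+1) → PMat S} (hA : isDSElem S A) :
    ∃ M : AR S, Val M ∧ ∃ P Q R', Rl A M P Q R' := by
  obtain ⟨hO, hs⟩ := hA
  choose P Q hPQ hQP hoh using fun i => orb_dest (hO i)
  choose fI gI hleg hfg using fun (i : Fin (S.p+1)) (j : Fin (S.m i)) => leg_irr i j
  have hregex : ∀ (i : Fin (S.p+1)) (j : Fin (S.m i)), ∃ f g, (¬ Iirr S i →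
    IsLeg (LT S S.n i j) (xe S i j) f g ∧
      f 0 * g 0 = (P 0 * Q i) * bd S i (S.R i) * (P i * Q 0) - xe S i j 0 • 1) := by
    intro i j
    by_cases hi : Iirr S i
    · exact ⟨fun _ => 0, fun _ => 0, fun h => absurd hi h⟩
    · obtain ⟨f, g, h⟩ := leg_reg hi j (P := P 0 * Q i) (Q := P i * Q 0)
        (by rw [Matrix.mul_assoc, ← Matrix.mul_assoc (Q i), hQP, Matrix.one_mul, hPQ])
        (by rw [Matrix.mul_assoc, ← Matrix.mul_assoc (Q 0), hQP, Matrix.one_mul, hPQ])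
      exact ⟨f, g, fun _ => h⟩
  choose fR gR hR using hregex
  let D : Dat S :=
    { X := fun i => Ph S i.1 (cst (P i.1) * ps (A i.1) * cst (Q i.1))
      C := fun i => P i.1 * Q 0
      Cs := fun i => - (P 0 * resMat S i.1 (A i.1) * Q i.1)
      bF := fun i j => fI i.1 j 0
      bG := fun i j => gI i.1 j 0
      rF := fun i j => fR i j 0
      rG := fun i j => gR i j 0
      lF := fun i j κ => if Iirr S i then fI i j (κ+1) else fR i j (κ+1)
      lG := fun i j κ => if Iirr S i then gI i j (κ+1) else gR i j (κ+1) }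
  have hrl : Rl A (mkRep D) (fun i => P i.1) (fun i => Q i.1) (fun i => bd S i.1 (S.R i.1)) := by
    refine ⟨fun i => hPQ _, fun i => hQP _, fun i => hoh i.1, fun i => ?_, fun i hi => ?_, fun i hi => ?_,
      fun i hi => ?_⟩
    · exact (XM_mk D i ((Ph_spec S i.1).supp _ _ (hoh i.1))).symm
    · exact CM_mk D i hi
    · exact CsM_mk D i hi
    · rw [rFM_mk D i hi, rGM_mk D i hi]
      have h1 := (hR i (z0 S i) hi).2
      show P 0 * resMat S i (A i) * Q 0 = fR i (z0 S i) 0 * gR i (z0 S i) 0 + _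
      rw [h1]
      have h2 := (reg_Ohat hi _ _).1 (hoh i)
      rw [← h2, cf_mul_cst, cf_cst_mul, res_ps, reg_kk hi]
      show _ = _ - _ + _
      rw [sub_add_cancel]
      simp only [Matrix.mul_assoc]
      rw [← Matrix.mul_assoc (Q i) (P i), ← Matrix.mul_assoc (Q i) (P i), hQP, Matrix.one_mul, Matrix.one_mul]
  refine ⟨mkRep D, ?_, _, _, _, hrl⟩
  refine ⟨fun i hi j => (hrl.mI i hi j).1 ?_, fun j => (hrl.m0 hs j).1 ?_, fun i j => ?_, fun i hi j => ?_,
    fun i hi => ?_⟩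
  · rw [bFM_mk, bGM_mk, sub_bd_same]
    show _ = fI i.1 j 0 * gI i.1 j 0 + _
    rw [hfg]; exact (sub_add_cancel _ _).symm
  · rw [bFM_mk, bGM_mk]
    show sub S 0 0 (bd S 0 (S.R 0)) j j = fI 0 j 0 * gI 0 j 0 + _
    rw [hfg, sub_bd_same]; exact (sub_add_cancel _ _).symm
  · convert hleg i.1 j using 1
    · funext κ
      cases κ with
      | zero => exact bFM_mk D i j
      | succ κ => exact (lFM_mk D i.1 j κ).trans (if_pos i.2)
    · funext κ
      cases κ with
      | zero => exact bGM_mk D i j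
      | succ κ => exact (lGM_mk D i.1 j κ).trans (if_pos i.2)
  · convert (hR i j hi).1 using 1
    · funext κ
      cases κ with
      | zero => exact rFM_mk D i hi j
      | succ κ => exact (lFM_mk D i j κ).trans (if_neg hi)
    · funext κ
      cases κ with
      | zero => exact rGM_mk D i hi j
      | succ κ => exact (lGM_mk D i j κ).trans (if_neg hi)
  · rw [CM_mk D i hi]
    show LI (P i.1 * Q 0) ∧ RI (P i.1 * Q 0)
    refine ⟨⟨P 0 * Q i.1, ?_⟩, ⟨P 0 * Q i.1, ?_⟩⟩
    · rw [Matrix.mul_assoc, ← Matrix.mul_assoc (Q i.1), hQP, Matrix.one_mul, hPQ]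
    · rw [Matrix.mul_assoc, ← Matrix.mul_assoc (Q 0), hQP, Matrix.one_mul, hPQ]

theorem surjective {M : AR S} (hM : Val M) :
    ∃ A : Fin (S.p+1) → PMat S, isDSElem S A ∧ ∃ P Q R', Rl A M P Q R' := by
  have hinv : ∀ i : Irr S, ∃ P Q : Mn S, P * Q = 1 ∧ Q * P = 1 ∧ (i.1 ≠ 0 → P = CM M i) ∧
      (i.1 = 0 → P = 1 ∧ Q = 1) := by
    intro i
    by_cases hi : i.1 = 0
    · exact ⟨1, 1, by simp, by simp, fun h => absurd hi h, fun _ => ⟨rfl, rfl⟩⟩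
    · obtain ⟨⟨a, ha⟩, ⟨b, hb⟩⟩ := hM.inv i hi
      exact ⟨CM M i, b, hb, mul_eq_one_comm.1 hb, fun _ => rfl, fun h => absurd h hi⟩
  choose P Q hPQ hQP hP h10 using hinv
  obtain ⟨hP0, hQ0⟩ := h10 (i0 S) rfl
  let Y : Irr S → Mn S := fun i => if i.1 = 0 then
     (∑ i ∈ Finset.univ.filter (fun i : Irr S => i.1 ≠ 0), CsM M i * CM M i)
      - ∑ i ∈ Finset.univ.filter (fun i : Fin (S.p+1) => ¬ Iirr S i),
        (rFM M i (z0 S i) * rGM M i (z0 S i) + xe S i (z0 S i) 0 • (1 : Mn S))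
    else - (CM M i * CsM M i)
  choose B R' hO hX hY using fun i : Irr S => (Ph_spec S i.1).surj (XM M i) (Y i) (XM_supp M i)
  let A : Fin (S.p+1) → PMat S := fun i => if h : Iirr S i then
      tr (S.kk i) (cst (Q ⟨i, h⟩) * B ⟨i, h⟩ * cst (P ⟨i, h⟩))
    else (rFM M i (z0 S i) * rGM M i (z0 S i) + xe S i (z0 S i) 0 • (1 : Mn S)).map Polynomial.C
  have hAI : ∀ i : Irr S, A i.1 = tr (S.kk i.1) (cst (Q i) * B i * cst (P i)) := fun i => dif_pos i.2
  have hAR : ∀ i, ¬ Iirr S i → A i =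
    (rFM M i (z0 S i) * rGM M i (z0 S i) + xe S i (z0 S i) 0 • (1 : Mn S)).map Polynomial.C :=
    fun i hi => dif_neg hi
  have hBA : ∀ i : Irr S, dv (S.kk i.1) (B i - cst (P i) * ps (A i.1) * cst (Q i)) := by
    intro i
    have h1 := ((tr_dv (S.kk i.1) (cst (Q i) * B i * cst (P i))).mul_left (cst (P i))).mul_right (cst (Q i))
    have h2 := h1.neg
    convert h2 using 1
    rw [hAI, Matrix.mul_sub, Matrix.sub_mul, neg_sub]
    congr 1
    have c : cst (P i) * cst (Q i) = 1 := by rw [← cst_mul, hPQ, cst_one]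
    simp only [Matrix.mul_assoc]
    rw [c, ← Matrix.mul_assoc (cst (P i)) (cst (Q i)), c]; simp
  have hres : ∀ i : Irr S, P i * resMat S i.1 (A i.1) * Q i = Y i := by
    intro i
    have hk := S.hkk i.1
    rw [← cf_PAQ, ← dv_cst_smul (hBA i) (by omega), hY]
  have hresR : ∀ i, ¬ Iirr S i → resMat S i (A i) =
      rFM M i (z0 S i) * rGM M i (z0 S i) + xe S i (z0 S i) 0 • (1 : Mn S) := by
    intro i hi
    rw [res_ps, hAR i hi, ps_C, cf_cst, reg_kk hi, if_pos rfl]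
  have hrl : Rl A M P Q R' := by
    refine ⟨hPQ, hQP, fun i => (hO i).congr (hBA i), fun i => ?_, fun i hi => ?_, fun i hi => ?_,
      fun i hi => ?_⟩
    · rw [(Ph_spec S i.1).congr _ _ _ (hO i) (hBA i), hX]
    · rw [hQ0, Matrix.mul_one, hP i hi]
    · have := hres i
      simp only [Y, if_neg hi] at this
      rw [← hP i hi] at this
      have h2 := congrArg (fun Z => Q i * Z) this
      simp only [Matrix.mul_neg] at h2
      rw [← Matrix.mul_assoc (Q i) (P i) (CsM M i), hQP, Matrix.one_mul] at h2
      rw [hP0, Matrix.one_mul, ← neg_eq_iff_eq_neg, ← h2, ← Matrix.mul_assoc, ← Matrix.mul_assoc, hQP,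
        Matrix.one_mul]
    · rw [hP0, hQ0, Matrix.one_mul, Matrix.mul_one, hresR i hi]
  have hs : ∑ i, resMat S i (A i) = 0 := by
    have h1 := hrl.sumY
    have h2 : P (i0 S) * resMat S 0 (A 0) * Q (i0 S) = _ := hres (i0 S)
    rw [h2] at h1
    simp only [Y, if_pos] at h1
    rw [hP0, hQ0, Matrix.one_mul, Matrix.mul_one] at h1
    rw [h1]
    simp
  refine ⟨A, ⟨fun i => ?_, hs⟩, P, Q, R', hrl⟩
  by_cases hi : Iirr S i
  · have key : ∀ i : Irr S, inOrbit S i.1 (A i.1) := by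
      intro i
      have hblock : ∀ j, sub S i.1 i.1 (R' i) j j = bFM M i j * bGM M i j + xe S i.1 j 0 • 1 := by
        by_cases h0 : i.1 = 0
        · obtain rfl : i = i0 S := Subtype.ext h0
          exact fun j => (hrl.m0 hs j).2 (hM.v0 j)
        · exact fun j => (hrl.mI i h0 j).2 (hM.vI i h0 j)
      refine orb_of (by rw [hAI]; exact tr_deg _ _) (hPQ i) (hQP i) (hrl.oh i) fun j => ?_
      obtain ⟨f, g, hl, hfg⟩ := leg_irr i.1 j
      obtain ⟨φ, φi, h1, h2, h3⟩ := legsim (hM.legI i j) hl (lt_empty _ i.1 j)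
      refine ⟨φ, φi, h1, h2, ?_⟩
      rw [hfg] at h3
      change φ * (bFM M i j * bGM M i j) = _ at h3
      rw [hblock]
      have h4 : φ * (bFM M i j * bGM M i j + xe S i.1 j 0 • 1) =
        φ * (bFM M i j * bGM M i j) + xe S i.1 j 0 • φ := by
        rw [Matrix.mul_add, Matrix.mul_smul, Matrix.mul_one]
      rw [h4, h3, Matrix.sub_mul, Matrix.smul_mul, Matrix.one_mul, sub_add_cancel]
    exact key ⟨i, hi⟩
  · obtain ⟨f, g, hl, hfg⟩ := leg_reg hi (z0 S i) (P := 1) (Q := 1) (by simp) (by simp)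
    obtain ⟨φ, φi, h1, h2, h3⟩ := legsim (hM.legR i hi (z0 S i)) hl (lt_empty _ i (z0 S i))
    refine orb_of (P := φ) (Q := φi) (R' := bd S i (S.R i)) ?_ h1 h2 ?_ ?_
    · rw [hAR i hi, reg_kk hi]
      intro a b
      exact lt_of_le_of_lt Polynomial.degree_C_le (by norm_num)
    · rw [reg_Ohat hi]
      have h5 := hresR i hi
      rw [res_ps, reg_kk hi] at h5
      change cf 0 (ps (A i)) = _ at h5
      rw [cf_mul_cst, cf_cst_mul, h5]
      rw [hfg, Matrix.one_mul, Matrix.mul_one] at h3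
      change φ * (rFM M i (z0 S i) * rGM M i (z0 S i)) = _ at h3
      have h4 : φ * (rFM M i (z0 S i) * rGM M i (z0 S i) + xe S i (z0 S i) 0 • 1) =
        bd S i (S.R i) * φ := by
        rw [Matrix.mul_add, Matrix.mul_smul, Matrix.mul_one, h3, Matrix.sub_mul, Matrix.smul_mul,
          Matrix.one_mul, sub_add_cancel]
      exact (congrArg (fun Z => Z * φi) h4).trans (by
        show _ * _ * _ = _
        rw [Matrix.mul_assoc]
        refine (congrArg _ h1).trans ?_
        exact Matrix.mul_one _)
    · intro j
      exact ⟨1, 1, by simp, by simp, by simp⟩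
end
end

noncomputable section
set_option linter.unusedSimpArgs false
set_option linter.unusedSectionVars false

section
variable {S : Setup}

/-- A block-diagonal equivalence between two representations. -/
structure Eqv (M N : AR S) (h h' : Irr S → Mn S)
    (ψ ψ' : ∀ (i : Fin (S.p+1)) (j : Fin (S.m i)) (κ : ℕ), Matrix (Fin (rk S i j κ)) (Fin (rk S i j κ)) ℂ) :
    Prop where
  hh' : ∀ i, h i * h' i = 1
  h'h : ∀ i, h' i * h i = 1
  b : ∀ i, blk (qn S i.1) (h i)
  b' : ∀ i, blk (qn S i.1) (h' i)
  pp' : ∀ i j κ, ψ i j κ * ψ' i j κ = 1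
  p'p : ∀ i j κ, ψ' i j κ * ψ i j κ = 1
  X : ∀ i t, XM N i t * h i = h i * XM M i t
  C : ∀ i : Irr S, i.1 ≠ 0 → CM N i * h (i0 S) = h i * CM M i
  Cs : ∀ i : Irr S, i.1 ≠ 0 → CsM N i * h i = h (i0 S) * CsM M i
  bF : ∀ (i : Irr S) j, bFM N i j * ψ i.1 j 0 = sub S i.1 i.1 (h i) j j * bFM M i j
  bG : ∀ (i : Irr S) j, bGM N i j * sub S i.1 i.1 (h i) j j = ψ i.1 j 0 * bGM M i j
  rF : ∀ i, ¬ Iirr S i → ∀ j, rFM N i j * ψ i j 0 = h (i0 S) * rFM M i j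
  rG : ∀ i, ¬ Iirr S i → ∀ j, rGM N i j * h (i0 S) = ψ i j 0 * rGM M i j
  lF : ∀ i j κ, lFM N i j κ * ψ i j (κ+1) = ψ i j κ * lFM M i j κ
  lG : ∀ i j κ, lGM N i j κ * ψ i j κ = ψ i j (κ+1) * lGM M i j κ

/-- the induced family of base changes -/
def gam (h : Irr S → Mn S)
    (ψ : ∀ (i : Fin (S.p+1)) (j : Fin (S.m i)) (κ : ℕ), Matrix (Fin (rk S i j κ)) (Fin (rk S i j κ)) ℂ) :
    ∀ a : V S, Matrix (Fin (alN S a)) (Fin (alN S a)) ℂ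
  | .inl ⟨i, j⟩ => sub S i.1 i.1 (h i) j j
  | .inr ⟨i, j, κ⟩ => ψ i j κ.val

theorem gam_one {h h' : Irr S → Mn S} (hh : ∀ i, h i * h' i = 1) (hb : ∀ i, blk (qn S i.1) (h i))
    {ψ ψ' : ∀ (i : Fin (S.p+1)) (j : Fin (S.m i)) (κ : ℕ), Matrix (Fin (rk S i j κ)) (Fin (rk S i j κ)) ℂ}
    (hp : ∀ i j κ, ψ i j κ * ψ' i j κ = 1) : ∀ a, gam h ψ a * gam h' ψ' a = 1 := by
  rintro (⟨i, j⟩ | ⟨i, j, κ⟩)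
  · show sub S i.1 i.1 (h i) j j * sub S i.1 i.1 (h' i) j j = 1
    rw [← sub_blk_mul (hb i), hh, sub_one_same]
  · exact hp i j κ

theorem Eqv.rep {M N : AR S} {h h' : Irr S → Mn S}
    {ψ ψ' : ∀ (i : Fin (S.p+1)) (j : Fin (S.m i)) (κ : ℕ), Matrix (Fin (rk S i j κ)) (Fin (rk S i j κ)) ℂ}
    (E : Eqv M N h h' ψ ψ') : repConj S M N := by
  have key : ∀ a b : V S, ∀ t < arr S a b, Ft N a b t * gam h ψ a = gam h ψ b * Ft M a b t ∧
      Gt N a b t * gam h ψ b = gam h ψ a * Gt M a b t := by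
    rintro (⟨i, j⟩ | ⟨i, j, κ⟩) (⟨i', j'⟩ | ⟨i', j', κ'⟩) t ht
    · by_cases hi : i = i'
      · subst hi
        have h1 := arr_II i j j'
        have ht' : t < if j < j' then dcnt S i.1 j j' else 0 := lt_of_lt_of_eq ht h1
        have hj : j < j' := by by_contra hc; rw [if_neg hc] at ht'; omega
        refine ⟨?_, ?_⟩
        · have := congrArg (fun Z => sub S i.1 i.1 Z j' j) (E.X i t)
          simp only [sub_mul_blk (E.b i), sub_blk_mul (E.b i), XM_lt _ _ _ hj] at this
          exact this
        · have := congrArg (fun Z => sub S i.1 i.1 Z j j') (E.X i t)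
          simp only [sub_mul_blk (E.b i), sub_blk_mul (E.b i), XM_gt _ _ _ hj] at this
          exact this
      · by_cases h0 : i.1 = 0 ∧ i'.1 ≠ 0
        · obtain ⟨h0, h2⟩ := h0
          obtain rfl : i = i0 S := Subtype.ext h0
          have h1 := arr_0I i' h2 j j'
          obtain rfl : t = 0 := Nat.lt_one_iff.1 (lt_of_lt_of_eq ht h1)
          refine ⟨?_, ?_⟩
          · have := congrArg (fun Z => sub S i'.1 0 Z j' j) (E.C i' h2)
            simp only [sub_mul_blk (E.b (i0 S)), sub_blk_mul (E.b i'), sub_CM] at this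
            exact this
          · have := congrArg (fun Z => sub S 0 i'.1 Z j j') (E.Cs i' h2)
            simp only [sub_mul_blk (E.b i'), sub_blk_mul (E.b (i0 S)), sub_CsM] at this
            exact this
        · have h1 := arr_ne i i' hi h0 j j'
          exact absurd (lt_of_lt_of_eq ht h1) (by omega)
    · exact absurd (lt_of_lt_of_eq ht (arr_lr _ _)) (by omega)
    · by_cases c1 : i = i'.1 ∧ j.val = j'.val ∧ κ.val = 0
      · obtain ⟨rfl, h2, h3⟩ := c1
        obtain rfl := Fin.ext h2
        have hκ : 0 < S.e i'.1 j - 1 := by have := κ.2; omega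
        obtain rfl : κ = ⟨0, hκ⟩ := Fin.ext h3
        have h1 := arr_rI i' j ⟨0, hκ⟩
        rw [if_pos rfl] at h1
        obtain rfl : t = 0 := Nat.lt_one_iff.1 (lt_of_lt_of_eq ht h1)
        have e1 := E.bF i' j
        have e2 := E.bG i' j
        rw [bFM, dif_pos hκ, bFM, dif_pos hκ] at e1
        rw [bGM, dif_pos hκ, bGM, dif_pos hκ] at e2
        exact ⟨e1, e2⟩
      · by_cases c2 : ¬ Iirr S i ∧ i'.1 = 0 ∧ κ.val = 0
        · obtain ⟨hi, h2, h3⟩ := c2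
          obtain rfl : i' = i0 S := Subtype.ext h2
          have hκ : 0 < S.e i j - 1 := by have := κ.2; omega
          obtain rfl : κ = ⟨0, hκ⟩ := Fin.ext h3
          have h1 := arr_r0 i hi j ⟨0, hκ⟩ j'
          rw [if_pos rfl] at h1
          obtain rfl : t = 0 := Nat.lt_one_iff.1 (lt_of_lt_of_eq ht h1)
          refine ⟨?_, ?_⟩
          · have := congrArg (fun Z => rsub S 0 Z j') (E.rF i hi j)
            simp only [rsub_mul, rsub_blk_mul (E.b (i0 S)), rsub_rFM _ i j hκ] at this
            exact this
          · have := congrArg (fun Z => csub S 0 Z j') (E.rG i hi j)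
            simp only [csub_mul, csub_mul_blk (E.b (i0 S)), csub_rGM _ i j hκ] at this
            exact this
        · exact absurd (lt_of_lt_of_eq ht (arr_rl_zero _ _ _ _ _ c1 c2)) (by omega)
    · by_cases c1 : i = i' ∧ j.val = j'.val ∧ κ.val = κ'.val + 1
      · obtain ⟨rfl, h2, h3⟩ := c1
        obtain rfl := Fin.ext h2
        have hκ : κ'.val + 1 < S.e i j - 1 := by have := κ.2; omega
        obtain rfl : κ = ⟨κ'.val + 1, hκ⟩ := Fin.ext h3
        have h1 := arr_rr i j ⟨κ'.val + 1, hκ⟩ κ'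
        rw [if_pos rfl] at h1
        obtain rfl : t = 0 := Nat.lt_one_iff.1 (lt_of_lt_of_eq ht h1)
        have e1 := E.lF i j κ'.val
        have e2 := E.lG i j κ'.val
        rw [lFM, dif_pos hκ, lFM, dif_pos hκ] at e1
        rw [lGM, dif_pos hκ, lGM, dif_pos hκ] at e2
        exact ⟨e1, e2⟩
      · exact absurd (lt_of_lt_of_eq ht (arr_rr_zero _ _ _ _ _ _ c1)) (by omega)
  exact repConj_of (gam h ψ) (gam h' ψ') (gam_one E.hh' E.b E.pp') (gam_one E.h'h E.b' E.p'p)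
    (fun a b t ht => (key a b t ht).1) (fun a b t ht => (key a b t ht).2)

/-- The part of an equivalence that is needed to go back to tuples. -/
structure Eqw (M N : AR S) (h h' : Irr S → Mn S) : Prop where
  hh' : ∀ i, h i * h' i = 1
  h'h : ∀ i, h' i * h i = 1
  b : ∀ i, blk (qn S i.1) (h i)
  b' : ∀ i, blk (qn S i.1) (h' i)
  X : ∀ i t, XM N i t * h i = h i * XM M i t
  C : ∀ i : Irr S, i.1 ≠ 0 → CM N i * h (i0 S) = h i * CM M i
  Cs : ∀ i : Irr S, i.1 ≠ 0 → CsM N i * h i = h (i0 S) * CsM M i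
  r : ∀ i, ¬ Iirr S i → ∀ j, rFM N i j * rGM N i j * h (i0 S) = h (i0 S) * (rFM M i j * rGM M i j)

theorem repConj.eqw {M N : AR S} (H : repConj S M N) : ∃ h h', Eqw M N h h' := by
  obtain ⟨γ, γi, h1, h2, hF, hG⟩ := repConj_dest H
  let h : Irr S → Mn S := fun i => bd S i.1 fun j => γ (vI S i j)
  let h' : Irr S → Mn S := fun i => bd S i.1 fun j => γi (vI S i j)
  have hs : ∀ i j, sub S i.1 i.1 (h i) j j = γ (vI S i j) := fun i j => sub_bd_same _ _ _
  have hb : ∀ i, blk (qn S i.1) (h i) := fun i => blk_bd _ _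
  have hs0 : ∀ j, sub S 0 0 (h (i0 S)) j j = γ (v0 S j) := fun j => hs (i0 S) j
  have hb0 : blk (qn S 0) (h (i0 S)) := hb (i0 S)
  refine ⟨h, h', fun i => bd_mul_one fun j => h1 _, fun i => bd_mul_one fun j => h2 _, hb,
    fun i => blk_bd _ _, fun i t => ?_, fun i hi => ?_, fun i hi => ?_, fun i hi j => ?_⟩
  · refine sub_ext (i := i.1) (i' := i.1) fun j j' => ?_
    rw [sub_mul_blk (hb i), sub_blk_mul (hb i), hs, hs]
    rcases lt_trichotomy j j' with hj | rfl | hj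
    · rw [XM_gt _ _ _ hj, XM_gt _ _ _ hj]; exact hG _ _ t
    · rw [XM_eq, XM_eq]; simp
    · rw [XM_lt _ _ _ hj, XM_lt _ _ _ hj]; exact hF _ _ t
  · refine sub_ext (i := i.1) (i' := 0) fun j j' => ?_
    rw [sub_mul_blk hb0, sub_blk_mul (hb i), hs, hs0, sub_CM, sub_CM]; exact hF _ _ 0
  · refine sub_ext (i := 0) (i' := i.1) fun j j' => ?_
    rw [sub_mul_blk (hb i), sub_blk_mul hb0, hs, hs0, sub_CsM, sub_CsM]; exact hG _ _ 0
  · by_cases he : 0 < S.e i j - 1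
    · let c : Matrix (Fin (rk S i j 0)) (Fin (rk S i j 0)) ℂ := γ (Sum.inr ⟨i, j, ⟨0, he⟩⟩)
      have e1 : rFM N i j * c = h (i0 S) * rFM M i j := by
        refine rsub_ext (i := 0) fun j' => ?_
        rw [rsub_mul, rsub_blk_mul hb0, hs0, rsub_rFM _ i j he, rsub_rFM _ i j he]; exact hF _ _ 0
      have e2 : rGM N i j * h (i0 S) = c * rGM M i j := by
        refine csub_ext (i := 0) fun j' => ?_
        rw [csub_mul_blk hb0, csub_mul, hs0, csub_rGM _ i j he, csub_rGM _ i j he]; exact hG _ _ 0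
      rw [Matrix.mul_assoc, e2, ← Matrix.mul_assoc, e1, Matrix.mul_assoc]
    · rw [rFM, dif_neg he, rFM, dif_neg he]; simp
end
end

noncomputable section
set_option linter.unusedSimpArgs false
set_option linter.unusedSectionVars false

section
variable {S : Setup}

theorem mcanc {m n r : Type} {R : Type} [CommRing R] [Fintype m] [DecidableEq m] [Fintype n] [DecidableEq n]
    {a : Matrix m n R} {b : Matrix n m R}
    (h : a * b = 1) (Z : Matrix m r R) : a * (b * Z) = Z := by
  rw [← Matrix.mul_assoc, h, Matrix.one_mul]

section
variable {A A' : Fin (S.p+1) → PMat S} {M M' : AR S} {P Q R1 P' Q' R2 : Irr S → Mn S}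

theorem compat1 (H : Rl A M P Q R1) (H' : Rl A' M' P' Q' R2) (hM : Val M) (hM' : Val M')
    (hs : ∑ i, resMat S i (A i) = 0) (hs' : ∑ i, resMat S i (A' i) = 0)
    {γ γ' : Mn S} (g1 : γ * γ' = 1) (g2 : γ' * γ = 1)
    (hA : ∀ i, ps (A' i) = cst γ * ps (A i) * cst γ') : repConj S M M' := by
  let h : Irr S → Mn S := fun i => P' i * γ * Q i
  let h' : Irr S → Mn S := fun i => P i * γ' * Q' i
  have hh' : ∀ i, h i * h' i = 1 := fun i => by
    simp only [h, h', Matrix.mul_assoc, mcanc (H.qp i), mcanc g1, H'.pq]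
  have h'h : ∀ i, h' i * h i = 1 := fun i => by
    simp only [h, h', Matrix.mul_assoc, mcanc (H'.qp i), mcanc g2, H.pq]
  have hres : ∀ i, resMat S i (A' i) = γ * resMat S i (A i) * γ' := fun i => by
    rw [res_ps, hA, ← cf_PAQ]
  have cqp : ∀ i, cst (Q i) * cst (P i) = 1 := fun i => by rw [← cst_mul, H.qp, cst_one]
  have cB : ∀ i : Irr S, cst (P' i) * ps (A' i.1) * cst (Q' i) =
      cst (h i) * (cst (P i) * ps (A i.1) * cst (Q i)) * cst (h' i) := by
    intro i
    rw [hA]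
    simp only [h, h', cst_mul, Matrix.mul_assoc, mcanc (cqp i)]
  have chh' : ∀ i, cst (h i) * cst (h' i) = 1 := fun i => by rw [← cst_mul, hh', cst_one]
  have ch'h : ∀ i, cst (h' i) * cst (h i) = 1 := fun i => by rw [← cst_mul, h'h, cst_one]
  have hb : ∀ i, blk (qn S i.1) (h i) := by
    intro i
    refine stab (fun _ => S.hq0 i.1 _) (fun _ => S.hq1 i.1 _) (fun _ => S.hqdeg i.1 _) (H.oh i) (H'.oh i) ?_
    rw [cB, Matrix.mul_assoc (cst (h i) * _), ch'h, Matrix.mul_one, sub_self]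
    exact dv_zero_right _
  have hb' : ∀ i, blk (qn S i.1) (h' i) := by
    intro i
    refine stab (fun _ => S.hq0 i.1 _) (fun _ => S.hq1 i.1 _) (fun _ => S.hqdeg i.1 _) (H'.oh i) (H.oh i) ?_
    rw [cB, Matrix.mul_assoc (cst (h i)), mcanc (ch'h i), sub_self]
    exact dv_zero_right _
  have hX : ∀ i t, XM M' i t * h i = h i * XM M i t := by
    intro i t
    rw [← H'.ph i, cB, (Ph_spec S i.1).equiv _ _ _ _ (H.oh i) (hh' i) (h'h i) (hb i) (hb' i), H.ph,
      Matrix.mul_assoc _ (h' i), h'h, Matrix.mul_one]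
  have hC : ∀ i : Irr S, i.1 ≠ 0 → CM M' i * h (i0 S) = h i * CM M i := by
    intro i hi
    rw [H.c i hi, H'.c i hi]
    simp only [h, Matrix.mul_assoc, mcanc (H'.qp _), mcanc (H.qp _)]
  have hCs : ∀ i : Irr S, i.1 ≠ 0 → CsM M' i * h i = h (i0 S) * CsM M i := by
    intro i hi
    rw [H.cs i hi, H'.cs i hi, hres, Matrix.neg_mul, Matrix.mul_neg]
    simp only [h, Matrix.mul_assoc, mcanc (H'.qp _), mcanc (H.qp _), mcanc g2]
  have blR : ∀ (i : Irr S) j, sub S i.1 i.1 (h i) j j * sub S i.1 i.1 (R1 i) j j =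
      sub S i.1 i.1 (R2 i) j j * sub S i.1 i.1 (h i) j j := by
    intro i j
    have e : sub S i.1 i.1 (R2 i) j j = sub S i.1 i.1 (h i * R1 i * h' i) j j := by
      ext x y
      have o1 := H'.oh i
      have o2 := (H.oh i).conj (hh' i) (h'h i) (hb i) (hb' i)
      rw [← cB] at o2
      have m1 := (Ph_spec S i.1).moment _ _ o1 (S.emb i.1 ⟨j, x⟩) (S.emb i.1 ⟨j, y⟩) (by simp)
      have m2 := (Ph_spec S i.1).moment _ _ o2 (S.emb i.1 ⟨j, x⟩) (S.emb i.1 ⟨j, y⟩) (by simp)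
      exact m1.trans m2.symm
    rw [e, ← sub_mul_blk (hb i), Matrix.mul_assoc, h'h, Matrix.mul_one, sub_blk_mul (hb i)]
  have val : ∀ {M : AR S} {A : Fin (S.p+1) → PMat S} {P Q R}, Rl A M P Q R → Val M →
      (∑ i, resMat S i (A i) = 0) → ∀ (i : Irr S) j,
      sub S i.1 i.1 (R i) j j = bFM M i j * bGM M i j + xe S i.1 j 0 • 1 := by
    intro M A P Q R H hM hs i
    by_cases h0 : i.1 = 0
    · obtain rfl : i = i0 S := Subtype.ext h0
      exact fun j => (H.m0 hs j).2 (hM.v0 j)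
    · exact fun j => (H.mI i h0 j).2 (hM.vI i h0 j)
  have hψ : ∀ i j, ∃ ψ ψ' : ∀ κ : ℕ, Matrix (Fin (rk S i j κ)) (Fin (rk S i j κ)) ℂ,
      (∀ κ, ψ κ * ψ' κ = 1) ∧ (∀ κ, ψ' κ * ψ κ = 1) ∧
      (∀ i' : Irr S, ∀ e : i'.1 = i, ∀ j' : Fin (S.m i'.1), j'.val = j.val →
         ∃ χ : Matrix (Fin (rk S i'.1 j' 0)) (Fin (rk S i'.1 j' 0)) ℂ, HEq χ (ψ 0) ∧
           bFM M' i' j' * χ = sub S i'.1 i'.1 (h i') j' j' * bFM M i' j' ∧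
           bGM M' i' j' * sub S i'.1 i'.1 (h i') j' j' = χ * bGM M i' j') ∧
      (¬ Iirr S i → rFM M' i j * ψ 0 = h (i0 S) * rFM M i j ∧ rGM M' i j * h (i0 S) = ψ 0 * rGM M i j) ∧
      (∀ κ, lFM M' i j κ * ψ (κ+1) = ψ κ * lFM M i j κ) ∧
      (∀ κ, lGM M' i j κ * ψ κ = ψ (κ+1) * lGM M i j κ) := by
    intro i j
    by_cases hi : Iirr S i
    · obtain ⟨i, rfl⟩ : ∃ i' : Irr S, i'.1 = i := ⟨⟨i, hi⟩, rfl⟩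
      have p1 : sub S i.1 i.1 (h i) j j * sub S i.1 i.1 (h' i) j j = 1 := by
        rw [← sub_blk_mul (hb i), hh', sub_one_same]
      have p2 : sub S i.1 i.1 (h' i) j j * sub S i.1 i.1 (h i) j j = 1 := by
        rw [← sub_blk_mul (hb' i), h'h, sub_one_same]
      have p3 := blR i j
      rw [val H hM hs, val H' hM' hs', Matrix.mul_add, Matrix.add_mul, Matrix.mul_smul, Matrix.smul_mul,
        Matrix.mul_one, Matrix.one_mul, add_left_inj] at p3
      obtain ⟨ψ, ψi, e1, e2, e3, e4, e5, e6⟩ := legiso (hM.legI i j) (hM'.legI i j) p1 p2 p3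
      refine ⟨fun κ => ψ (κ+1), fun κ => ψi (κ+1), fun κ => e3 _, fun κ => e4 _, ?_, fun hc => absurd hi hc,
        fun κ => (e5 (κ+1)).symm, fun κ => (e6 (κ+1)).symm⟩
      intro i' e j' ej
      obtain rfl := Subtype.ext e
      obtain rfl := Fin.ext ej
      refine ⟨ψ 1, HEq.rfl, ?_, ?_⟩
      · have := e5 0
        rw [e1] at this
        exact this.symm
      · have := e6 0
        rw [e1] at this
        exact this.symm
    · obtain rfl := eq_z0 hi j
      have p3 : h (i0 S) * (rFM M i (z0 S i) * rGM M i (z0 S i)) =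
          rFM M' i (z0 S i) * rGM M' i (z0 S i) * h (i0 S) := by
        have q1 := H.rg i hi
        have q2 := H'.rg i hi
        have q3 : h (i0 S) * (P (i0 S) * resMat S i (A i) * Q (i0 S)) =
            (P' (i0 S) * resMat S i (A' i) * Q' (i0 S)) * h (i0 S) := by
          rw [hres]
          simp only [h, Matrix.mul_assoc, mcanc (H'.qp _), mcanc (H.qp _), mcanc g2]
        rw [q1, q2, Matrix.mul_add, Matrix.add_mul, Matrix.mul_smul, Matrix.smul_mul,
          Matrix.mul_one, Matrix.one_mul, add_left_inj] at q3
        exact q3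
      obtain ⟨ψ, ψi, e1, e2, e3, e4, e5, e6⟩ := legiso (hM.legR i hi (z0 S i)) (hM'.legR i hi (z0 S i))
        (hh' (i0 S)) (h'h (i0 S)) p3
      refine ⟨fun κ => ψ (κ+1), fun κ => ψi (κ+1), fun κ => e3 _, fun κ => e4 _, ?_, fun _ => ⟨?_, ?_⟩,
        fun κ => (e5 (κ+1)).symm, fun κ => (e6 (κ+1)).symm⟩
      · intro i' e
        exact absurd (e ▸ i'.2) hi
      · have := e5 0
        rw [e1] at this
        exact this.symm
      · have := e6 0
        rw [e1] at this
        exact this.symm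
  choose ψ ψ' k1 k2 k3 k4 k5 k6 using hψ
  refine Eqv.rep (h := h) (h' := h') (ψ := ψ) (ψ' := ψ') ⟨hh', h'h, hb, hb', k1, k2, hX, hC, hCs,
    fun i j => ?_, fun i j => ?_, fun i hi j => (k4 i j hi).1, fun i hi j => (k4 i j hi).2, k5, k6⟩
  · obtain ⟨χ, e, e1, e2⟩ := k3 i.1 j i rfl j rfl
    obtain rfl := eq_of_heq e
    exact e1
  · obtain ⟨χ, e, e1, e2⟩ := k3 i.1 j i rfl j rfl
    obtain rfl := eq_of_heq e
    exact e2

theorem compat2 (H : Rl A M P Q R1) (H' : Rl A' M' P' Q' R2)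
    (hs : ∑ i, resMat S i (A i) = 0) (hs' : ∑ i, resMat S i (A' i) = 0)
    (hd : ∀ i, degLT S (S.kk i) (A i)) (hd' : ∀ i, degLT S (S.kk i) (A' i))
    {h h' : Irr S → Mn S} (E : Eqw M M' h h') :
    ∃ γ γ' : Mn S, γ * γ' = 1 ∧ γ' * γ = 1 ∧
      ∀ i, A' i = γ.map Polynomial.C * A i * γ'.map Polynomial.C := by
  let γ : Mn S := Q' (i0 S) * h (i0 S) * P (i0 S)
  let γ' : Mn S := Q (i0 S) * h' (i0 S) * P' (i0 S)
  have g1 : γ * γ' = 1 := by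
    simp only [γ, γ', Matrix.mul_assoc, mcanc (H.pq _), mcanc (E.hh' _), H'.qp]
  have g2 : γ' * γ = 1 := by
    simp only [γ, γ', Matrix.mul_assoc, mcanc (H'.pq _), mcanc (E.h'h _), H.qp]
  have hg : ∀ i, Q' i * h i * P i = γ := by
    intro i
    by_cases h0 : i.1 = 0
    · obtain rfl : i = i0 S := Subtype.ext h0
      rfl
    · have := E.C i h0
      rw [H.c i h0, H'.c i h0] at this
      have t := congrArg (fun Z => Q' i * Z * P (i0 S)) this
      simp only [Matrix.mul_assoc, mcanc (H'.qp _), H.qp, Matrix.mul_one] at t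
      simp only [γ, Matrix.mul_assoc]
      exact t.symm
  have hg' : ∀ i, Q i * h' i * P' i = γ' := by
    intro i
    have e1 : (Q i * h' i * P' i) * γ = 1 := by
      rw [← hg i]
      simp only [Matrix.mul_assoc, mcanc (H'.pq _), mcanc (E.h'h _), H.qp]
    exact left_inv_eq_right_inv e1 g1
  have regc : ∀ i, ¬ Iirr S i → (rFM M' i (z0 S i) * rGM M' i (z0 S i) + xe S i (z0 S i) 0 • (1 : Mn S)) * h (i0 S) =
     h (i0 S) * (rFM M i (z0 S i) * rGM M i (z0 S i) + xe S i (z0 S i) 0 • (1 : Mn S)) := by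
    intro i hi
    rw [Matrix.mul_add, Matrix.add_mul, Matrix.mul_smul, Matrix.smul_mul, Matrix.mul_one, Matrix.one_mul,
      E.r i hi]
  have hres : ∀ i : Irr S, (P' i * resMat S i.1 (A' i.1) * Q' i) * h i =
      h i * (P i * resMat S i.1 (A i.1) * Q i) := by
    intro i
    by_cases h0 : i.1 = 0
    · obtain rfl : i = i0 S := Subtype.ext h0
      have t := H.sumY
      have t' := H'.sumY
      rw [hs, Matrix.mul_zero, Matrix.zero_mul] at t
      rw [hs', Matrix.mul_zero, Matrix.zero_mul] at t'
      have s1 : h (i0 S) * (∑ i ∈ Finset.univ.filter (fun i : Irr S => i.1 ≠ 0), CsM M i * CM M i) =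
         (∑ i ∈ Finset.univ.filter (fun i : Irr S => i.1 ≠ 0), CsM M' i * CM M' i) * h (i0 S) := by
        rw [Finset.mul_sum, Finset.sum_mul]
        refine Finset.sum_congr rfl fun i hi => ?_
        have hi' := (Finset.mem_filter.1 hi).2
        rw [Matrix.mul_assoc (CsM M' i), E.C i hi', ← Matrix.mul_assoc (CsM M' i), E.Cs i hi', Matrix.mul_assoc]
      have s2 : h (i0 S) * (∑ i ∈ Finset.univ.filter (fun i : Fin (S.p+1) => ¬ Iirr S i),
          (rFM M i (z0 S i) * rGM M i (z0 S i) + xe S i (z0 S i) 0 • (1 : Mn S))) =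
         (∑ i ∈ Finset.univ.filter (fun i : Fin (S.p+1) => ¬ Iirr S i),
          (rFM M' i (z0 S i) * rGM M' i (z0 S i) + xe S i (z0 S i) 0 • (1 : Mn S))) * h (i0 S) := by
        rw [Finset.mul_sum, Finset.sum_mul]
        refine Finset.sum_congr rfl fun i hi => (regc i (Finset.mem_filter.1 hi).2).symm
      have t2 := congrArg (fun Z => h (i0 S) * Z) t
      have t2' := congrArg (fun Z => Z * h (i0 S)) t'
      simp only [Matrix.mul_zero, Matrix.mul_add, Matrix.mul_sub] at t2
      simp only [Matrix.zero_mul, Matrix.add_mul, Matrix.sub_mul] at t2'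
      rw [s1, s2] at t2
      have t3 := t2'.symm.trans t2
      rw [add_left_inj, sub_left_inj] at t3
      exact t3
    · rw [H.YI i h0, H'.YI i h0, Matrix.neg_mul, Matrix.mul_neg, Matrix.mul_assoc, E.Cs i h0,
        ← Matrix.mul_assoc, E.C i h0, Matrix.mul_assoc]
  have cqp : ∀ i, cst (Q' i) * cst (P' i) = 1 := fun i => by rw [← cst_mul, H'.qp, cst_one]
  refine ⟨γ, γ', g1, g2, fun i => deg_uniq (hd' i) (deg_conj (hd i) _ _) ?_⟩
  rw [ps_mul, ps_mul, ps_C, ps_C]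
  by_cases hi : Iirr S i
  · obtain ⟨i, rfl⟩ : ∃ i' : Irr S, i'.1 = i := ⟨⟨i, hi⟩, rfl⟩
    have o2 := (H.oh i).conj (E.hh' i) (E.h'h i) (E.b i) (E.b' i)
    have e1 : Ph S i.1 (cst (P' i) * ps (A' i.1) * cst (Q' i)) =
        Ph S i.1 (cst (h i) * (cst (P i) * ps (A i.1) * cst (Q i)) * cst (h' i)) := by
      funext t
      rw [H'.ph, (Ph_spec S i.1).equiv _ _ _ _ (H.oh i) (E.hh' i) (E.h'h i) (E.b i) (E.b' i), H.ph, ← E.X,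
        Matrix.mul_assoc, E.hh', Matrix.mul_one]
    have e2 : cf (S.kk i.1 - 1) (cst (P' i) * ps (A' i.1) * cst (Q' i)) =
        cf (S.kk i.1 - 1) (cst (h i) * (cst (P i) * ps (A i.1) * cst (Q i)) * cst (h' i)) := by
      rw [cf_PAQ, cf_mul_cst, cf_cst_mul, cf_PAQ, ← hres i, Matrix.mul_assoc _ (h i) (h' i), E.hh', Matrix.mul_one]
    have d := (Ph_spec S i.1).inj _ _ _ _ (H'.oh i) o2 e1 e2
    have d2 := (d.mul_left (cst (Q' i))).mul_right (cst (P' i))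
    have w1 : cst (Q' i) * (cst (P' i) * ps (A' i.1) * cst (Q' i)) * cst (P' i) = ps (A' i.1) := by
      simp only [Matrix.mul_assoc, cqp, mcanc (cqp i), Matrix.mul_one]
    have w2 : cst (Q' i) * (cst (h i) * (cst (P i) * ps (A i.1) * cst (Q i)) * cst (h' i)) * cst (P' i) =
        cst γ * ps (A i.1) * cst γ' := by
      rw [← hg i, ← hg' i]
      simp only [cst_mul, Matrix.mul_assoc]
    rw [Matrix.mul_sub, Matrix.sub_mul, w1, w2] at d2
    exact d2
  · rw [reg_kk hi, dv_iff]
    intro n hn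
    obtain rfl : n = 0 := by omega
    have e0 : cf 0 (ps (A' i) - cst γ * ps (A i) * cst γ') = cf 0 (ps (A' i)) - γ * cf 0 (ps (A i)) * γ' := by
      rw [← cf_cst_mul, ← cf_mul_cst]
      ext a b; exact map_sub (PowerSeries.coeff (R := ℂ) 0) _ _
    have r0 : resMat S i (A i) = cf 0 (ps (A i)) := by rw [res_ps, reg_kk hi]
    have r0' : resMat S i (A' i) = cf 0 (ps (A' i)) := by rw [res_ps, reg_kk hi]
    rw [e0, ← r0, ← r0', sub_eq_zero]
    have q := regc i hi
    rw [← H.rg i hi, ← H'.rg i hi] at q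
    have t := congrArg (fun Z => Q' (i0 S) * Z * h' (i0 S) * P' (i0 S)) q
    simp only [Matrix.mul_assoc, mcanc (H'.qp _), mcanc (E.hh' _), H'.qp, Matrix.mul_one] at t
    rw [t]
    simp only [γ, γ', Matrix.mul_assoc]
end

theorem quot_equiv {X Y : Type} (r : X → X → Prop) (s : Y → Y → Prop) (T : X → Y → Prop)
    (hr : ∀ x, r x x) (hs : ∀ y, s y y)
    (tot : ∀ x, ∃ y, T x y) (sur : ∀ y, ∃ x, T x y)
    (c1 : ∀ x x' y y', T x y → T x' y' → r x x' → s y y')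
    (c2 : ∀ x x' y y', T x y → T x' y' → s y y' → r x x') : Nonempty (Quot r ≃ Quot s) := by
  choose f hf using tot
  choose g hg using sur
  exact ⟨{
    toFun := Quot.lift (fun x => Quot.mk s (f x)) fun x x' h => Quot.sound (c1 _ _ _ _ (hf x) (hf x') h)
    invFun := Quot.lift (fun y => Quot.mk r (g y)) fun y y' h => Quot.sound (c2 _ _ _ _ (hg y) (hg y') h)
    left_inv := by
      rintro ⟨x⟩
      exact Quot.sound (c2 _ _ _ _ (hg (f x)) (hf x) (hs _))
    right_inv := by
      rintro ⟨y⟩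
      exact Quot.sound (c1 _ _ _ _ (hf (g y)) (hg y) (hr _)) }⟩

theorem tupConj_refl (A : Fin (S.p+1) → PMat S) : tupConj S A A := by
  refine ⟨1, fun i => ?_⟩
  have : ((1 : Mn S)).map (Polynomial.C : ℂ → ℂ[X]) = 1 := Matrix.map_one _ (map_zero _) (map_one _)
  simp [this]

theorem repConj_refl (M : AR S) : repConj S M M := by
  refine repConj_of (fun _ => 1) (fun _ => 1) (by simp) (by simp) ?_ ?_ <;> intros <;> simp

theorem main (S : Setup) : Nonempty (DSQ S ≃ DifQ S (lam S)) := by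
  refine quot_equiv _ _ (fun (A : DSC S) (M : DifC S (lam S)) => ∃ P Q R', Rl A.1 M.1 P Q R')
    (fun A => tupConj_refl A.1) (fun M => repConj_refl M.1) ?_ ?_ ?_ ?_
  · rintro ⟨A, hA⟩
    obtain ⟨M, hM, h⟩ := total hA
    exact ⟨⟨M, of_val hM⟩, h⟩
  · rintro ⟨M, hM⟩
    obtain ⟨A, hA, h⟩ := surjective (val_of hM.1 hM.2)
    exact ⟨⟨A, hA⟩, h⟩
  · rintro ⟨A, hA⟩ ⟨A', hA'⟩ ⟨M, hM⟩ ⟨M', hM'⟩ ⟨P, Q, R1, H⟩ ⟨P', Q', R2, H'⟩ ⟨g, hg⟩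
    refine compat1 H H' (val_of hM.1 hM.2) (val_of hM'.1 hM'.2) hA.2 hA'.2 (γ := g.val) (γ' := (g⁻¹).val)
      (by simp) (by simp) fun i => ?_
    have := hg i
    rw [this, ps_mul, ps_mul, ps_C, ps_C]
  · rintro ⟨A, hA⟩ ⟨A', hA'⟩ ⟨M, hM⟩ ⟨M', hM'⟩ ⟨P, Q, R1, H⟩ ⟨P', Q', R2, H'⟩ hc
    obtain ⟨h, h', E⟩ := repConj.eqw hc
    obtain ⟨γ, γ', g1, g2, e⟩ := compat2 H H' hA.2 hA'.2 (fun i => (hA.1 i).1) (fun i => (hA'.1 i).1) E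
    exact ⟨⟨γ, γ', g1, g2⟩, e⟩
end
end

/-- There is a bijection `Φ_ξ` from
`{(Σ_j A⁽ⁱ⁾_j x^{-j})_i ∈ ∏ 𝒪_{B⁽ⁱ⁾} : Σ_i A⁽ⁱ⁾₁ = 0}/GL(n,ℂ)` onto
`Rep(Q̄,α)_λ^{dif}/∏_a GL(α_a,ℂ)`. -/
theorem statement3 (S : Setup) : Nonempty (DSQ S ≃ DifQ S (lam S)) := by
  exact main S

end

end DS
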